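/- Let ν > n/2 − 1 and 2 ≤ p ≤ p̃_ν with p < ∞, where p̃_ν = (ν + n − 1)/(n/2 − 1). For every integer m ≥ 1 there is a constant C such that every F ∈ A^p_ν satisfies ∫_{T_Λ} |□F|^p dV_{ν+p} ≤ C ∫_{T_Λ} |□^{m+1} F|^p dV_{ν+(m+1)p}, i.e. ‖□F‖_{L^p_{ν+p}} ≤ C ‖□^{m+1}F‖_{L^p_{ν+(m+1)p}}. -/

import Mathlib

open MeasureTheory Complex Set
open scoped ENNReal

noncomputable section

/-- The Lorentz form `Δ(y) = y₁² − y₂² − ⋯ − yₙ²` on `ℝⁿ`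
(written as `2 y₀² − ∑ yᵢ²` with 0-based indexing). -/
def lor {n : ℕ} [NeZero n] (y : Fin n → ℝ) : ℝ := 2 * y 0 ^ 2 - ∑ i, y i ^ 2

/-- The holomorphic extension of the Lorentz form to `ℂⁿ`. -/
def lorC {n : ℕ} [NeZero n] (z : Fin n → ℂ) : ℂ := 2 * z 0 ^ 2 - ∑ i, z i ^ 2

/-- Componentwise imaginary part. -/
def imP {n : ℕ} (z : Fin n → ℂ) : Fin n → ℝ := fun i => (z i).im

/-- The forward light cone `Λ`. -/
def cone (n : ℕ) [NeZero n] : Set (Fin n → ℝ) := {y | 0 < lor y ∧ 0 < y 0}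

/-- The tube domain `T_Λ` over the forward light cone. -/
def tube (n : ℕ) [NeZero n] : Set (Fin n → ℂ) := {z | imP z ∈ cone n}

/-- The weighted measure `dV_ν = Δ(Im z)^{ν − n/2} dz` on `T_Λ`. -/
def dV (n : ℕ) [NeZero n] (ν : ℝ) : Measure (Fin n → ℂ) :=
  ((volume : Measure (Fin n → ℂ)).restrict (tube n)).withDensity
    (fun z => ENNReal.ofReal (lor (imP z) ^ (ν - (n : ℝ) / 2)))

/-- `∫ |F|^p dV_ν` (as an extended nonnegative real). -/
def lpInt (n : ℕ) [NeZero n] (p ν : ℝ) (F : (Fin n → ℂ) → ℂ) : ℝ≥0∞ :=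
  ∫⁻ z, ENNReal.ofReal (‖F z‖ ^ p) ∂(dV n ν)

/-- The `L^p_ν` norm `(∫ |F|^p dV_ν)^{1/p}`. -/
def lpNorm (n : ℕ) [NeZero n] (p ν : ℝ) (F : (Fin n → ℂ) → ℂ) : ℝ≥0∞ :=
  (lpInt n p ν F) ^ (1 / p)

/-- The Bergman space `A^p_ν`: holomorphic on `T_Λ` and in `L^p_ν`. -/
def memA (n : ℕ) [NeZero n] (p ν : ℝ) (F : (Fin n → ℂ) → ℂ) : Prop :=
  DifferentiableOn ℂ F (tube n) ∧ lpInt n p ν F < ⊤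

/-- Partial derivative `∂/∂zᵢ`. -/
def pd {n : ℕ} (i : Fin n) (F : (Fin n → ℂ) → ℂ) : (Fin n → ℂ) → ℂ :=
  fun z => fderiv ℂ F z (Pi.single i 1)

/-- The wave (Box) operator `□ = −(∂₁² − ∂₂² − ⋯ − ∂ₙ²)`, so that
`□ e^{i z·ξ} = Δ(ξ) e^{i z·ξ}`. -/
def BoxOp {n : ℕ} [NeZero n] (F : (Fin n → ℂ) → ℂ) : (Fin n → ℂ) → ℂ :=
  fun z => -(2 * pd 0 (pd 0 F) z - ∑ i, pd i (pd i F) z)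

/-- The (unnormalized) Bergman kernel `B_β(z,w) = Δ((z − w̄)/i)^{−(β+n)}`. -/
def berg (n : ℕ) [NeZero n] (β : ℝ) (z w : Fin n → ℂ) : ℂ :=
  lorC (fun i => (z i - (starRingEnd ℂ) (w i)) / Complex.I) ^ (-(β + (n : ℝ)) : ℂ)

/-- The Hardy inequality holds for `(p, ν)`:
`∫ |F|^p dV_ν ≤ C ∫ |Δ(Im z) □F(z)|^p dV_ν(z)` for all `F ∈ A^p_ν`. -/
def hardy (n : ℕ) [NeZero n] (p ν : ℝ) : Prop :=
  ∃ C > (0 : ℝ), ∀ F, memA n p ν F →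
    lpInt n p ν F ≤ ENNReal.ofReal C *
      lpInt n p ν (fun z => (lor (imP z) : ℂ) * BoxOp F z)

/-- `g` is the orthogonal projection of `f ∈ L²_ν` onto the closed subspace `A²_ν`:
`g ∈ A²_ν` and `f − g ⊥ A²_ν`. -/
def isProj (n : ℕ) [NeZero n] (ν : ℝ) (f g : (Fin n → ℂ) → ℂ) : Prop :=
  memA n 2 ν g ∧ ∀ h, memA n 2 ν h →
    ∫ z, f z * (starRingEnd ℂ) (h z) ∂(dV n ν) =
      ∫ z, g z * (starRingEnd ℂ) (h z) ∂(dV n ν)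

/-- The Bergman projection `P_ν` admits a bounded extension to `L^p_ν`:
`‖P_ν f‖_{L^p_ν} ≤ C ‖f‖_{L^p_ν}` for all `f ∈ L²_ν ∩ L^p_ν`. -/
def projBounded (n : ℕ) [NeZero n] (p ν : ℝ) : Prop :=
  ∃ C > (0 : ℝ), ∀ f g : (Fin n → ℂ) → ℂ,
    AEStronglyMeasurable f (dV n ν) → lpInt n 2 ν f < ⊤ → lpInt n p ν f < ⊤ →
    isProj n ν f g → lpNorm n p ν g ≤ ENNReal.ofReal C * lpNorm n p ν f

/-- A bounded (continuous) linear functional on `A^p_ν`. -/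
def isBddFunc (n : ℕ) [NeZero n] (p ν : ℝ) (γ : ((Fin n → ℂ) → ℂ) → ℂ) : Prop :=
  (∀ F G, memA n p ν F → memA n p ν G → γ (F + G) = γ F + γ G) ∧
  (∀ (c : ℂ) (F), memA n p ν F → γ (fun z => c * F z) = c * γ F) ∧
  ∃ C : ℝ, ∀ F, memA n p ν F → ‖γ F‖ ≤ C * (lpNorm n p ν F).toReal

section coordinates

variable {d : ℕ}

/-- The light-cone coordinate `y₀ + y₁`. -/
def cA {K : Type*} [Field K] (y : Fin (d + 2) → K) : K := y 0 + y 1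

/-- The light-cone coordinate `y₀ - y₁`. -/
def cS {K : Type*} [Field K] (y : Fin (d + 2) → K) : K := y 0 - y 1

/-- The remaining coordinates `y₂, y₃, …`. -/
def cW {K : Type*} (y : Fin (d + 2) → K) : Fin d → K := fun j => y j.succ.succ

/-- The second Gauss coordinate, so that the Lorentz form is `cA y * cT y`. -/
def cT {K : Type*} [Field K] (y : Fin (d + 2) → K) : K := cS y - (∑ j, cW y j ^ 2) / cA y

/-- The vector with given light-cone coordinates. -/
def mkV {K : Type*} [Field K] (a s : K) (w : Fin d → K) : Fin (d + 2) → K :=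
  Fin.cons ((a + s) / 2) (Fin.cons ((a - s) / 2) w)

/-- The vector with given Gauss coordinates. -/
def mkY (a t : ℝ) (w : Fin d → ℝ) : Fin (d + 2) → ℝ := mkV a (t + (∑ j, w j ^ 2) / a) w

lemma cA_mkV {K : Type*} [Field K] [CharZero K] (a s : K) (w : Fin d → K) : cA (mkV a s w) = a := by
  have : (mkV a s w) 1 = (a - s) / 2 := rfl
  rw [cA, this]; simp [mkV]; ring

lemma cS_mkV {K : Type*} [Field K] [CharZero K] (a s : K) (w : Fin d → K) : cS (mkV a s w) = s := by
  have : (mkV a s w) 1 = (a - s) / 2 := rfl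
  rw [cS, this]; simp [mkV]; ring

lemma cW_mkV {K : Type*} [Field K] (a s : K) (w : Fin d → K) : cW (mkV a s w) = w := by
  ext j; simp [cW, mkV]

lemma cA_mkY (a t : ℝ) (w : Fin d → ℝ) : cA (mkY a t w) = a := cA_mkV _ _ _

lemma cW_mkY (a t : ℝ) (w : Fin d → ℝ) : cW (mkY a t w) = w := cW_mkV _ _ _

lemma cS_mkY (a t : ℝ) (w : Fin d → ℝ) : cS (mkY a t w) = t + (∑ j, w j ^ 2) / a := cS_mkV _ _ _

lemma cT_mkY (a t : ℝ) (w : Fin d → ℝ) : cT (mkY a t w) = t := by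
  simp [cT, cA_mkY, cS_mkY, cW_mkY]

lemma cA_add {K : Type*} [Field K] (x y : Fin (d + 2) → K) : cA (x + y) = cA x + cA y := by
  simp [cA]; ring

lemma cS_add {K : Type*} [Field K] (x y : Fin (d + 2) → K) : cS (x + y) = cS x + cS y := by
  simp [cS]; ring

lemma lor_eq (y : Fin (d + 2) → ℝ) : lor y = cA y * cS y - ∑ j, cW y j ^ 2 := by
  simp [lor, cA, cS, cW, Fin.sum_univ_succ]; ring

lemma lorC_eq (y : Fin (d + 2) → ℂ) : lorC y = cA y * cS y - ∑ j, cW y j ^ 2 := by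
  simp [lorC, cA, cS, cW, Fin.sum_univ_succ]; ring

lemma lor_eq_mul {y : Fin (d + 2) → ℝ} (h : cA y ≠ 0) : lor y = cA y * cT y := by
  rw [lor_eq, cT]; field_simp

lemma lorC_eq_mul {y : Fin (d + 2) → ℂ} (h : cA y ≠ 0) : lorC y = cA y * cT y := by
  rw [lorC_eq, cT]; field_simp

lemma mem_cone_iff {y : Fin (d + 2) → ℝ} : y ∈ cone (d + 2) ↔ 0 < cA y ∧ 0 < cT y := by
  have hq : 0 ≤ ∑ j, cW y j ^ 2 := Finset.sum_nonneg fun _ _ => sq_nonneg _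
  constructor
  · rintro ⟨h1, h2⟩
    have h3 : 0 < cA y := by
      rw [lor_eq] at h1
      have h4 : 0 < cA y * cS y := by linarith
      have h5 : cA y + cS y = 2 * y 0 := by simp [cA, cS]; ring
      by_contra hc
      push Not at hc
      nlinarith
    refine ⟨h3, ?_⟩
    rw [lor_eq_mul h3.ne'] at h1
    exact (pos_iff_pos_of_mul_pos h1).1 h3
  · rintro ⟨h1, h2⟩
    have h3 : 0 < lor y := by rw [lor_eq_mul h1.ne']; positivity
    refine ⟨h3, ?_⟩
    have h4 : cS y = cT y + (∑ j, cW y j ^ 2) / cA y := by rw [cT]; ring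
    have h5 : 0 < cS y := by rw [h4]; positivity
    have h6 : cA y + cS y = 2 * y 0 := by simp [cA, cS]; ring
    linarith

lemma mkY_mem {a t : ℝ} (ha : 0 < a) (ht : 0 < t) (w : Fin d → ℝ) : mkY a t w ∈ cone (d + 2) := by
  rw [mem_cone_iff, cA_mkY, cT_mkY]; exact ⟨ha, ht⟩

lemma continuous_cA : Continuous (cA : (Fin (d + 2) → ℝ) → ℝ) := by unfold cA; fun_prop
lemma continuous_cS : Continuous (cS : (Fin (d + 2) → ℝ) → ℝ) := by unfold cS; fun_prop
lemma continuous_cW : Continuous (cW : (Fin (d + 2) → ℝ) → _) := by unfold cW; fun_prop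
lemma measurable_cT : Measurable (cT : (Fin (d + 2) → ℝ) → ℝ) := by
  unfold cT cS cA cW; fun_prop
lemma continuous_lor {n : ℕ} [NeZero n] : Continuous (lor : (Fin n → ℝ) → ℝ) := by
  unfold lor; fun_prop

lemma isOpen_cone {n : ℕ} [NeZero n] : IsOpen (cone n) :=
  (isOpen_lt continuous_const continuous_lor).inter
    (isOpen_lt continuous_const (continuous_apply 0))

/-- The second Gauss coordinate of a sum: the correction is a nonnegative square. -/
lemma cT_add {x y : Fin (d + 2) → ℝ} (hx : 0 < cA x) (hy : 0 < cA y) :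
    cT (x + y) = cT x + cT y + (cA x * cA y / (cA x + cA y)) *
      ∑ j, (cW x j / cA x - cW y j / cA y) ^ 2 := by
  have e : ∀ j, cW (x + y) j = cW x j + cW y j := fun j => rfl
  simp only [cT, cA_add, cS_add, e]
  have h1 : (∑ j, (cW x j + cW y j) ^ 2) = (∑ j, cW x j ^ 2) + 2 * (∑ j, cW x j * cW y j) +
      ∑ j, cW y j ^ 2 := by
    rw [Finset.mul_sum, ← Finset.sum_add_distrib, ← Finset.sum_add_distrib]
    exact Finset.sum_congr rfl fun j _ => by ring
  have h2 : (∑ j, (cW x j / cA x - cW y j / cA y) ^ 2) = (∑ j, cW x j ^ 2) / cA x ^ 2 -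
      2 * (∑ j, cW x j * cW y j) / (cA x * cA y) + (∑ j, cW y j ^ 2) / cA y ^ 2 := by
    rw [Finset.mul_sum, Finset.sum_div, Finset.sum_div, Finset.sum_div, ← Finset.sum_sub_distrib,
      ← Finset.sum_add_distrib]
    exact Finset.sum_congr rfl fun j _ => by field_simp; ring
  rw [h1, h2]
  have : 0 < cA x + cA y := by positivity
  field_simp
  ring

lemma cT_add_ge {x y : Fin (d + 2) → ℝ} (hx : 0 < cA x) (hy : 0 < cA y) :
    cT x + cT y ≤ cT (x + y) := by
  rw [cT_add hx hy]
  have : 0 ≤ (cA x * cA y / (cA x + cA y)) * ∑ j, (cW x j / cA x - cW y j / cA y) ^ 2 :=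
    mul_nonneg (by positivity) (Finset.sum_nonneg fun _ _ => sq_nonneg _)
  linarith

lemma add_mem_cone {x y : Fin (d + 2) → ℝ} (hx : x ∈ cone (d + 2)) (hy : y ∈ cone (d + 2)) :
    x + y ∈ cone (d + 2) := by
  rw [mem_cone_iff] at *
  refine ⟨by rw [cA_add]; linarith, ?_⟩
  have := cT_add_ge hx.1 hy.1
  linarith

lemma lor_le_add {x y : Fin (d + 2) → ℝ} (hx : x ∈ cone (d + 2)) (hy : y ∈ cone (d + 2)) :
    lor x ≤ lor (x + y) := by
  have hxy := add_mem_cone hx hy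
  rw [mem_cone_iff] at *
  rw [lor_eq_mul hx.1.ne', lor_eq_mul hxy.1.ne']
  have := cT_add_ge hx.1 hy.1
  rw [cA_add]
  have h := hx.1; have h2 := hx.2
  exact mul_le_mul (by linarith) (by linarith) hx.2.le (by linarith)

lemma lintegral_comp_half (f : ℝ → ℝ≥0∞) (c : ℝ) (hf : Measurable f) :
    ∫⁻ x, f x = (1 / 2) * ∫⁻ a, f ((a + c) / 2) := by
  have h1 : ∫⁻ a, f ((a + c) / 2) = ∫⁻ a, f (a / 2) :=
    lintegral_add_right_eq_self (fun a => f (a / 2)) c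
  have h2 := Measure.map_addHaar_smul (volume : Measure ℝ) (r := 1 / 2) (by norm_num)
  have h3 : ∫⁻ a, f (a / 2) = 2 * ∫⁻ x, f x := by
    have : ∫⁻ a, f (a / 2) = ∫⁻ x, f x ∂(Measure.map (fun x : ℝ => (1 / 2 : ℝ) • x) volume) := by
      rw [lintegral_map hf (by fun_prop)]
      refine lintegral_congr fun a => ?_
      rw [smul_eq_mul]; congr 1; ring
    rw [this, h2, lintegral_smul_measure]
    simp
  rw [h1, h3, ← mul_assoc, ENNReal.div_mul_cancel (by simp) (by simp), one_mul]

lemma measurable_mkV : Measurable (fun q : ℝ × ℝ × (Fin d → ℝ) => mkV q.1 q.2.1 q.2.2) := by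
  refine measurable_pi_iff.2 fun i => ?_
  refine Fin.cases ?_ (fun i => Fin.cases ?_ (fun j => ?_) i) i
  · simp only [mkV, Fin.cons_zero]; fun_prop
  · simp only [mkV, Fin.cons_zero, Fin.cons_succ]; fun_prop
  · simp only [mkV, Fin.cons_succ]; fun_prop

lemma measurable_mkY : Measurable (fun q : ℝ × ℝ × (Fin d → ℝ) => mkY q.1 q.2.1 q.2.2) := by
  unfold mkY
  have : Measurable (fun q : ℝ × ℝ × (Fin d → ℝ) => (q.1, (q.2.1 + (∑ j, q.2.2 j ^ 2) / q.1, q.2.2))) := by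
    fun_prop
  exact measurable_mkV.comp this

lemma lintegral_fin_cons {k : ℕ} (f : (Fin (k + 1) → ℝ) → ℝ≥0∞) (hf : Measurable f) :
    ∫⁻ y, f y = ∫⁻ x : ℝ, ∫⁻ w : Fin k → ℝ, f (Fin.cons x w) := by
  have h := (volume_preserving_piFinSuccAbove (fun _ : Fin (k + 1) => ℝ) 0).symm
  rw [← h.lintegral_comp hf, Measure.volume_eq_prod, lintegral_prod]
  · refine lintegral_congr fun x => lintegral_congr fun w => ?_
    congr 1
    exact Fin.insertNth_zero' (β := ℝ) x w
  · exact (hf.comp h.measurable).aemeasurable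

/-- Integration in light-cone coordinates. -/
lemma lintegral_mkV (f : (Fin (d + 2) → ℝ) → ℝ≥0∞) (hf : Measurable f) :
    ∫⁻ y, f y = (1 / 2) * ∫⁻ a, ∫⁻ s, ∫⁻ w, f (mkV a s w) := by
  have hc : Measurable fun q : ℝ × ℝ × (Fin d → ℝ) => f (Fin.cons q.1 (Fin.cons q.2.1 q.2.2)) := by
    refine hf.comp (measurable_pi_iff.2 fun i => ?_)
    refine Fin.cases ?_ (fun i => Fin.cases ?_ (fun j => ?_) i) i <;>
      simp only [Fin.cons_zero, Fin.cons_succ] <;> fun_prop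
  set g : ℝ × ℝ → ℝ≥0∞ := fun q => ∫⁻ w, f (Fin.cons q.1 (Fin.cons q.2 w)) with hg
  have hgm : Measurable g := by
    have : Measurable (fun q : (ℝ × ℝ) × (Fin d → ℝ) => f (Fin.cons q.1.1 (Fin.cons q.1.2 q.2))) := 
      hc.comp (f := fun q : (ℝ × ℝ) × (Fin d → ℝ) => (q.1.1, q.1.2, q.2)) (by fun_prop)
    exact this.lintegral_prod_right'
  have e1 : ∫⁻ y, f y = ∫⁻ x, ∫⁻ y, g (x, y) := by
    rw [lintegral_fin_cons f hf]
    refine lintegral_congr fun x => ?_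
    rw [lintegral_fin_cons]
    exact hf.comp (measurable_pi_iff.2 fun i => by
      refine Fin.cases ?_ (fun j => ?_) i <;> simp only [Fin.cons_zero, Fin.cons_succ] <;> fun_prop)
  have e2 : ∀ x, ∫⁻ y, g (x, y) = ∫⁻ a, g (x, a - x) := fun x =>
    (lintegral_sub_right_eq_self (fun y => g (x, y)) x).symm
  rw [e1]
  simp_rw [e2]
  rw [lintegral_lintegral_swap]
  · have e3 : ∀ a, ∫⁻ x, g (x, a - x) = (1 / 2) * ∫⁻ s, g ((s + a) / 2, a - (s + a) / 2) := fun a =>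
      lintegral_comp_half (fun x => g (x, a - x)) a (hgm.comp (by fun_prop))
    simp_rw [e3]
    rw [lintegral_const_mul]
    · congr 1
      refine lintegral_congr fun a => lintegral_congr fun s => lintegral_congr fun w => ?_
      rw [mkV]
      have h1 : (s + a) / 2 = (a + s) / 2 := by ring
      have h2 : a - (s + a) / 2 = (a - s) / 2 := by ring
      simp only [h1] at h2 ⊢
      rw [h2]
    · exact Measurable.lintegral_prod_right' (f := fun q : ℝ × ℝ => g ((q.2 + q.1) / 2, q.1 - (q.2 + q.1) / 2))
        (hgm.comp (by fun_prop))
  · exact (hgm.comp (f := fun q : ℝ × ℝ => (q.1, q.2 - q.1)) (by fun_prop)).aemeasurable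

/-- Integration over the cone in Gauss coordinates. -/
lemma lintegral_cone (f : (Fin (d + 2) → ℝ) → ℝ≥0∞) (hf : Measurable f) :
    ∫⁻ y in cone (d + 2), f y =
      (1 / 2) * ∫⁻ a in Ioi (0 : ℝ), ∫⁻ t in Ioi (0 : ℝ), ∫⁻ w, f (mkY a t w) := by
  have hco : MeasurableSet (cone (d + 2)) := isOpen_cone.measurableSet
  have hfi : Measurable ((cone (d + 2)).indicator f) := hf.indicator hco
  have hY := hfi.comp (measurable_mkY (d := d))
  have hV := hfi.comp (measurable_mkV (d := d))
  rw [← lintegral_indicator hco, lintegral_mkV _ hfi, ← lintegral_indicator measurableSet_Ioi]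
  congr 1
  refine lintegral_congr fun a => ?_
  by_cases ha : 0 < a
  · rw [indicator_of_mem (by exact ha), lintegral_lintegral_swap]
    · have e : ∀ w : Fin d → ℝ, ∫⁻ s, (cone (d + 2)).indicator f (mkV a s w) =
          ∫⁻ t, (cone (d + 2)).indicator f (mkY a t w) := fun w =>
        (lintegral_add_right_eq_self (fun s => (cone (d + 2)).indicator f (mkV a s w))
          ((∑ j, w j ^ 2) / a)).symm
      simp_rw [e]
      rw [lintegral_lintegral_swap, ← lintegral_indicator measurableSet_Ioi]
      · refine lintegral_congr fun t => ?_
        by_cases ht : 0 < t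
        · rw [indicator_of_mem (by exact ht)]
          exact lintegral_congr fun w => indicator_of_mem (mkY_mem ha ht w) _
        · rw [indicator_of_notMem (by exact ht)]
          rw [lintegral_eq_zero_iff']
          · refine .of_forall fun w => indicator_of_notMem ?_ _
            rw [mem_cone_iff, cT_mkY]; exact fun h => ht h.2
          · exact (hY.comp (f := fun w => (a, t, w)) (by fun_prop)).aemeasurable
      · exact (hY.comp (f := fun q : (Fin d → ℝ) × ℝ => (a, q.2, q.1)) (by fun_prop)).aemeasurable
    · exact (hV.comp (f := fun q : ℝ × (Fin d → ℝ) => (a, q.1, q.2)) (by fun_prop)).aemeasurable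
  · rw [indicator_of_notMem (by exact ha)]
    have : ∀ s (w : Fin d → ℝ), (cone (d + 2)).indicator f (mkV a s w) = 0 := fun s w =>
      indicator_of_notMem (by rw [mem_cone_iff, cA_mkV]; exact fun h => ha h.1) _
    simp [this]

end coordinates

section scaling

lemma lintegral_comp_smul_pos {d : ℕ} (f : (Fin d → ℝ) → ℝ≥0∞) (hf : Measurable f) {r : ℝ}
    (hr : 0 < r) : ∫⁻ x, f x = ENNReal.ofReal (r ^ d) * ∫⁻ x, f (r • x) := by
  have h2 := Measure.map_addHaar_smul (volume : Measure (Fin d → ℝ)) hr.ne'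
  have : ∫⁻ a, f (r • a) = ∫⁻ x, f x ∂(Measure.map (fun x => r • x) volume) := by
    rw [lintegral_map hf (by fun_prop)]
  rw [this, h2, lintegral_smul_measure, smul_eq_mul, ← mul_assoc, ← ENNReal.ofReal_mul (by positivity)]
  simp only [Module.finrank_fintype_fun_eq_card, Fintype.card_fin]
  rw [abs_of_pos (by positivity), mul_inv_cancel₀ (by positivity)]
  simp

lemma lintegral_Ioi_comp_mul (f : ℝ → ℝ≥0∞) (hf : Measurable f) {r : ℝ}
    (hr : 0 < r) : ∫⁻ x in Ioi (0 : ℝ), f x = ENNReal.ofReal r * ∫⁻ x in Ioi (0 : ℝ), f (r * x) := by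
  rw [← lintegral_indicator measurableSet_Ioi, ← lintegral_indicator measurableSet_Ioi]
  have h2 := Measure.map_addHaar_smul (volume : Measure ℝ) hr.ne'
  have : ∫⁻ a, (Ioi (0 : ℝ)).indicator (fun x => f (r * x)) a =
      ∫⁻ x, (Ioi (0 : ℝ)).indicator f x ∂(Measure.map (fun x => r • x) volume) := by
    rw [lintegral_map (hf.indicator measurableSet_Ioi) (by fun_prop)]
    refine lintegral_congr fun a => ?_
    simp only [indicator, mem_Ioi, smul_eq_mul, mul_pos_iff_of_pos_left hr]
  rw [this, h2, lintegral_smul_measure, smul_eq_mul, ← mul_assoc, ← ENNReal.ofReal_mul (by positivity)]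
  simp only [Module.finrank_self, pow_one]
  rw [abs_of_pos (by positivity), mul_inv_cancel₀ (by positivity)]
  simp

/-- The constant `∫ (1 + |u|²)^{-D} du` on `ℝ^d`. -/
def sC (d : ℕ) (D : ℝ) : ℝ≥0∞ := ∫⁻ u : Fin d → ℝ, ENNReal.ofReal ((1 + ∑ i, u i ^ 2) ^ (-D))

lemma sC_ne_top {d : ℕ} {D : ℝ} (h : (d : ℝ) / 2 < D) : sC d D ≠ ⊤ := by
  have hi : Integrable (fun x : Fin d → ℝ => (1 + ‖x‖) ^ (-(2 * D))) :=
    integrable_one_add_norm (by rw [Module.finrank_fin_fun]; linarith)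
  have hD : 0 < D := lt_of_le_of_lt (by positivity) h
  refine ((hi.const_mul (2 ^ D)).lintegral_lt_top.trans_le' (lintegral_mono fun u => ?_)).ne
  refine ENNReal.ofReal_le_ofReal ?_
  have h1 : ‖u‖ ^ 2 ≤ ∑ i, u i ^ 2 := by
    have h0 : 0 ≤ ∑ i, u i ^ 2 := Finset.sum_nonneg fun _ _ => sq_nonneg _
    have : ‖u‖ ≤ √(∑ i, u i ^ 2) := by
      refine (pi_norm_le_iff_of_nonneg (Real.sqrt_nonneg _)).2 fun i => ?_
      refine Real.le_sqrt_of_sq_le ?_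
      rw [Real.norm_eq_abs, sq_abs]
      exact Finset.single_le_sum (f := fun i => u i ^ 2) (fun _ _ => sq_nonneg _) (Finset.mem_univ i)
    calc ‖u‖ ^ 2 ≤ (√(∑ i, u i ^ 2)) ^ 2 := by gcongr
      _ = _ := Real.sq_sqrt h0
  have h2 : (1 + ‖u‖) ^ 2 / 2 ≤ 1 + ∑ i, u i ^ 2 := by nlinarith [sq_nonneg (1 - ‖u‖)]
  have h3 : (0 : ℝ) < (1 + ‖u‖) ^ 2 / 2 := by positivity
  calc (1 + ∑ i, u i ^ 2) ^ (-D) ≤ ((1 + ‖u‖) ^ 2 / 2) ^ (-D) :=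
        Real.rpow_le_rpow_of_nonpos h3 h2 (by linarith)
    _ = 2 ^ D * (1 + ‖u‖) ^ (-(2 * D)) := by
        rw [Real.div_rpow (by positivity) (by positivity), Real.rpow_neg (x := 2) (by positivity),
          div_inv_eq_mul, mul_comm, ← Real.rpow_natCast, ← Real.rpow_mul (by positivity)]
        congr 2; push_cast; ring

/-- Scaling of a translated and dilated power of a positive quadratic. -/
lemma lintegral_quadratic {d : ℕ} (D : ℝ) {T ρ : ℝ} (hT : 0 < T) (hρ : 0 < ρ) (c : Fin d → ℝ) :
    ∫⁻ w : Fin d → ℝ, ENNReal.ofReal ((T + ρ * ∑ i, (w i - c i) ^ 2) ^ (-D)) =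
      sC d D * ENNReal.ofReal (T ^ ((d : ℝ) / 2 - D) * ρ ^ (-((d : ℝ) / 2))) := by
  have e1 : ∫⁻ w : Fin d → ℝ, ENNReal.ofReal ((T + ρ * ∑ i, (w i - c i) ^ 2) ^ (-D)) =
      ∫⁻ w : Fin d → ℝ, ENNReal.ofReal ((T + ρ * ∑ i, (w i) ^ 2) ^ (-D)) :=
    lintegral_sub_right_eq_self (fun w : Fin d → ℝ => ENNReal.ofReal ((T + ρ * ∑ i, (w i) ^ 2) ^ (-D))) c
  have hr : 0 < √(T / ρ) := by positivity
  rw [e1, lintegral_comp_smul_pos _ (by fun_prop) hr, sC]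
  have e2 : ∀ x : Fin d → ℝ, ENNReal.ofReal ((T + ρ * ∑ i, ((√(T / ρ) • x) i) ^ 2) ^ (-D)) =
      ENNReal.ofReal (T ^ (-D)) * ENNReal.ofReal ((1 + ∑ i, x i ^ 2) ^ (-D)) := fun x => by
    have h0 : 0 ≤ ∑ i, x i ^ 2 := Finset.sum_nonneg fun _ _ => sq_nonneg _
    rw [← ENNReal.ofReal_mul (by positivity), ← Real.mul_rpow hT.le (by positivity)]
    congr 2
    simp only [Pi.smul_apply, smul_eq_mul, mul_pow, Real.sq_sqrt (show 0 ≤ T / ρ by positivity)]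
    rw [← Finset.mul_sum]
    field_simp
  simp_rw [e2]
  rw [lintegral_const_mul _ (by fun_prop), ← mul_assoc, mul_comm, ← ENNReal.ofReal_mul (by positivity)]
  congr 2
  rw [Real.sqrt_eq_rpow, ← Real.rpow_natCast, ← Real.rpow_mul (by positivity),
    Real.div_rpow hT.le hρ.le, Real.rpow_neg hρ.le, sub_eq_add_neg, Real.rpow_add hT]
  have : 1 / 2 * (d : ℝ) = d / 2 := by ring
  rw [this]
  ring

lemma lintegral_quadratic_one (D : ℝ) {T ρ : ℝ} (hT : 0 < T) (hρ : 0 < ρ) (c : ℝ) :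
    ∫⁻ w : ℝ, ENNReal.ofReal ((T + ρ * (w - c) ^ 2) ^ (-D)) =
      sC 1 D * ENNReal.ofReal (T ^ ((1 : ℝ) / 2 - D) * ρ ^ (-((1 : ℝ) / 2))) := by
  have := lintegral_quadratic (d := 1) D hT hρ (fun _ => c)
  simp only [Fin.sum_univ_one, Nat.cast_one] at this
  rw [← this]
  have h := (volume_preserving_funUnique (Fin 1) ℝ).symm
  exact h.lintegral_comp (f := fun w : Fin 1 → ℝ => ENNReal.ofReal ((T + ρ * (w 0 - c) ^ 2) ^ (-D)))
    (by fun_prop)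

/-- The constant `∫₀^∞ s^P (1 + s)^{-Q} ds`. -/
def bC (P Q : ℝ) : ℝ≥0∞ := ∫⁻ s in Ioi (0 : ℝ), ENNReal.ofReal (s ^ P * (1 + s) ^ (-Q))

lemma bC_ne_top {P Q : ℝ} (hP : -1 < P) (hQ : P + 1 < Q) : bC P Q ≠ ⊤ := by
  have e : Ioi (0 : ℝ) = Ioc 0 1 ∪ Ioi 1 := (Ioc_union_Ioi_eq_Ioi zero_le_one).symm
  have h1 : IntegrableOn (fun s : ℝ => s ^ P) (Ioc 0 1) :=
    (intervalIntegrable_iff_integrableOn_Ioc_of_le zero_le_one).1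
      (intervalIntegral.intervalIntegrable_rpow' hP)
  have h2 : IntegrableOn (fun s : ℝ => s ^ (P - Q)) (Ioi 1) :=
    integrableOn_Ioi_rpow_of_lt (by linarith) one_pos
  rw [bC, e]
  refine ((lintegral_union_le _ _ _).trans_lt (ENNReal.add_lt_top.2 ⟨?_, ?_⟩)).ne
  · refine h1.lintegral_lt_top.trans_le' (setLIntegral_mono' measurableSet_Ioc fun s hs => ?_)
    refine ENNReal.ofReal_le_ofReal ?_
    have := hs.1
    exact mul_le_of_le_one_right (by positivity)
      (Real.rpow_le_one_of_one_le_of_nonpos (by linarith) (by linarith))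
  · refine h2.lintegral_lt_top.trans_le' (setLIntegral_mono' measurableSet_Ioi fun s hs => ?_)
    refine ENNReal.ofReal_le_ofReal ?_
    have hs : (1 : ℝ) < s := hs
    rw [sub_eq_add_neg, Real.rpow_add (by linarith)]
    gcongr ?_ * ?_
    exact Real.rpow_le_rpow_of_nonpos (by linarith) (by linarith) (by linarith)

lemma lintegral_beta (P Q : ℝ) {y : ℝ} (hy : 0 < y) :
    ∫⁻ s in Ioi (0 : ℝ), ENNReal.ofReal (s ^ P * (y + s) ^ (-Q)) =
      bC P Q * ENNReal.ofReal (y ^ (P + 1 - Q)) := by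
  rw [lintegral_Ioi_comp_mul _ (by fun_prop) hy, bC, ← lintegral_const_mul' _ _ (by simp),
    ← lintegral_mul_const' _ _ (by simp)]
  refine setLIntegral_congr_fun measurableSet_Ioi fun s hs => ?_
  have hs : 0 < s := hs
  rw [← ENNReal.ofReal_mul (by positivity), ← ENNReal.ofReal_mul (by positivity)]
  congr 1
  rw [show y + y * s = y * (1 + s) by ring, Real.mul_rpow hy.le hs.le,
    Real.mul_rpow hy.le (by positivity), show P + 1 - Q = P + 1 + -Q by ring,
    Real.rpow_add hy, Real.rpow_add hy, Real.rpow_one]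
  ring

end scaling

section beta

variable {d : ℕ}

/-- The Beta integral on the Lorentz cone, in Gauss coordinates. -/
lemma lintegral_cone_beta (A B C D : ℝ) (hA : -1 < A + d / 2) (hC : A + d + 1 < C) (hB : -1 < B)
    (hD : B + d / 2 + 1 < D) :
    ∃ K : ℝ≥0∞, K ≠ ⊤ ∧ ∀ y ∈ cone (d + 2),
      ∫⁻ v in cone (d + 2), ENNReal.ofReal (cA v ^ A * cT v ^ B * cA (y + v) ^ (-C) *
        cT (y + v) ^ (-D)) =
      K * ENNReal.ofReal (cA y ^ (A + d / 2 + 1 - C) * cT y ^ (B + d / 2 + 1 - D)) := by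
  refine ⟨(1 / 2) * (sC d D * bC (A + d / 2) (C - d / 2) * bC B (D - d / 2)), ?_, fun y hy => ?_⟩
  · refine ENNReal.mul_ne_top (by simp) (ENNReal.mul_ne_top (ENNReal.mul_ne_top
      (sC_ne_top (by linarith)) (bC_ne_top hA (by linarith))) (bC_ne_top hB (by linarith)))
  rw [mem_cone_iff] at hy
  obtain ⟨h1, h2⟩ := hy
  have hm : Measurable fun v : Fin (d + 2) → ℝ => ENNReal.ofReal (cA v ^ A * cT v ^ B *
      cA (y + v) ^ (-C) * cT (y + v) ^ (-D)) := by
    have := continuous_cA (d := d) |>.measurable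
    have := measurable_cT (d := d)
    fun_prop
  rw [lintegral_cone _ hm, mul_assoc]
  congr 1
  have key : ∀ a ∈ Ioi (0 : ℝ), ∀ t ∈ Ioi (0 : ℝ), ∫⁻ w : Fin d → ℝ, ENNReal.ofReal
      (cA (mkY a t w) ^ A * cT (mkY a t w) ^ B * cA (y + mkY a t w) ^ (-C) *
        cT (y + mkY a t w) ^ (-D)) = (sC d D * ENNReal.ofReal (cA y ^ (-((d : ℝ) / 2)))) *
        (ENNReal.ofReal (a ^ (A + d / 2) * (cA y + a) ^ (-(C - d / 2))) *
        ENNReal.ofReal (t ^ B * (cT y + t) ^ (-(D - d / 2)))) := by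
    intro a ha t ht
    have ha : 0 < a := ha
    have ht : 0 < t := ht
    set ρ : ℝ := cA y / (a * (cA y + a)) with hρ
    have hρ0 : 0 < ρ := by positivity
    have e : ∀ w : Fin d → ℝ, ENNReal.ofReal
      (cA (mkY a t w) ^ A * cT (mkY a t w) ^ B * cA (y + mkY a t w) ^ (-C) *
        cT (y + mkY a t w) ^ (-D)) = ENNReal.ofReal (a ^ A * t ^ B * (cA y + a) ^ (-C)) *
        ENNReal.ofReal ((cT y + t + ρ * ∑ j, (w j - a * cW y j / cA y) ^ 2) ^ (-D)) := by
      intro w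
      rw [cT_add h1 (by rwa [cA_mkY]), cA_add, cA_mkY, cT_mkY, cW_mkY,
        ← ENNReal.ofReal_mul (by positivity)]
      congr 4
      rw [Finset.mul_sum, Finset.mul_sum]
      refine Finset.sum_congr rfl fun j _ => ?_
      rw [hρ]; field_simp; ring
    simp_rw [e]
    rw [lintegral_const_mul _ (by fun_prop), lintegral_quadratic D (by positivity) hρ0,
      mul_left_comm, mul_assoc (sC d D), ← ENNReal.ofReal_mul (by positivity),
      ← ENNReal.ofReal_mul (by positivity), ← ENNReal.ofReal_mul (by positivity)]
    congr 2
    rw [hρ, Real.div_rpow h1.le (by positivity), Real.mul_rpow ha.le (by positivity),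
      Real.rpow_add ha, show -(C - (d : ℝ) / 2) = -C + d / 2 by ring,
      Real.rpow_add (by positivity), Real.rpow_neg (x := a) ha.le,
      Real.rpow_neg (x := cA y + a) (y := d / 2) (by positivity),
      show -(D - (d : ℝ) / 2) = d / 2 - D by ring]
    field_simp
  rw [setLIntegral_congr_fun measurableSet_Ioi fun a ha =>
    setLIntegral_congr_fun measurableSet_Ioi (key a ha)]
  have hsub : sC d D * ENNReal.ofReal (cA y ^ (-((d : ℝ) / 2))) ≠ ⊤ :=
    ENNReal.mul_ne_top (sC_ne_top (by linarith)) (by simp)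
  simp_rw [lintegral_const_mul' _ _ hsub, lintegral_const_mul' _ _ ENNReal.ofReal_ne_top]
  rw [lintegral_beta _ _ h2, lintegral_mul_const _ (by fun_prop), lintegral_beta _ _ h1]
  have : ENNReal.ofReal (cA y ^ (A + d / 2 + 1 - C) * cT y ^ (B + d / 2 + 1 - D)) =
      ENNReal.ofReal (cA y ^ (-((d : ℝ) / 2))) * ENNReal.ofReal (cA y ^ (A + d / 2 + 1 - (C - d / 2)))
        * ENNReal.ofReal (cT y ^ (B + 1 - (D - d / 2))) := by
    rw [← ENNReal.ofReal_mul (by positivity), ← ENNReal.ofReal_mul (by positivity),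
      ← Real.rpow_add h1]
    congr 3 <;> ring
  rw [this]
  ring

end beta

section pairing

variable {d : ℕ}

/-- The Lorentz pairing on real vectors. -/
def prR (y ξ : Fin (d + 2) → ℝ) : ℝ := 2 * y 0 * ξ 0 - ∑ i, y i * ξ i

/-- The Lorentz pairing of a complex with a real vector. -/
def prC (z : Fin (d + 2) → ℂ) (ξ : Fin (d + 2) → ℝ) : ℂ := 2 * z 0 * ξ 0 - ∑ i, z i * ξ i

lemma prC_im (z : Fin (d + 2) → ℂ) (ξ : Fin (d + 2) → ℝ) : (prC z ξ).im = prR (imP z) ξ := by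
  simp [prC, prR, imP]

lemma prC_ofReal (x ξ : Fin (d + 2) → ℝ) : prC (fun i => (x i : ℂ)) ξ = (prR x ξ : ℂ) := by
  simp [prC, prR]

lemma prC_add (z w : Fin (d + 2) → ℂ) (ξ : Fin (d + 2) → ℝ) :
    prC (z + w) ξ = prC z ξ + prC w ξ := by
  simp only [prC, Pi.add_apply, add_mul, mul_add, Finset.sum_add_distrib]; ring

lemma prC_smul (c : ℂ) (z : Fin (d + 2) → ℂ) (ξ : Fin (d + 2) → ℝ) :
    prC (c • z) ξ = c * prC z ξ := by
  simp only [prC, Pi.smul_apply, smul_eq_mul, mul_sub, Finset.mul_sum]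
  congr 1
  · ring
  · exact Finset.sum_congr rfl fun i _ => by ring

lemma prR_add_left (x y ξ : Fin (d + 2) → ℝ) : prR (x + y) ξ = prR x ξ + prR y ξ := by
  simp only [prR, Pi.add_apply, add_mul, mul_add, Finset.sum_add_distrib]; ring

lemma prR_smul_left (c : ℝ) (y ξ : Fin (d + 2) → ℝ) : prR (c • y) ξ = c * prR y ξ := by
  simp only [prR, Pi.smul_apply, smul_eq_mul, mul_sub, Finset.mul_sum]
  congr 1
  · ring
  · exact Finset.sum_congr rfl fun i _ => by ring

lemma prR_comm (x y : Fin (d + 2) → ℝ) : prR x y = prR y x := by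
  simp only [prR]
  congr 1
  · ring
  · exact Finset.sum_congr rfl fun i _ => by ring

lemma prR_smul_right (c : ℝ) (y ξ : Fin (d + 2) → ℝ) : prR y (c • ξ) = c * prR y ξ := by
  rw [prR_comm, prR_smul_left, prR_comm]

lemma prR_add_right (x y ξ : Fin (d + 2) → ℝ) : prR x (y + ξ) = prR x y + prR x ξ := by
  rw [prR_comm, prR_add_left, prR_comm y, prR_comm ξ]

lemma norm_exp_prC (z : Fin (d + 2) → ℂ) (ξ : Fin (d + 2) → ℝ) :
    ‖cexp (I * prC z ξ)‖ = Real.exp (-prR (imP z) ξ) := by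
  rw [Complex.norm_exp]; simp [prC_im]

lemma lor_add (x y : Fin (d + 2) → ℝ) : lor (x + y) = lor x + lor y + 2 * prR x y := by
  simp only [lor, prR, Pi.add_apply]
  have : ∑ i, (x i + y i) ^ 2 = ∑ i, x i ^ 2 + 2 * ∑ i, x i * y i + ∑ i, y i ^ 2 := by
    rw [Finset.mul_sum, ← Finset.sum_add_distrib, ← Finset.sum_add_distrib]
    exact Finset.sum_congr rfl fun j _ => by ring
  rw [this]; ring

lemma prR_eq_gauss {y ξ : Fin (d + 2) → ℝ} (hy : 0 < cA y) (hξ : 0 < cA ξ) :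
    prR y ξ = (cA y * cT ξ + cT y * cA ξ + cA y * cA ξ *
      ∑ j, (cW y j / cA y - cW ξ j / cA ξ) ^ 2) / 2 := by
  have h := lor_add y ξ
  rw [lor_eq_mul (y := y + ξ) (by rw [cA_add]; positivity), cT_add hy hξ, lor_eq_mul hy.ne',
    lor_eq_mul hξ.ne', cA_add] at h
  generalize ∑ j, (cW y j / cA y - cW ξ j / cA ξ) ^ 2 = Q at *
  have : 0 < cA y + cA ξ := by positivity
  field_simp at h
  linarith

lemma prR_pos {y ξ : Fin (d + 2) → ℝ} (hy : y ∈ cone (d + 2)) (hξ : ξ ∈ cone (d + 2)) :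
    0 < prR y ξ := by
  rw [mem_cone_iff] at *
  obtain ⟨h1, h2⟩ := hy
  obtain ⟨h3, h4⟩ := hξ
  have : 0 ≤ ∑ j, (cW y j / cA y - cW ξ j / cA ξ) ^ 2 := Finset.sum_nonneg fun _ _ => sq_nonneg _
  rw [prR_eq_gauss h1 h3]
  positivity

/-- The base point `(1, 0, …, 0)` of the cone. -/
def e0 : Fin (d + 2) → ℝ := Pi.single 0 1

lemma prR_e0 (ξ : Fin (d + 2) → ℝ) : prR e0 ξ = ξ 0 := by
  simp [prR, e0, Pi.single_apply]; ring

lemma e0_mem : (e0 : Fin (d + 2) → ℝ) ∈ cone (d + 2) := by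
  constructor
  · simp [lor, e0, Pi.single_apply, Finset.sum_ite_eq']
  · simp [e0]

lemma smul_mem_cone {n : ℕ} [NeZero n] {y : Fin n → ℝ} (hy : y ∈ cone n) {c : ℝ}
    (hc : 0 < c) : c • y ∈ cone n := by
  obtain ⟨h1, h2⟩ := hy
  refine ⟨?_, by simpa using mul_pos hc h2⟩
  have : lor (c • y) = c ^ 2 * lor y := by
    simp only [lor, Pi.smul_apply, smul_eq_mul, mul_pow, ← Finset.mul_sum]; ring
  rw [this]; positivity

/-- For `y` in the cone, `prR y ξ` dominates `ξ 0` on the cone. -/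
lemma exists_prR_ge {y : Fin (d + 2) → ℝ} (hy : y ∈ cone (d + 2)) :
    ∃ c > 0, ∀ ξ ∈ cone (d + 2), c * ξ 0 ≤ prR y ξ := by
  have hc : Continuous fun c : ℝ => y - c • (e0 : Fin (d + 2) → ℝ) := by fun_prop
  have h0 : (fun c : ℝ => y - c • (e0 : Fin (d + 2) → ℝ)) ⁻¹' cone (d + 2) ∈ nhds (0 : ℝ) :=
    (isOpen_cone.preimage hc).mem_nhds (by simpa using hy)
  obtain ⟨c, hcp, hc⟩ := Filter.nonempty_of_mem
    (Filter.inter_mem (mem_nhdsWithin_of_mem_nhds h0) (self_mem_nhdsWithin (s := Ioi (0 : ℝ))))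
  refine ⟨c, hc, fun ξ hξ => ?_⟩
  have h := prR_pos (y := y - c • (e0 : Fin (d + 2) → ℝ)) hcp hξ
  rw [sub_eq_add_neg, prR_add_left, ← neg_smul, prR_smul_left, prR_e0] at h
  linarith

lemma abs_le_zero_coord {ξ : Fin (d + 2) → ℝ} (hξ : ξ ∈ cone (d + 2)) (j : Fin (d + 2)) :
    |ξ j| ≤ ξ 0 := by
  obtain ⟨h1, h2⟩ := hξ
  refine abs_le_of_sq_le_sq ?_ h2.le
  refine Fin.cases le_rfl (fun i => ?_) j
  rw [lor, Fin.sum_univ_succ] at h1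
  have := Finset.single_le_sum (f := fun i : Fin (d + 1) => ξ i.succ ^ 2)
    (fun _ _ => sq_nonneg _) (Finset.mem_univ i)
  linarith

end pairing

section laplaceReal

/-- The constant `∫₀^∞ t^s e^{-t} dt`. -/
def gamC (s : ℝ) : ℝ≥0∞ := ∫⁻ t in Ioi (0 : ℝ), ENNReal.ofReal (t ^ s * Real.exp (-t))

lemma gamC_ne_top {s : ℝ} (hs : -1 < s) : gamC s ≠ ⊤ := by
  have h := Real.GammaIntegral_convergent (s := s + 1) (by linarith)
  refine (h.lintegral_lt_top.trans_le' (lintegral_mono fun t => ?_)).ne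
  rw [mul_comm, add_sub_cancel_right]

lemma lintegral_gamma (s : ℝ) {b : ℝ} (hb : 0 < b) :
    ∫⁻ t in Ioi (0 : ℝ), ENNReal.ofReal (t ^ s * Real.exp (-(b * t))) =
      gamC s * ENNReal.ofReal (b ^ (-s - 1)) := by
  rw [lintegral_Ioi_comp_mul _ (by fun_prop) (inv_pos.2 hb), gamC, ← lintegral_const_mul' _ _ (by simp),
    ← lintegral_mul_const' _ _ (by simp)]
  refine setLIntegral_congr_fun measurableSet_Ioi fun t ht => ?_
  have ht : 0 < t := ht
  rw [← ENNReal.ofReal_mul (by positivity), ← ENNReal.ofReal_mul (by positivity)]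
  congr 1
  rw [Real.mul_rpow (by positivity) ht.le, Real.rpow_sub hb, Real.rpow_neg hb.le, Real.inv_rpow hb.le,
    mul_inv_cancel_left₀ hb.ne', Real.rpow_one]
  field_simp

/-- The constant `∫ e^{-|u|²/2} du` on `ℝ^d`. -/
def gauC (d : ℕ) : ℝ≥0∞ := ∫⁻ u : Fin d → ℝ, ENNReal.ofReal (Real.exp (-(∑ i, u i ^ 2) / 2))

lemma gauC_ne_top (d : ℕ) : gauC d ≠ ⊤ := by
  have h := GaussianFourier.integrable_cexp_neg_mul_sum_add (ι := Fin d) (b := 1 / 2) (by norm_num) 0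
  refine (h.norm.lintegral_lt_top.trans_le' (lintegral_mono fun t => ?_)).ne
  refine ENNReal.ofReal_le_ofReal (le_of_eq ?_)
  rw [Complex.norm_exp]
  congr 1
  simp only [Pi.zero_apply, zero_mul, Finset.sum_const_zero, add_zero]
  have : (-(1 / 2 : ℂ) * ∑ i, (t i : ℂ) ^ 2) = ((-(1 / 2 : ℝ) * ∑ i, t i ^ 2 : ℝ) : ℂ) := by
    push_cast; rfl
  rw [this, Complex.ofReal_re]; ring

lemma lintegral_gauss {d : ℕ} {ρ : ℝ} (hρ : 0 < ρ) (c : Fin d → ℝ) :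
    ∫⁻ w : Fin d → ℝ, ENNReal.ofReal (Real.exp (-(ρ * ∑ i, (w i - c i) ^ 2) / 2)) =
      gauC d * ENNReal.ofReal (ρ ^ (-((d : ℝ) / 2))) := by
  have e1 : ∫⁻ w : Fin d → ℝ, ENNReal.ofReal (Real.exp (-(ρ * ∑ i, (w i - c i) ^ 2) / 2)) =
      ∫⁻ w : Fin d → ℝ, ENNReal.ofReal (Real.exp (-(ρ * ∑ i, (w i) ^ 2) / 2)) :=
    lintegral_sub_right_eq_self
      (fun w : Fin d → ℝ => ENNReal.ofReal (Real.exp (-(ρ * ∑ i, (w i) ^ 2) / 2))) c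
  have hr : 0 < (√ρ)⁻¹ := by positivity
  rw [e1, lintegral_comp_smul_pos _ (by fun_prop) hr, gauC, mul_comm]
  congr 1
  · refine lintegral_congr fun x => ?_
    congr 4
    simp only [Pi.smul_apply, smul_eq_mul, mul_pow, ← Finset.mul_sum, inv_pow, Real.sq_sqrt hρ.le]
    field_simp
  · congr 1
    rw [Real.sqrt_eq_rpow, ← Real.rpow_natCast, Real.inv_rpow (by positivity),
      ← Real.rpow_mul (by positivity), Real.rpow_neg hρ.le]
    congr 2; ring

lemma lintegral_laplace {d : ℕ} {κ : ℝ} (hκ : -1 < κ) : ∃ K : ℝ≥0∞, K ≠ ⊤ ∧ ∀ y ∈ cone (d + 2),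
    ∫⁻ ξ in cone (d + 2), ENNReal.ofReal (lor ξ ^ κ * Real.exp (-prR y ξ)) =
      K * ENNReal.ofReal (lor y ^ (-(κ + ((d + 2 : ℕ) : ℝ) / 2))) := by
  refine ⟨(1 / 2) * (gauC d * (gamC κ * ENNReal.ofReal ((1 / 2) ^ (-κ - 1))) *
    (gamC (κ + d / 2) * ENNReal.ofReal ((1 / 2) ^ (-(κ + d / 2) - 1)))), ?_, fun y hy => ?_⟩
  · have : 0 ≤ (d : ℝ) / 2 := by positivity
    refine ENNReal.mul_ne_top (by simp) (ENNReal.mul_ne_top (ENNReal.mul_ne_top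
      (gauC_ne_top d) (ENNReal.mul_ne_top (gamC_ne_top hκ) (by simp)))
      (ENNReal.mul_ne_top (gamC_ne_top (by linarith)) (by simp)))
  have hm : Measurable fun ξ : Fin (d + 2) → ℝ =>
      ENNReal.ofReal (lor ξ ^ κ * Real.exp (-prR y ξ)) := by
    have := (continuous_lor (n := d + 2)).measurable
    unfold prR
    fun_prop
  rw [mem_cone_iff] at hy
  obtain ⟨h1, h2⟩ := hy
  rw [lintegral_cone _ hm, mul_assoc]
  congr 1
  have key : ∀ a ∈ Ioi (0 : ℝ), ∀ t ∈ Ioi (0 : ℝ), ∫⁻ w : Fin d → ℝ, ENNReal.ofReal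
      (lor (mkY a t w) ^ κ * Real.exp (-prR y (mkY a t w))) =
        (gauC d * ENNReal.ofReal (cA y ^ (-((d : ℝ) / 2)))) *
        (ENNReal.ofReal (a ^ (κ + d / 2) * Real.exp (-(cT y / 2 * a))) *
        ENNReal.ofReal (t ^ κ * Real.exp (-(cA y / 2 * t)))) := by
    intro a ha t ht
    have ha : 0 < a := ha
    have ht : 0 < t := ht
    have e : ∀ w : Fin d → ℝ, ENNReal.ofReal (lor (mkY a t w) ^ κ * Real.exp (-prR y (mkY a t w))) =
        ENNReal.ofReal ((a * t) ^ κ * Real.exp (-(cT y / 2 * a)) * Real.exp (-(cA y / 2 * t))) *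
        ENNReal.ofReal (Real.exp (-((cA y / a) * ∑ j, (w j - a * cW y j / cA y) ^ 2) / 2)) := by
      intro w
      rw [← ENNReal.ofReal_mul (by positivity), lor_eq_mul (by rw [cA_mkY]; exact ha.ne'),
        prR_eq_gauss h1 (by rwa [cA_mkY]), cA_mkY, cT_mkY, cW_mkY, mul_assoc ((a * t) ^ κ),
        mul_assoc ((a * t) ^ κ), ← Real.exp_add, ← Real.exp_add]
      congr 3
      have : cA y * a * ∑ j, (cW y j / cA y - w j / a) ^ 2 =
          (cA y / a) * ∑ j, (w j - a * cW y j / cA y) ^ 2 := by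
        rw [Finset.mul_sum, Finset.mul_sum]
        refine Finset.sum_congr rfl fun j _ => ?_
        field_simp; ring
      rw [this]; ring
    simp_rw [e]
    rw [lintegral_const_mul _ (by fun_prop), lintegral_gauss (by positivity),
      mul_left_comm, mul_assoc (gauC d), ← ENNReal.ofReal_mul (by positivity),
      ← ENNReal.ofReal_mul (by positivity), ← ENNReal.ofReal_mul (by positivity)]
    congr 2
    rw [Real.div_rpow h1.le (by positivity), Real.mul_rpow ha.le (by positivity),
      Real.rpow_add ha, Real.rpow_neg (x := a) ha.le]
    field_simp
  rw [setLIntegral_congr_fun measurableSet_Ioi fun a ha =>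
    setLIntegral_congr_fun measurableSet_Ioi (key a ha)]
  have hsub : gauC d * ENNReal.ofReal (cA y ^ (-((d : ℝ) / 2))) ≠ ⊤ :=
    ENNReal.mul_ne_top (gauC_ne_top d) (by simp)
  simp_rw [lintegral_const_mul' _ _ hsub, lintegral_const_mul' _ _ ENNReal.ofReal_ne_top]
  rw [lintegral_gamma _ (half_pos h1), lintegral_mul_const _ (by fun_prop), lintegral_gamma _ (half_pos h2)]
  have e1 : ∀ (s : ℝ) {b : ℝ}, 0 < b → ENNReal.ofReal ((b / 2) ^ s) =
      ENNReal.ofReal ((1 / 2) ^ s) * ENNReal.ofReal (b ^ s) := fun s b hb => by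
    rw [← ENNReal.ofReal_mul (by positivity), ← Real.mul_rpow (by positivity) hb.le]
    congr 2; ring
  have : ENNReal.ofReal (lor y ^ (-(κ + ((d + 2 : ℕ) : ℝ) / 2))) =
      ENNReal.ofReal (cA y ^ (-((d : ℝ) / 2))) * ENNReal.ofReal (cA y ^ (-κ - 1))
        * ENNReal.ofReal (cT y ^ (-(κ + (d : ℝ) / 2) - 1)) := by
    rw [← ENNReal.ofReal_mul (by positivity), ← ENNReal.ofReal_mul (by positivity),
      ← Real.rpow_add h1, lor_eq_mul h1.ne', Real.mul_rpow h1.le h2.le]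
    congr 3 <;> push_cast <;> ring
  rw [this, e1 _ h1, e1 _ h2]
  ring

end laplaceReal

section laplaceTransform

variable {d : ℕ}

/-- The Fourier–Laplace transform of a function on the cone. -/
def lapT (g : (Fin (d + 2) → ℝ) → ℂ) (z : Fin (d + 2) → ℂ) : ℂ :=
  ∫ ξ in cone (d + 2), g ξ * cexp (I * prC z ξ)

/-- Functions with an absolutely convergent Laplace transform on the whole cone. -/
def LI (g : (Fin (d + 2) → ℝ) → ℂ) : Prop :=
  Measurable g ∧ ∀ y ∈ cone (d + 2), IntegrableOn (fun ξ => ‖g ξ‖ * Real.exp (-prR y ξ)) (cone (d + 2))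

lemma continuous_prR : Continuous fun q : (Fin (d + 2) → ℝ) × (Fin (d + 2) → ℝ) => prR q.1 q.2 := by
  unfold prR; fun_prop

lemma continuous_prC : Continuous fun q : (Fin (d + 2) → ℂ) × (Fin (d + 2) → ℝ) => prC q.1 q.2 := by
  unfold prC; fun_prop

lemma measurable_prC (z : Fin (d + 2) → ℂ) : Measurable (prC z) := by
  unfold prC; fun_prop

lemma measurable_prR (y : Fin (d + 2) → ℝ) : Measurable (prR y) := by
  unfold prR; fun_prop

lemma LI.integrableOn {g : (Fin (d + 2) → ℝ) → ℂ} (hg : LI g) {z : Fin (d + 2) → ℂ}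
    (hz : z ∈ tube (d + 2)) :
    IntegrableOn (fun ξ => g ξ * cexp (I * prC z ξ)) (cone (d + 2)) := by
  refine (hg.2 _ hz).mono' ?_ (.of_forall fun ξ => ?_)
  · have := hg.1; have := measurable_prC z
    exact Measurable.aestronglyMeasurable (by fun_prop)
  · rw [norm_mul, norm_exp_prC]

lemma LI.mul_linear {g c : (Fin (d + 2) → ℝ) → ℂ} (hg : LI g) (hc : Measurable c) {M : ℝ}
    (hM : ∀ ξ ∈ cone (d + 2), ‖c ξ‖ ≤ M * ξ 0) : LI (fun ξ => g ξ * c ξ) := by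
  refine ⟨hg.1.mul hc, fun y hy => ?_⟩
  have hy2 : (1 / 2 : ℝ) • y ∈ cone (d + 2) := smul_mem_cone hy (by norm_num)
  obtain ⟨b, hb, hb2⟩ := exists_prR_ge hy2
  refine ((hg.2 _ hy2).const_mul (|M| / b)).mono' ?_ ?_
  · have := hg.1; have := measurable_prR y
    exact Measurable.aestronglyMeasurable (by fun_prop)
  · refine ae_restrict_of_forall_mem isOpen_cone.measurableSet fun ξ hξ => ?_
    have h0 : 0 < ξ 0 := hξ.2
    have h1 := hb2 ξ hξ
    have e : prR y ξ = prR ((1 / 2 : ℝ) • y) ξ + prR ((1 / 2 : ℝ) • y) ξ := by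
      rw [prR_smul_left]; ring
    rw [e]
    generalize prR ((1 / 2 : ℝ) • y) ξ = u at *
    have h2 : u * Real.exp (-u) ≤ 1 := by
      rw [Real.exp_neg, mul_inv_le_iff₀ (Real.exp_pos _)]
      linarith [Real.add_one_le_exp u]
    have h3 : ‖c ξ‖ * Real.exp (-u) ≤ |M| / b := by
      calc ‖c ξ‖ * Real.exp (-u) ≤ (|M| / b * u) * Real.exp (-u) := by
            gcongr
            calc ‖c ξ‖ ≤ M * ξ 0 := hM ξ hξ
              _ ≤ |M| * ξ 0 := by gcongr; exact le_abs_self M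
              _ = |M| / b * (b * ξ 0) := by field_simp
              _ ≤ _ := by gcongr
        _ = |M| / b * (u * Real.exp (-u)) := by ring
        _ ≤ |M| / b * 1 := by gcongr
        _ = _ := mul_one _
    rw [norm_mul, norm_mul, norm_mul, norm_norm, norm_norm, Real.norm_eq_abs, abs_of_pos (Real.exp_pos _), neg_add,
      Real.exp_add]
    calc ‖g ξ‖ * ‖c ξ‖ * (Real.exp (-u) * Real.exp (-u))
        = (‖c ξ‖ * Real.exp (-u)) * (‖g ξ‖ * Real.exp (-u)) := by ring
      _ ≤ _ := by gcongr

/-- The pairing as a continuous linear form in its first argument. -/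
def prL (ξ : Fin (d + 2) → ℝ) : (Fin (d + 2) → ℂ) →L[ℂ] ℂ :=
  (2 * (ξ 0 : ℂ)) • ContinuousLinearMap.proj 0 - ∑ i, (ξ i : ℂ) • ContinuousLinearMap.proj i

lemma prL_apply (ξ : Fin (d + 2) → ℝ) (z : Fin (d + 2) → ℂ) : prL ξ z = prC z ξ := by
  simp only [prL, prC, sub_apply, smul_apply,
    ContinuousLinearMap.proj_apply, sum_apply, smul_eq_mul]
  congr 1
  · ring
  · exact Finset.sum_congr rfl fun i _ => mul_comm _ _

lemma norm_prC_le {ξ : Fin (d + 2) → ℝ} (hξ : ξ ∈ cone (d + 2)) (z : Fin (d + 2) → ℂ) :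
    ‖prC z ξ‖ ≤ (d + 4) * ξ 0 * ‖z‖ := by
  have h0 : 0 < ξ 0 := hξ.2
  have h1 : ∀ i, ‖z i * (ξ i : ℂ)‖ ≤ ξ 0 * ‖z‖ := fun i => by
    rw [norm_mul, Complex.norm_real, Real.norm_eq_abs, mul_comm]
    gcongr
    · exact abs_le_zero_coord hξ i
    · exact norm_le_pi_norm z i
  calc ‖prC z ξ‖ ≤ ‖2 * z 0 * ξ 0‖ + ‖∑ i, z i * (ξ i : ℂ)‖ := norm_sub_le _ _
    _ ≤ 2 * (ξ 0 * ‖z‖) + ∑ i : Fin (d + 2), ξ 0 * ‖z‖ := by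
        gcongr
        · rw [mul_assoc, norm_mul]
          have := h1 0
          simpa using this
        · exact norm_sum_le_of_le _ fun i _ => h1 i
    _ = _ := by simp; ring

lemma norm_prL_le {ξ : Fin (d + 2) → ℝ} (hξ : ξ ∈ cone (d + 2)) :
    ‖prL ξ‖ ≤ (d + 4) * ξ 0 := by
  have h0 : 0 < ξ 0 := hξ.2
  refine ContinuousLinearMap.opNorm_le_bound _ (by positivity) fun z => ?_
  rw [prL_apply]; exact norm_prC_le hξ z

lemma measurable_prL : Measurable (prL : (Fin (d + 2) → ℝ) → _) := by
  refine Continuous.measurable ?_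
  unfold prL; fun_prop

lemma continuous_imP {n : ℕ} : Continuous (imP : (Fin n → ℂ) → _) := by
  unfold imP; fun_prop

lemma isOpen_tube {n : ℕ} [NeZero n] : IsOpen (tube n) := isOpen_cone.preimage continuous_imP

lemma LI.hasFDerivAt {g : (Fin (d + 2) → ℝ) → ℂ} (hg : LI g) {z : Fin (d + 2) → ℂ}
    (hz : z ∈ tube (d + 2)) :
    IntegrableOn (fun ξ => (g ξ * (cexp (I * prC z ξ) * I)) • prL ξ) (cone (d + 2)) ∧
    HasFDerivAt (lapT g) (∫ ξ in cone (d + 2), (g ξ * (cexp (I * prC z ξ) * I)) • prL ξ) z := by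
  have hy2 : (1 / 2 : ℝ) • imP z ∈ cone (d + 2) := smul_mem_cone hz (by norm_num)
  have hb := (hg.mul_linear (c := fun ξ => (((d + 4) * ξ 0 : ℝ) : ℂ)) (M := d + 4) (by fun_prop)
    (fun ξ hξ => by
      have h0 : 0 < ξ 0 := hξ.2
      rw [Complex.norm_real, Real.norm_eq_abs, abs_of_pos (by positivity)])).2 _ hy2
  set s : Set (Fin (d + 2) → ℂ) := {w | imP w - (1 / 2 : ℝ) • imP z ∈ cone (d + 2)} with hs
  have hzs : z ∈ s := by
    have : imP z - (1 / 2 : ℝ) • imP z = (1 / 2 : ℝ) • imP z := by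
      ext i; simp only [Pi.sub_apply, Pi.smul_apply, smul_eq_mul]; ring
    simpa only [hs, mem_ofPred_eq, this] using hy2
  have hso : IsOpen s := isOpen_cone.preimage (continuous_imP.sub continuous_const)
  have hm : ∀ w, Measurable fun ξ => (g ξ * (cexp (I * prC w ξ) * I)) • prL ξ := fun w => by
    have := hg.1; have := measurable_prC w; have := measurable_prL (d := d)
    fun_prop
  have hbd : ∀ ξ ∈ cone (d + 2), ∀ w ∈ s, ‖(g ξ * (cexp (I * prC w ξ) * I)) • prL ξ‖ ≤
      ‖g ξ * (((d + 4) * ξ 0 : ℝ) : ℂ)‖ * Real.exp (-prR ((1 / 2 : ℝ) • imP z) ξ) := by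
    intro ξ hξ w hw
    have h0 : 0 < ξ 0 := hξ.2
    have h1 := prR_pos hw hξ
    rw [sub_eq_add_neg, prR_add_left, ← neg_one_smul ℝ ((1 / 2 : ℝ) • imP z), prR_smul_left] at h1
    rw [norm_smul, norm_mul, norm_mul, norm_exp_prC, norm_I, mul_one, norm_mul, Complex.norm_real,
      Real.norm_eq_abs, abs_of_pos (by positivity), mul_right_comm]
    gcongr
    · exact norm_prL_le hξ
    · linarith
  constructor
  · exact hb.mono' (hm z).aestronglyMeasurable
      (ae_restrict_of_forall_mem isOpen_cone.measurableSet fun ξ hξ => hbd ξ hξ z hzs)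
  · refine hasFDerivAt_integral_of_dominated_of_fderiv_le (hso.mem_nhds hzs) (.of_forall fun w => ?_)
      (hg.integrableOn hz) (hm z).aestronglyMeasurable
      (ae_restrict_of_forall_mem isOpen_cone.measurableSet hbd) hb (.of_forall fun ξ w _ => ?_)
      (F' := fun w ξ => (g ξ * (cexp (I * prC w ξ) * I)) • prL ξ)
    · have := hg.1; have := measurable_prC w
      exact Measurable.aestronglyMeasurable (by fun_prop)
    · have h1 : HasFDerivAt (fun w => prC w ξ) (prL ξ) w := by
        have := (prL ξ).hasFDerivAt (x := w)
        rwa [show ⇑(prL ξ) = fun w => prC w ξ from funext (prL_apply ξ)] at this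
      have h2 := ((h1.const_mul I).cexp).const_mul (g ξ)
      convert! h2 using 1
      simp only [smul_smul]

lemma LI.differentiableOn {g : (Fin (d + 2) → ℝ) → ℂ} (hg : LI g) :
    DifferentiableOn ℂ (lapT g) (tube (d + 2)) := fun _ hz =>
  (hg.hasFDerivAt hz).2.differentiableAt.differentiableWithinAt

lemma LI.mul_coord {g : (Fin (d + 2) → ℝ) → ℂ} (hg : LI g) (j : Fin (d + 2)) :
    LI (fun ξ => g ξ * (I * prC (Pi.single j 1) ξ)) := by
  refine hg.mul_linear (M := d + 4) ((measurable_prC _).const_mul I) fun ξ hξ => ?_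
  have := norm_prC_le hξ (Pi.single j 1)
  rw [Pi.norm_single] at this
  simpa using this

lemma LI.pd {g : (Fin (d + 2) → ℝ) → ℂ} (hg : LI g) (j : Fin (d + 2)) :
    EqOn (pd j (lapT g)) (lapT fun ξ => g ξ * (I * prC (Pi.single j 1) ξ)) (tube (d + 2)) := by
  intro z hz
  obtain ⟨h1, h2⟩ := hg.hasFDerivAt hz
  rw [_root_.pd, h2.fderiv, ContinuousLinearMap.integral_apply h1, lapT]
  refine integral_congr_ae (.of_forall fun ξ => ?_)
  simp only [smul_apply, prL_apply, smul_eq_mul]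
  ring

lemma pd_congr {n : ℕ} [NeZero n] {F G : (Fin n → ℂ) → ℂ} {U : Set (Fin n → ℂ)} (hU : IsOpen U)
    (h : EqOn F G U) (j : Fin n) : EqOn (pd j F) (pd j G) U := fun z hz => by
  simp only [pd]
  rw [Filter.EventuallyEq.fderiv_eq (h.eventuallyEq_of_mem (hU.mem_nhds hz))]

lemma BoxOp_congr {n : ℕ} [NeZero n] {F G : (Fin n → ℂ) → ℂ} {U : Set (Fin n → ℂ)} (hU : IsOpen U)
    (h : EqOn F G U) : EqOn (BoxOp F) (BoxOp G) U := fun z hz => by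
  simp only [BoxOp]
  rw [pd_congr hU (pd_congr hU h 0) 0 hz,
    Finset.sum_congr rfl fun i _ => pd_congr hU (pd_congr hU h i) i hz]

lemma BoxOp_iterate_congr {n : ℕ} [NeZero n] {F G : (Fin n → ℂ) → ℂ} {U : Set (Fin n → ℂ)}
    (hU : IsOpen U) (h : EqOn F G U) (m : ℕ) : EqOn (BoxOp^[m] F) (BoxOp^[m] G) U := by
  induction m with
  | zero => exact h
  | succ m ih => rw [Function.iterate_succ_apply', Function.iterate_succ_apply']; exact BoxOp_congr hU ih

lemma sum_sq_prC (ξ : Fin (d + 2) → ℝ) :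
    2 * prC (Pi.single 0 1) ξ ^ 2 - ∑ j, prC (Pi.single j 1) ξ ^ 2 = (lor ξ : ℂ) := by
  have h : ∀ j, prC (Pi.single j 1) ξ ^ 2 = (ξ j : ℂ) ^ 2 := fun j => by
    have : ∑ i, (Pi.single j 1 : Fin (d + 2) → ℂ) i * (ξ i : ℂ) = ξ j := by
      simp [Pi.single_apply]
    rw [prC, this]
    by_cases hj : j = 0
    · subst hj; simp; ring
    · rw [Pi.single_eq_of_ne (Ne.symm hj)]; simp
  simp only [h, lor]
  push_cast; rfl

lemma LI.mul_lor {g : (Fin (d + 2) → ℝ) → ℂ} (hg : LI g) : LI (fun ξ => g ξ * (lor ξ : ℂ)) := by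
  have h1 := hg.mul_linear (c := fun ξ => (ξ 0 : ℂ)) (M := 1) (by fun_prop) (fun ξ hξ => by
    rw [Complex.norm_real, Real.norm_eq_abs, one_mul, abs_of_pos hξ.2])
  have h2 := h1.mul_linear (c := fun ξ => ((lor ξ / ξ 0 : ℝ) : ℂ)) (M := 1)
    (by have := (continuous_lor (n := d + 2)).measurable; fun_prop) (fun ξ hξ => by
      have h0 : 0 < ξ 0 := hξ.2
      have h3 : 0 < lor ξ := hξ.1
      rw [Complex.norm_real, Real.norm_eq_abs, abs_of_pos (by positivity), div_le_iff₀ h0, one_mul]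
      rw [lor, Fin.sum_univ_succ]
      have : 0 ≤ ∑ i : Fin (d + 1), ξ i.succ ^ 2 := Finset.sum_nonneg fun _ _ => sq_nonneg _
      linarith)
  refine ⟨hg.1.mul (by have := (continuous_lor (n := d + 2)).measurable; fun_prop), fun y hy => ?_⟩
  refine (h2.2 y hy).congr (ae_restrict_of_forall_mem isOpen_cone.measurableSet fun ξ hξ => ?_)
  have h0 : (ξ 0 : ℂ) ≠ 0 := by exact_mod_cast hξ.2.ne'
  simp only
  congr 2
  push_cast
  field_simp

lemma LI.BoxOp {g : (Fin (d + 2) → ℝ) → ℂ} (hg : LI g) :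
    EqOn (BoxOp (lapT g)) (lapT fun ξ => g ξ * (lor ξ : ℂ)) (tube (d + 2)) := by
  have h2 : ∀ j, EqOn (_root_.pd j (_root_.pd j (lapT g)))
      (lapT fun ξ => g ξ * (I * prC (Pi.single j 1) ξ) * (I * prC (Pi.single j 1) ξ)) (tube (d + 2)) :=
    fun j => (pd_congr isOpen_tube (hg.pd j) j).trans ((hg.mul_coord j).pd j)
  intro z hz
  have hi : ∀ j, IntegrableOn (fun ξ => g ξ * (I * prC (Pi.single j 1) ξ) *
      (I * prC (Pi.single j 1) ξ) * cexp (I * prC z ξ)) (cone (d + 2)) := fun j =>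
    ((hg.mul_coord j).mul_coord j).integrableOn hz
  rw [_root_.BoxOp, h2 0 hz, Finset.sum_congr rfl fun i _ => h2 i hz]
  simp only [lapT]
  rw [← integral_finsetSum _ fun i _ => hi i, ← integral_const_mul, ← integral_sub,
    ← integral_neg]
  · refine integral_congr_ae (.of_forall fun ξ => ?_)
    simp only [← sum_sq_prC ξ]
    have e : ∀ j, g ξ * (I * prC (Pi.single j 1) ξ) * (I * prC (Pi.single j 1) ξ) *
        cexp (I * prC z ξ) = -(g ξ * cexp (I * prC z ξ)) * prC (Pi.single j 1) ξ ^ 2 := fun j => by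
      linear_combination g ξ * cexp (I * prC z ξ) * prC (Pi.single j 1) ξ ^ 2 * I_sq
    simp only [e, ← Finset.mul_sum]
    ring
  · exact (hi 0).const_mul 2
  · exact integrable_finsetSum _ fun i _ => hi i

lemma LI.mul_lor_pow {g : (Fin (d + 2) → ℝ) → ℂ} (hg : LI g) (m : ℕ) :
    LI (fun ξ => g ξ * (lor ξ : ℂ) ^ m) := by
  induction m with
  | zero => simpa using hg
  | succ m ih => simpa only [pow_succ, ← mul_assoc] using ih.mul_lor

lemma LI.BoxOp_iterate {g : (Fin (d + 2) → ℝ) → ℂ} (hg : LI g) (m : ℕ) :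
    EqOn (_root_.BoxOp^[m] (lapT g)) (lapT fun ξ => g ξ * (lor ξ : ℂ) ^ m) (tube (d + 2)) := by
  induction m with
  | zero => simp [EqOn]
  | succ m ih =>
    rw [Function.iterate_succ_apply']
    refine (BoxOp_congr isOpen_tube ih).trans ((hg.mul_lor_pow m).BoxOp.trans ?_)
    simp only [pow_succ, ← mul_assoc, EqOn, implies_true]

end laplaceTransform

section laplacePower

variable {d : ℕ}

lemma convex_cone : Convex ℝ (cone (d + 2)) := by
  intro x hx y hy a b ha hb hab
  rcases ha.eq_or_lt with rfl | ha
  · have : b = 1 := by linarith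
    subst this; simpa using hy
  rcases hb.eq_or_lt with rfl | hb
  · have : a = 1 := by linarith
    subst this; simpa using hx
  exact add_mem_cone (smul_mem_cone hx ha) (smul_mem_cone hy hb)

lemma ofReal_toReal_laplace {κ : ℝ} (hκ : -1 < κ) :
    LI (fun ξ : Fin (d + 2) → ℝ => ((lor ξ ^ κ : ℝ) : ℂ)) ∧
    ∃ K : ℝ, 0 < K ∧ ∀ y ∈ cone (d + 2), ∫ ξ in cone (d + 2), lor ξ ^ κ * Real.exp (-prR y ξ) =
      K * lor y ^ (-(κ + ((d + 2 : ℕ) : ℝ) / 2)) := by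
  obtain ⟨K, hK, h⟩ := lintegral_laplace (d := d) hκ
  have hm : ∀ y : Fin (d + 2) → ℝ, Measurable fun ξ => lor ξ ^ κ * Real.exp (-prR y ξ) := fun y => by
    have := (continuous_lor (n := d + 2)).measurable; have := measurable_prR y
    fun_prop
  have hpos : ∀ y : Fin (d + 2) → ℝ, ∀ ξ ∈ cone (d + 2), 0 < lor ξ ^ κ * Real.exp (-prR y ξ) :=
    fun y ξ hξ => mul_pos (Real.rpow_pos_of_pos hξ.1 _) (Real.exp_pos _)
  have hnn : ∀ y : Fin (d + 2) → ℝ, 0 ≤ᵐ[volume.restrict (cone (d + 2))]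
      fun ξ => lor ξ ^ κ * Real.exp (-prR y ξ) := fun y =>
    ae_restrict_of_forall_mem isOpen_cone.measurableSet fun ξ hξ => (hpos y ξ hξ).le
  refine ⟨⟨by have := (continuous_lor (n := d + 2)).measurable; fun_prop, fun y hy => ?_⟩, K.toReal, ?_,
    fun y hy => ?_⟩
  · have h1 : IntegrableOn (fun ξ => lor ξ ^ κ * Real.exp (-prR y ξ)) (cone (d + 2)) := by
      refine ⟨(hm y).aestronglyMeasurable, ?_⟩
      rw [hasFiniteIntegral_iff_ofReal (hnn y), h y hy]
      exact ENNReal.mul_lt_top hK.lt_top ENNReal.ofReal_lt_top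
    refine h1.congr (ae_restrict_of_forall_mem isOpen_cone.measurableSet fun ξ hξ => ?_)
    simp only [Complex.norm_real, Real.norm_eq_abs]
    rw [abs_of_pos (Real.rpow_pos_of_pos hξ.1 _)]
  · refine ENNReal.toReal_pos (fun h0 => ?_) hK
    have h1 := h e0 e0_mem
    rw [h0, zero_mul, setLIntegral_eq_zero_iff' isOpen_cone.measurableSet
      (hm e0).ennreal_ofReal.aemeasurable, ← ae_restrict_iff' isOpen_cone.measurableSet] at h1
    have h2 : ∀ᵐ ξ ∂(volume.restrict (cone (d + 2))), False := by
      filter_upwards [h1, ae_restrict_mem isOpen_cone.measurableSet] with ξ h3 h4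
      rw [ENNReal.ofReal_eq_zero] at h3
      exact absurd h3 (not_le.2 (hpos _ ξ h4))
    rw [Filter.eventually_false_iff_eq_bot, ae_eq_bot, Measure.restrict_eq_zero] at h2
    exact (isOpen_cone.measure_pos volume ⟨e0, e0_mem⟩).ne' h2
  · rw [integral_eq_lintegral_of_nonneg_ae (hnn y) (hm y).aestronglyMeasurable, h y hy,
      ENNReal.toReal_mul, ENNReal.toReal_ofReal (Real.rpow_nonneg hy.1.le _)]

lemma differentiable_lorC : Differentiable ℂ (lorC : (Fin (d + 2) → ℂ) → ℂ) := by
  unfold lorC; fun_prop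

lemma lorC_smul_I (v : Fin (d + 2) → ℝ) : lorC (fun i => I * (v i : ℂ)) = -(lor v : ℂ) := by
  simp only [lorC, lor, mul_pow, I_sq]
  push_cast
  rw [← Finset.mul_sum]; ring

/-- The Laplace transform of a power of the Lorentz form is, in modulus, a power of the Lorentz form. -/
lemma norm_lapT_lor_pow (N : ℕ) : ∃ K : ℝ, 0 < K ∧ ∀ z ∈ tube (d + 2),
      ‖lapT (fun ξ : Fin (d + 2) → ℝ => (lor ξ : ℂ) ^ N) z‖ =
        K * ‖lorC z‖ ^ (-((N : ℝ) + ((d + 2 : ℕ) : ℝ) / 2)) := by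
  obtain ⟨hLI, K, hK, h⟩ := ofReal_toReal_laplace (d := d) (κ := N)
    (lt_of_lt_of_le (by norm_num) (Nat.cast_nonneg N))
  simp only [Real.rpow_natCast, ofReal_pow] at hLI h
  set β : ℕ := 2 * N + (d + 2) with hβ
  have hβ2 : (N : ℝ) + ((d + 2 : ℕ) : ℝ) / 2 = β / 2 := by rw [hβ]; push_cast; ring
  refine ⟨K, hK, fun z hz => ?_⟩
  set g : (Fin (d + 2) → ℝ) → ℂ := fun ξ => (lor ξ : ℂ) ^ N with hg
  set Z : ℂ → Fin (d + 2) → ℂ := fun s i => s * ((z i).re : ℂ) + I * ((z i).im : ℂ) with hZ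
  have hZd : Differentiable ℂ Z := by rw [hZ]; fun_prop
  have hZim : ∀ s, imP (Z s) = s.im • (fun i => (z i).re) + imP z := fun s => by
    ext i; simp [hZ, imP]
  set U : Set ℂ := Z ⁻¹' tube (d + 2) with hU
  have hUo : IsOpen U := isOpen_tube.preimage hZd.continuous
  have hUc : Convex ℝ U := by
    intro s hs t ht a b ha hb hab
    have := convex_cone hs ht ha hb hab
    simp only [hU, mem_preimage, tube, mem_ofPred_eq] at hs ht ⊢
    convert! this using 1
    rw [hZim, hZim, hZim]
    ext i
    simp only [add_im, real_smul, im_ofReal_mul, Pi.add_apply, Pi.smul_apply, smul_eq_mul]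
    linear_combination (-imP z i) * hab
  have hU0 : (0 : ℂ) ∈ U := by
    simpa [hU, tube, hZim] using! hz
  have hU1 : (1 : ℂ) ∈ U := by
    simpa [hU, tube, hZim] using! hz
  have hφ : DifferentiableOn ℂ (fun s => lapT g (Z s) ^ 2 * lorC (Z s) ^ β) U :=
    ((hLI.differentiableOn.comp hZd.differentiableOn (fun s hs => hs)).pow 2).mul
      ((differentiable_lorC.comp hZd).pow β).differentiableOn
  have key := AnalyticOnNhd.eqOn_of_preconnected_of_frequently_eq (hφ.analyticOnNhd hUo)
    (analyticOnNhd_const (v := (K : ℂ) ^ 2 * (-1) ^ β)) hUc.isPreconnected hU0 ?_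
  · have h1 := key hU1
    have hZ1 : Z 1 = z := by
      ext i; simp only [hZ, one_mul]; rw [mul_comm, re_add_im]
    simp only [hZ1] at h1
    have h2 : ‖lapT g z‖ ^ 2 * ‖lorC z‖ ^ β = K ^ 2 := by
      rw [← norm_pow, ← norm_pow, ← norm_mul, h1]; simp [abs_of_pos hK]
    have h3 : 0 < ‖lorC z‖ := by
      refine lt_of_le_of_ne (norm_nonneg _) fun h0 => ?_
      rw [← h0, zero_pow (by omega), mul_zero] at h2
      exact absurd h2.symm (by positivity)
    refine (pow_left_inj₀ (norm_nonneg _) (by positivity) two_ne_zero).1 ?_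
    rw [mul_pow, ← h2, mul_assoc, ← Real.rpow_natCast, ← Real.rpow_natCast ‖lorC z‖,
      ← Real.rpow_natCast (_ ^ (_ : ℝ)), ← Real.rpow_mul h3.le, ← Real.rpow_add h3, hβ2]
    simp
  · have ht : Filter.Tendsto (fun σ : ℝ => (σ : ℂ) * I) (nhdsWithin 0 {0}ᶜ) (nhdsWithin 0 {0}ᶜ) := by
      refine tendsto_nhdsWithin_iff.2 ⟨?_, ?_⟩
      · refine Filter.Tendsto.mono_left ?_ nhdsWithin_le_nhds
        have : Continuous fun σ : ℝ => (σ : ℂ) * I := by fun_prop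
        simpa using this.tendsto 0
      · filter_upwards [self_mem_nhdsWithin] with σ hσ
        simpa using hσ
    refine ht.frequently (Filter.Eventually.frequently ?_)
    have hU' : ∀ᶠ σ : ℝ in nhdsWithin 0 {0}ᶜ, (σ : ℂ) * I ∈ U :=
      (ht.mono_right nhdsWithin_le_nhds).eventually (hUo.mem_nhds hU0)
    filter_upwards [hU'] with σ hσ
    set v : Fin (d + 2) → ℝ := imP (Z (σ * I)) with hv
    have hvc : v ∈ cone (d + 2) := hσ
    have hZv : Z (σ * I) = fun i => I * (v i : ℂ) := by
      ext i
      rw [hv, hZim]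
      simp [hZ, imP]; ring
    have h1 : lapT g (Z (σ * I)) = ((K * lor v ^ (-((N : ℝ) + ((d + 2 : ℕ) : ℝ) / 2)) : ℝ) : ℂ) := by
      rw [← h v hvc, lapT, ← integral_complex_ofReal]
      refine integral_congr_ae (.of_forall fun ξ => ?_)
      have : prC (Z (σ * I)) ξ = I * (prR v ξ : ℂ) := by
        rw [hZv]; simp only [prC, prR]; push_cast; rw [mul_sub, Finset.mul_sum]
        congr 1
        · ring
        · exact Finset.sum_congr rfl fun i _ => by ring
      simp only [this, hg]
      rw [← mul_assoc, I_mul_I, neg_one_mul]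
      push_cast; rfl
    have h2 : (lor v ^ (-((β : ℝ) / 2))) ^ 2 * lor v ^ β = 1 := by
      rw [← Real.rpow_natCast, ← Real.rpow_natCast (lor v), ← Real.rpow_mul hvc.1.le,
        ← Real.rpow_add hvc.1]
      simp
    have h3 : ((lor v ^ (-((β : ℝ) / 2)) : ℝ) : ℂ) ^ 2 * (lor v : ℂ) ^ β = 1 := by
      exact_mod_cast h2
    rw [h1, hZv, lorC_smul_I, hβ2, neg_pow (lor v : ℂ)]
    push_cast at h3 ⊢
    linear_combination (K : ℂ) ^ 2 * (-1) ^ β * h3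

end laplacePower

section lorentzKernel

variable {d : ℕ}

/-- The complex vector with given real and imaginary parts. -/
def cpt {n : ℕ} (x y : Fin n → ℝ) : Fin n → ℂ := fun i => (x i : ℂ) + (y i : ℂ) * I

lemma imP_cpt {n : ℕ} (x y : Fin n → ℝ) : imP (cpt x y) = y := by
  ext i; simp [imP, cpt]

lemma continuous_cpt {n : ℕ} :
    Continuous fun q : (Fin n → ℝ) × (Fin n → ℝ) => cpt q.1 q.2 := by
  unfold cpt; fun_prop

/-- The imaginary part of the complex coordinate `cT`. -/
lemma norm_lorC_mkV {w : Fin (d + 2) → ℝ} (hw : w ∈ cone (d + 2)) (a : ℝ) (u : Fin d → ℝ) :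
    ∃ c : ℝ, ∀ s : ℝ, ‖lorC (cpt (mkV a s u) w)‖ =
      √(cA w ^ 2 + a ^ 2) * √((cT w + cA w / (cA w ^ 2 + a ^ 2) *
        ∑ j, (u j - cW w j * a / cA w) ^ 2) ^ 2 + (s - c) ^ 2) := by
  rw [mem_cone_iff] at hw
  obtain ⟨hA, hT⟩ := hw
  set A := cA w with hAd
  set T := cT w with hTd
  set α : ℂ := (a : ℂ) + A * I with hα
  have hN : normSq α = A ^ 2 + a ^ 2 := by
    rw [hα, normSq_add_mul_I]; ring
  have hN0 : 0 < A ^ 2 + a ^ 2 := by positivity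
  have hα0 : α ≠ 0 := by
    intro h; rw [h, map_zero] at hN; linarith
  set Q : ℂ := (∑ j, ((u j : ℂ) + cW w j * I) ^ 2) / α with hQ
  refine ⟨Q.re, fun s => ?_⟩
  have hcA : cA (cpt (mkV a s u) w) = α := by
    have h1 : cA (mkV a s u) = a := cA_mkV a s u
    have h2 : cA (cpt (mkV a s u) w) = ((cA (mkV a s u) : ℝ) : ℂ) + ((cA w : ℝ) : ℂ) * I := by
      simp only [cA, cpt]; push_cast; ring
    rw [h2, h1]
  have hcS : cS (cpt (mkV a s u) w) = (s : ℂ) + (cS w : ℝ) * I := by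
    have h1 : cS (mkV a s u) = s := cS_mkV a s u
    have h2 : cS (cpt (mkV a s u) w) = ((cS (mkV a s u) : ℝ) : ℂ) + ((cS w : ℝ) : ℂ) * I := by
      simp only [cS, cpt]; push_cast; ring
    rw [h2, h1]
  have hcW : ∀ j, cW (cpt (mkV a s u) w) j = (u j : ℂ) + (cW w j : ℝ) * I := fun j => by
    have h1 : cW (mkV a s u) = u := cW_mkV a s u
    conv_rhs => rw [← h1]
    simp only [cW, cpt]
  have hcS' : cS w = T + (∑ j, cW w j ^ 2) / A := by
    rw [hTd, cT]; ring
  have him : Q.im = (∑ j, cW w j ^ 2) / A - A / (A ^ 2 + a ^ 2) *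
        ∑ j, (u j - cW w j * a / A) ^ 2 := by
    rw [hQ, Finset.sum_div, im_sum, Finset.sum_div, Finset.mul_sum, ← Finset.sum_sub_distrib]
    refine Finset.sum_congr rfl fun j _ => ?_
    rw [div_im, hN]
    simp only [hα, pow_two, mul_im, mul_re, add_re, add_im, ofReal_re, ofReal_im, I_re, I_im]
    field_simp
    ring
  rw [lorC_eq_mul (by rw [hcA]; exact hα0), hcA, norm_mul, norm_def α, hN]
  congr 1
  rw [norm_def, normSq_apply, cT, hcS, hcA]
  simp only [hcW]
  rw [← hQ]
  simp only [sub_re, sub_im, add_re, add_im, mul_re, mul_im, ofReal_re, ofReal_im, I_re, I_im, him,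
    hcS']
  congr 1
  ring

lemma lor_le_norm_lorC {w : Fin (d + 2) → ℝ} (hw : w ∈ cone (d + 2)) (x : Fin (d + 2) → ℝ) :
    lor w ≤ ‖lorC (cpt x w)‖ := by
  have hx : x = mkV (cA x) (cS x) (cW x) := by
    ext i
    refine Fin.cases ?_ (fun i => Fin.cases ?_ (fun j => ?_) i) i
    · simp [mkV, cA, cS]
    · simp [mkV, cA, cS]
    · simp [mkV, cW]
  obtain ⟨c, hc⟩ := norm_lorC_mkV hw (cA x) (cW x)
  rw [hx, hc]
  rw [mem_cone_iff] at hw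
  obtain ⟨hA, hT⟩ := hw
  rw [lor_eq_mul hA.ne']
  have h0 : 0 ≤ ∑ j, (cW x j - cW w j * cA x / cA w) ^ 2 := Finset.sum_nonneg fun _ _ => sq_nonneg _
  refine mul_le_mul ?_ ?_ hT.le (by positivity)
  · exact Real.le_sqrt_of_sq_le (by nlinarith [sq_nonneg (cA x)])
  · refine Real.le_sqrt_of_sq_le ?_
    have h1 : cT w ≤ cT w + cA w / (cA w ^ 2 + cA x ^ 2) *
        ∑ j, (cW x j - cW w j * cA x / cA w) ^ 2 := le_add_of_nonneg_right (by positivity)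
    nlinarith [sq_nonneg (cS x - c)]

lemma continuous_lorC : Continuous (lorC : (Fin (d + 2) → ℂ) → ℂ) := differentiable_lorC.continuous

lemma lintegral_norm_lorC {β : ℝ} (hβ : (d : ℝ) + 1 < β) :
    ∃ K : ℝ≥0∞, K ≠ ⊤ ∧ ∀ w ∈ cone (d + 2),
      ∫⁻ x, ENNReal.ofReal (‖lorC (cpt x w)‖ ^ (-β)) =
        K * ENNReal.ofReal (lor w ^ (((d + 2 : ℕ) : ℝ) / 2 - β)) := by
  have hd0 : (0 : ℝ) ≤ d := by positivity
  refine ⟨(1 / 2) * (sC 1 (β / 2) * (sC d (β - 1) * sC 1 ((β - d) / 2))), ?_, fun w hw => ?_⟩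
  · refine ENNReal.mul_ne_top (by simp) (ENNReal.mul_ne_top (sC_ne_top (by push_cast; linarith))
      (ENNReal.mul_ne_top (sC_ne_top (by linarith)) (sC_ne_top (by push_cast; linarith))))
  have hw' := hw
  rw [mem_cone_iff] at hw'
  obtain ⟨hA, hT⟩ := hw'
  have hmx : Measurable fun x : Fin (d + 2) → ℝ => cpt x w := by unfold cpt; fun_prop
  have hm : Measurable fun x => ENNReal.ofReal (‖lorC (cpt x w)‖ ^ (-β)) := by
    have := continuous_lorC (d := d).measurable
    fun_prop
  rw [lintegral_mkV _ hm]
  have e1 : ∀ a : ℝ, ∫⁻ s, ∫⁻ u, ENNReal.ofReal (‖lorC (cpt (mkV a s u) w)‖ ^ (-β)) =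
      sC 1 (β / 2) * (sC d (β - 1) * ENNReal.ofReal (cT w ^ ((d : ℝ) / 2 - (β - 1)) *
        cA w ^ (-((d : ℝ) / 2)) * (cA w ^ 2 + 1 * (a - 0) ^ 2) ^ (-((β - d) / 2)))) := by
    intro a
    have hN : 0 < cA w ^ 2 + a ^ 2 := by positivity
    rw [lintegral_lintegral_swap (by
      refine Measurable.aemeasurable ?_
      exact hm.comp ((measurable_mkV (d := d)).comp (f := fun q : ℝ × (Fin d → ℝ) => (a, q.1, q.2))
        (by fun_prop)))]
    have e2 : ∀ u : Fin d → ℝ, ∫⁻ s, ENNReal.ofReal (‖lorC (cpt (mkV a s u) w)‖ ^ (-β)) =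
        ENNReal.ofReal ((cA w ^ 2 + a ^ 2) ^ (-(β / 2))) * (sC 1 (β / 2) *
          ENNReal.ofReal ((cT w + cA w / (cA w ^ 2 + a ^ 2) *
            ∑ j, (u j - cW w j * a / cA w) ^ 2) ^ (-(β - 1)))) := by
      intro u
      obtain ⟨c, hc⟩ := norm_lorC_mkV hw a u
      have h0 : 0 ≤ ∑ j, (u j - cW w j * a / cA w) ^ 2 := Finset.sum_nonneg fun _ _ => sq_nonneg _
      simp only [hc]
      set τ := cT w + cA w / (cA w ^ 2 + a ^ 2) * ∑ j, (u j - cW w j * a / cA w) ^ 2 with hτ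
      have hτ0 : 0 < τ := by positivity
      have e3 : ∀ s : ℝ, ENNReal.ofReal ((√(cA w ^ 2 + a ^ 2) * √(τ ^ 2 + (s - c) ^ 2)) ^ (-β)) =
          ENNReal.ofReal ((cA w ^ 2 + a ^ 2) ^ (-(β / 2))) *
            ENNReal.ofReal ((τ ^ 2 + 1 * (s - c) ^ 2) ^ (-(β / 2))) := fun s => by
        rw [← ENNReal.ofReal_mul (by positivity), Real.mul_rpow (by positivity) (by positivity),
          Real.sqrt_eq_rpow, Real.sqrt_eq_rpow, ← Real.rpow_mul (by positivity),
          ← Real.rpow_mul (by positivity), one_mul, show 1 / 2 * -β = -(β / 2) by ring]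
      simp only [e3]
      rw [lintegral_const_mul _ (by fun_prop), lintegral_quadratic_one _ (by positivity) one_pos,
        Real.one_rpow, mul_one, ← Real.rpow_natCast τ, ← Real.rpow_mul hτ0.le]
      congr 4
      push_cast; ring
    simp only [e2]
    rw [lintegral_const_mul _ (by fun_prop), lintegral_const_mul _ (by fun_prop),
      lintegral_quadratic _ hT (by positivity)]
    rw [mul_left_comm, mul_left_comm (ENNReal.ofReal _), ← ENNReal.ofReal_mul (by positivity)]
    congr 3
    rw [Real.div_rpow hA.le hN.le, Real.rpow_neg hN.le (d / 2 : ℝ), one_mul, sub_zero, div_inv_eq_mul,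
      show -((β - d) / 2) = -(β / 2) + d / 2 by ring, Real.rpow_add hN]
    ring
  simp only [e1]
  rw [lintegral_const_mul _ (by fun_prop), lintegral_const_mul _ (by fun_prop)]
  have e4 : ∀ a : ℝ, ENNReal.ofReal (cT w ^ ((d : ℝ) / 2 - (β - 1)) *
        cA w ^ (-((d : ℝ) / 2)) * (cA w ^ 2 + 1 * (a - 0) ^ 2) ^ (-((β - d) / 2))) =
      ENNReal.ofReal (cT w ^ ((d : ℝ) / 2 - (β - 1)) * cA w ^ (-((d : ℝ) / 2))) *
        ENNReal.ofReal ((cA w ^ 2 + 1 * (a - 0) ^ 2) ^ (-((β - d) / 2))) := fun a =>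
    ENNReal.ofReal_mul (by positivity)
  simp only [e4]
  rw [lintegral_const_mul _ (by fun_prop), lintegral_quadratic_one _ (by positivity) one_pos,
    Real.one_rpow, mul_one, mul_left_comm (ENNReal.ofReal _), ← ENNReal.ofReal_mul (by positivity)]
  simp only [mul_assoc]
  congr 6
  rw [lor_eq_mul hA.ne', Real.mul_rpow hA.le hT.le, ← Real.rpow_natCast, ← Real.rpow_mul hA.le,
    ← Real.rpow_add hA, mul_comm]
  congr 2 <;> · push_cast; ring

end lorentzKernel

section fourierInversion

open scoped FourierTransform

variable {d : ℕ}

/-- Reflection in the time axis. -/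
def flipV : (Fin (d + 2) → ℝ) ≃ₜ (Fin (d + 2) → ℝ) where
  toFun x i := if i = 0 then x i else -x i
  invFun x i := if i = 0 then x i else -x i
  left_inv x := by ext i; simp only; split_ifs <;> simp
  right_inv x := by ext i; simp only; split_ifs <;> simp
  continuous_toFun := by
    refine continuous_pi fun i => ?_
    split_ifs <;> fun_prop
  continuous_invFun := by
    refine continuous_pi fun i => ?_
    split_ifs <;> fun_prop

lemma flipV_flipV (x : Fin (d + 2) → ℝ) : flipV (flipV x) = x := flipV.left_inv x

lemma measurePreserving_flipV : MeasurePreserving (flipV (d := d)).toMeasurableEquiv := by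
  refine volume_preserving_pi (f := fun i (t : ℝ) => if i = (0 : Fin (d + 2)) then t else -t) fun i => ?_
  split_ifs
  · exact MeasurePreserving.id _
  · exact Measure.measurePreserving_neg _

lemma prR_flipV (x y : Fin (d + 2) → ℝ) : prR x (flipV y) = ∑ i, x i * y i := by
  rw [prR, Fin.sum_univ_succ, Fin.sum_univ_succ (fun i => x i * y i)]
  have : ∀ i : Fin (d + 1), x i.succ * flipV y i.succ = -(x i.succ * y i.succ) := fun i => by
    simp [flipV, Fin.succ_ne_zero]
  simp only [this, Finset.sum_neg_distrib]
  have h0 : flipV y 0 = y 0 := by simp [flipV]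
  rw [h0]; ring

lemma fourier_inversion {h : (Fin (d + 2) → ℝ) → ℂ} (hc : Continuous h) (hi : Integrable h)
    (hK : Integrable fun x => ∫ ξ, h ξ * cexp (-(I * prR x ξ))) (ξ : Fin (d + 2) → ℝ) :
    ∫ x, (∫ η, h η * cexp (-(I * prR x η))) * cexp (I * prR x ξ) =
      (2 * Real.pi : ℝ) ^ (d + 2) * h ξ := by
  set E := EuclideanSpace ℝ (Fin (d + 2)) with hE
  set e : E ≃ᵐ (Fin (d + 2) → ℝ) := (MeasurableEquiv.toLp 2 (Fin (d + 2) → ℝ)).symm with he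
  have hep : MeasurePreserving e := PiLp.volume_preserving_ofLp _
  set K : (Fin (d + 2) → ℝ) → ℂ := fun x => ∫ η, h η * cexp (-(I * prR x η)) with hKd
  set H : E → ℂ := fun η => h (flipV (e η)) with hH
  have hecont : Continuous e := PiLp.continuous_ofLp 2 _
  have hin : ∀ u v : E, inner ℝ u v = prR (e v) (flipV (e u)) := fun u v => by
    rw [prR_flipV, PiLp.inner_apply]
    rfl
  have hKF : ∀ u : E, 𝓕 H u = K ((2 * Real.pi) • e u) := fun u => by
    rw [Real.fourier_eq', hKd]
    simp only
    rw [← measurePreserving_flipV.integral_comp', ← hep.integral_comp']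
    refine integral_congr_ae (.of_forall fun v => ?_)
    simp only [hH, smul_eq_mul, hin, prR_smul_left, Homeomorph.toMeasurableEquiv_coe]
    rw [mul_comm]
    congr 2
    push_cast; ring
  have h2 : Integrable (𝓕 H) := by
    rw [show 𝓕 H = (fun x => K ((2 * Real.pi) • x)) ∘ e from funext hKF,
      hep.integrable_comp_emb e.measurableEmbedding]
    exact (integrable_comp_smul_iff _ _ (by positivity)).2 hK
  have h1 : Integrable H :=
    hep.integrable_comp_of_integrable (measurePreserving_flipV.integrable_comp_of_integrable hi)
  have key := congrFun (Continuous.fourierInv_fourier_eq (f := H)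
    (hc.comp (flipV.continuous.comp hecont)) h1 h2) (e.symm (flipV ξ))
  rw [Real.fourierInv_eq'] at key
  have e1 : H (e.symm (flipV ξ)) = h ξ := by
    simp only [hH, MeasurableEquiv.apply_symm_apply, flipV_flipV]
  rw [e1] at key
  have e2 : ∫ v : E, cexp (((2 * Real.pi * inner ℝ v (e.symm (flipV ξ)) : ℝ) : ℂ) * I) • 𝓕 H v =
      ∫ v : E, (fun x => K ((2 * Real.pi) • x) * cexp (I * prR ((2 * Real.pi) • x) ξ)) (e v) := by
    refine integral_congr_ae (.of_forall fun v => ?_)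
    simp only [smul_eq_mul, hKF, prR_smul_left]
    rw [real_inner_comm, hin, MeasurableEquiv.apply_symm_apply, flipV_flipV, mul_comm]
    congr 2
    push_cast; ring
  rw [e2, hep.integral_comp' (g := fun x => K ((2 * Real.pi) • x) * cexp (I * prR ((2 * Real.pi) • x) ξ)),
    Measure.integral_comp_smul volume (fun x => K x * cexp (I * prR x ξ))] at key
  rw [← key, Module.finrank_fin_fun, abs_of_pos (by positivity), real_smul, ← mul_assoc]
  push_cast
  rw [mul_inv_cancel₀, one_mul]
  exact pow_ne_zero _ (by simp [Real.pi_ne_zero])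

lemma prR_neg_left (x ξ : Fin (d + 2) → ℝ) : prR (-x) ξ = -prR x ξ := by
  rw [← neg_one_smul ℝ, prR_smul_left]; ring

lemma prR_neg_right (x ξ : Fin (d + 2) → ℝ) : prR x (-ξ) = -prR x ξ := by
  rw [prR_comm, prR_neg_left, prR_comm]

lemma fourier_inversion' {h : (Fin (d + 2) → ℝ) → ℂ} (hc : Continuous h) (hi : Integrable h)
    (hK : Integrable fun x => ∫ ξ, h ξ * cexp (I * prR x ξ)) (ξ : Fin (d + 2) → ℝ) :
    ∫ x, (∫ η, h η * cexp (I * prR x η)) * cexp (-(I * prR x ξ)) =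
      (2 * Real.pi : ℝ) ^ (d + 2) * h ξ := by
  have e : ∀ x, ∫ η, h (-η) * cexp (-(I * prR x η)) = ∫ η, h η * cexp (I * prR x η) := fun x => by
    rw [← integral_neg_eq_self]
    refine integral_congr_ae (.of_forall fun η => ?_)
    simp [prR_neg_right]
  have := fourier_inversion (h := fun ξ => h (-ξ)) (hc.comp continuous_neg) hi.comp_neg
    (by simpa only [e] using hK) (-ξ)
  simpa only [e, prR_neg_right, neg_neg, ofReal_neg, mul_neg] using this

end fourierInversion

section kernel

variable {d : ℕ}

lemma prC_cpt (x y ξ : Fin (d + 2) → ℝ) : prC (cpt x y) ξ = prR x ξ + I * prR y ξ := by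
  have : cpt x y = (fun i => (x i : ℂ)) + I • (fun i => (y i : ℂ)) := by
    ext i; simp [cpt]; ring
  rw [this, prC_add, prC_smul, prC_ofReal, prC_ofReal]

lemma cexp_prC_cpt (x y ξ : Fin (d + 2) → ℝ) :
    cexp (I * prC (cpt x y) ξ) = Real.exp (-prR y ξ) * cexp (I * prR x ξ) := by
  rw [prC_cpt, mul_add, ← mul_assoc, I_mul_I, Complex.exp_add, mul_comm]
  push_cast; simp

lemma norm_cexp_I_mul (r : ℝ) : ‖cexp (I * r)‖ = 1 := by
  rw [mul_comm, norm_exp_ofReal_mul_I]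

lemma norm_cexp_neg_I_mul (r : ℝ) : ‖cexp (-(I * r))‖ = 1 := by
  have := norm_cexp_I_mul (-r)
  simpa using this

lemma measurable_lapT {g : (Fin (d + 2) → ℝ) → ℂ} (hg : Measurable g) : Measurable (lapT g) := by
  refine StronglyMeasurable.measurable (StronglyMeasurable.integral_prod_right
    (f := fun z ξ => g ξ * cexp (I * prC z ξ)) (Measurable.stronglyMeasurable ?_))
  have := (continuous_prC (d := d)).measurable
  unfold Function.uncurry
  fun_prop

lemma cpt_mem_tube {n : ℕ} [NeZero n] {x y : Fin n → ℝ} : cpt x y ∈ tube n ↔ y ∈ cone n := by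
  simp only [tube, mem_ofPred_eq, imP_cpt]

lemma LI_lor_pow (N : ℕ) : LI (fun ξ : Fin (d + 2) → ℝ => (lor ξ : ℂ) ^ N) := by
  have := (ofReal_toReal_laplace (d := d) (κ := N)
    (lt_of_lt_of_le (by norm_num) (Nat.cast_nonneg N))).1
  simpa only [Real.rpow_natCast, ofReal_pow] using this

/-- The Fourier transform of the kernel. -/
def kerHat (N : ℕ) (w ξ : Fin (d + 2) → ℝ) : ℂ :=
  (cone (d + 2)).indicator (fun ξ => (lor ξ : ℂ) ^ N * (Real.exp (-prR w ξ) : ℝ)) ξ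

/-- The Laplace transform of a power of the Lorentz form, restricted to a translate of `ℝⁿ`. -/
def ker (N : ℕ) (w x : Fin (d + 2) → ℝ) : ℂ :=
  lapT (fun ξ : Fin (d + 2) → ℝ => (lor ξ : ℂ) ^ N) (cpt x w)

lemma measurable_ker (N : ℕ) : Measurable fun q : (Fin (d + 2) → ℝ) × (Fin (d + 2) → ℝ) => ker N q.1 q.2 := by
  have h1 := measurable_lapT (LI_lor_pow (d := d) N).1
  exact h1.comp ((continuous_cpt.comp continuous_swap).measurable)

lemma lor_eq_zero_of_mem_frontier {ξ : Fin (d + 2) → ℝ} (h : ξ ∈ frontier (cone (d + 2))) : lor ξ = 0 := by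
  rw [isOpen_cone.frontier_eq] at h
  obtain ⟨h1, h2⟩ := h
  have hcl : closure (cone (d + 2)) ⊆ {ξ | 0 ≤ lor ξ ∧ 0 ≤ ξ 0} := by
    refine closure_minimal (fun ξ h => ⟨h.1.le, h.2.le⟩) ?_
    exact (isClosed_le continuous_const continuous_lor).inter
      (isClosed_le continuous_const (continuous_apply 0))
  obtain ⟨h3, h4⟩ := hcl h1
  rcases h3.eq_or_lt with h3 | h3
  · exact h3.symm
  rcases h4.eq_or_lt with h4 | h4
  · refine le_antisymm ?_ h3.le
    rw [lor, ← h4]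
    have : 0 ≤ ∑ i, ξ i ^ 2 := Finset.sum_nonneg fun _ _ => sq_nonneg _
    linarith
  · exact absurd ⟨h3, h4⟩ h2

lemma continuous_kerHat {N : ℕ} (hN : N ≠ 0) (w : Fin (d + 2) → ℝ) : Continuous (kerHat N w) := by
  have h1 : Continuous (fun ξ : Fin (d + 2) → ℝ => (lor ξ : ℂ) ^ N * (Real.exp (-prR w ξ) : ℝ)) := by
    have := continuous_lor (n := d + 2)
    unfold prR; fun_prop
  refine continuous_indicator (fun ξ hξ => ?_) h1.continuousOn
  rw [lor_eq_zero_of_mem_frontier hξ]; simp [hN]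

lemma integrable_kerHat (N : ℕ) {w : Fin (d + 2) → ℝ} (hw : w ∈ cone (d + 2)) : Integrable (kerHat N w) := by
  unfold kerHat
  refine (integrable_indicator_iff isOpen_cone.measurableSet).2 ?_
  have := (LI_lor_pow (d := d) N).integrableOn (z := cpt 0 w) (by rwa [cpt_mem_tube])
  refine this.congr (.of_forall fun ξ => ?_)
  simp only [cexp_prC_cpt]
  simp [prR]

lemma ker_eq (N : ℕ) (w x : Fin (d + 2) → ℝ) : ker N w x = ∫ ξ, kerHat N w ξ * cexp (I * prR x ξ) := by
  rw [ker, lapT, ← integral_indicator isOpen_cone.measurableSet]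
  refine integral_congr_ae (.of_forall fun ξ => ?_)
  simp only [kerHat, indicator, cexp_prC_cpt]
  split_ifs
  · ring
  · simp

lemma kerHat_mul (N M : ℕ) (w v ξ : Fin (d + 2) → ℝ) :
    kerHat N w ξ * kerHat M v ξ = kerHat (N + M) (w + v) ξ := by
  simp only [kerHat, indicator]
  split_ifs
  · rw [prR_add_left, neg_add, Real.exp_add]; push_cast; ring
  · simp

lemma conj_kerHat (N : ℕ) (w ξ : Fin (d + 2) → ℝ) : (starRingEnd ℂ) (kerHat N w ξ) = kerHat N w ξ := by
  simp only [kerHat, indicator]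
  split_ifs
  · simp [← Complex.exp_conj]
  · simp

lemma norm_ker_le (N : ℕ) : ∃ K : ℝ, 0 < K ∧ ∀ w ∈ cone (d + 2), ∀ x,
    ‖ker N w x‖ ≤ K * lor w ^ (-((N : ℝ) + ((d + 2 : ℕ) : ℝ) / 2)) := by
  obtain ⟨K, hK, h⟩ := norm_lapT_lor_pow (d := d) N
  refine ⟨K, hK, fun w hw x => ?_⟩
  rw [ker, h _ (by rwa [cpt_mem_tube])]
  exact mul_le_mul_of_nonneg_left (Real.rpow_le_rpow_of_nonpos hw.1 (lor_le_norm_lorC hw x)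
    (neg_nonpos.2 (by positivity))) hK.le

lemma lintegral_ker {N : ℕ} (hN : (d : ℝ) / 2 < N) : ∃ K : ℝ≥0∞, K ≠ ⊤ ∧ ∀ w ∈ cone (d + 2),
    ∫⁻ x, ‖ker N w x‖ₑ = K * ENNReal.ofReal (lor w ^ (-(N : ℝ))) := by
  obtain ⟨K, hK, h⟩ := norm_lapT_lor_pow (d := d) N
  obtain ⟨K', hK', h'⟩ := lintegral_norm_lorC (d := d) (β := (N : ℝ) + ((d + 2 : ℕ) : ℝ) / 2)
    (by push_cast; linarith)
  refine ⟨ENNReal.ofReal K * K', ENNReal.mul_ne_top ENNReal.ofReal_ne_top hK', fun w hw => ?_⟩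
  have e : ∀ x, ‖ker N w x‖ₑ = ENNReal.ofReal K *
      ENNReal.ofReal (‖lorC (cpt x w)‖ ^ (-((N : ℝ) + ((d + 2 : ℕ) : ℝ) / 2))) := fun x => by
    rw [← ofReal_norm, ker, h _ (by rwa [cpt_mem_tube]), ENNReal.ofReal_mul hK.le]
  simp only [e]
  rw [lintegral_const_mul' _ _ ENNReal.ofReal_ne_top, h' w hw, mul_assoc]
  congr 3
  ring_nf

lemma integrable_ker {N : ℕ} (hN : (d : ℝ) / 2 < N) {w : Fin (d + 2) → ℝ} (hw : w ∈ cone (d + 2)) :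
    Integrable (ker N w) := by
  obtain ⟨K, hK, h⟩ := lintegral_ker hN
  refine ⟨((measurable_ker N).comp (f := fun x => (w, x)) (by fun_prop)).aestronglyMeasurable, ?_⟩
  rw [hasFiniteIntegral_iff_enorm, h w hw]
  exact ENNReal.mul_lt_top hK.lt_top ENNReal.ofReal_lt_top

lemma fourier_ker {N : ℕ} (hN : (d : ℝ) / 2 < N) {w : Fin (d + 2) → ℝ} (hw : w ∈ cone (d + 2))
    (ξ : Fin (d + 2) → ℝ) :
    ∫ x, ker N w x * cexp (-(I * prR x ξ)) = (2 * Real.pi : ℝ) ^ (d + 2) * kerHat N w ξ := by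
  have hN0 : N ≠ 0 := by
    rintro rfl
    have : (0 : ℝ) ≤ d := Nat.cast_nonneg d
    simp at hN; linarith
  have := fourier_inversion' (continuous_kerHat hN0 w) (integrable_kerHat N hw)
    (by simpa only [← ker_eq] using integrable_ker hN hw) ξ
  simpa only [← ker_eq] using this

/-- Integrating the kernel against the Fourier integral of an integrable function. -/
lemma integral_ker_mul_fourier {N : ℕ} (hN : (d : ℝ) / 2 < N) {w : Fin (d + 2) → ℝ}
    (hw : w ∈ cone (d + 2)) {h : (Fin (d + 2) → ℝ) → ℂ} (hh : Integrable h) (x : Fin (d + 2) → ℝ) :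
    ∫ u, ker N w (x - u) * ∫ ξ, h ξ * cexp (I * prR u ξ) =
      (2 * Real.pi : ℝ) ^ (d + 2) * ∫ ξ, kerHat N w ξ * h ξ * cexp (I * prR x ξ) := by
  have hint : Integrable (fun q : (Fin (d + 2) → ℝ) × (Fin (d + 2) → ℝ) =>
      ker N w (x - q.1) * (h q.2 * cexp (I * prR q.1 q.2))) := by
    have h1 := ((integrable_ker hN hw).comp_sub_left x).mul_prod hh
    refine h1.mono ?_ (.of_forall fun q => ?_)
    · have h2 : Measurable fun q : (Fin (d + 2) → ℝ) × (Fin (d + 2) → ℝ) => cexp (I * prR q.1 q.2) := by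
        have := (continuous_prR (d := d)).measurable; fun_prop
      have := h1.aestronglyMeasurable.mul h2.aestronglyMeasurable
      refine this.congr (.of_forall fun q => ?_)
      simp only [Pi.mul_apply]; ring
    · rw [norm_mul, norm_mul, norm_mul, norm_cexp_I_mul, mul_one]
  simp only [← integral_const_mul]
  rw [integral_integral_swap hint]
  refine integral_congr_ae (.of_forall fun ξ => ?_)
  simp only
  have e1 : ∀ u, ker N w (x - u) * (h ξ * cexp (I * prR u ξ)) =
      (h ξ * cexp (I * prR x ξ)) * (ker N w (x - u) * cexp (-(I * prR (x - u) ξ))) := fun u => by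
    have : prR (x - u) ξ = prR x ξ - prR u ξ := by
      rw [sub_eq_add_neg, prR_add_left, prR_neg_left]; ring
    rw [this]
    have : cexp (I * prR u ξ) = cexp (I * prR x ξ) * cexp (-(I * ((prR x ξ - prR u ξ : ℝ) : ℂ))) := by
      rw [← Complex.exp_add]; congr 1; push_cast; ring
    rw [this]; ring
  simp only [e1]
  rw [integral_const_mul, integral_sub_left_eq_self (fun u => ker N w u * cexp (-(I * prR u ξ))),
    fourier_ker hN hw]
  ring

lemma conj_ker (N : ℕ) (w x : Fin (d + 2) → ℝ) : (starRingEnd ℂ) (ker N w x) = ker N w (-x) := by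
  rw [ker_eq, ker_eq, ← integral_conj]
  refine integral_congr_ae (.of_forall fun ξ => ?_)
  simp only [map_mul, conj_kerHat, ← Complex.exp_conj, conj_I, conj_ofReal, prR_neg_left, ofReal_neg]
  ring_nf

lemma integral_ker_mul_ker {N : ℕ} (hN : (d : ℝ) / 2 < N) {w v : Fin (d + 2) → ℝ}
    (hw : w ∈ cone (d + 2)) (hv : v ∈ cone (d + 2)) (a b : Fin (d + 2) → ℝ) :
    ∫ x, ker N w (x - a) * (starRingEnd ℂ) (ker N v (x - b)) =
      (2 * Real.pi : ℝ) ^ (d + 2) * ker (N + N) (w + v) (b - a) := by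
  have h1 := integral_ker_mul_fourier hN hw (integrable_kerHat N hv) (b - a)
  simp only [kerHat_mul, ← ker_eq] at h1
  rw [← h1, ← integral_sub_left_eq_self _ volume b]
  refine integral_congr_ae (.of_forall fun u => ?_)
  simp only [conj_ker]
  congr 2 <;> abel

end kernel

section representation

variable {d : ℕ}

lemma integral_ker_mul_lapT {N : ℕ} (hN : (d : ℝ) / 2 < N) {w v : Fin (d + 2) → ℝ}
    (hw : w ∈ cone (d + 2)) (hv : v ∈ cone (d + 2)) {g : (Fin (d + 2) → ℝ) → ℂ} (hg : LI g)
    (x : Fin (d + 2) → ℝ) :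
    ∫ u, ker N w (x - u) * lapT g (cpt u v) =
      (2 * Real.pi : ℝ) ^ (d + 2) * lapT (fun ξ => g ξ * (lor ξ : ℂ) ^ N) (cpt x (w + v)) := by
  have hi := hg.integrableOn (z := cpt 0 v) (by rwa [cpt_mem_tube])
  have e1 : ∀ u, lapT g (cpt u v) = ∫ ξ, (cone (d + 2)).indicator
      (fun ξ => g ξ * cexp (I * prC (cpt 0 v) ξ)) ξ * cexp (I * prR u ξ) := fun u => by
    rw [lapT, ← integral_indicator isOpen_cone.measurableSet]
    refine integral_congr_ae (.of_forall fun ξ => ?_)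
    simp only [indicator]
    split_ifs
    · rw [cexp_prC_cpt, cexp_prC_cpt, ← zero_smul ℝ (0 : Fin (d + 2) → ℝ), prR_smul_left]
      simp; ring
    · simp
  simp only [e1]
  rw [integral_ker_mul_fourier hN hw ((integrable_indicator_iff isOpen_cone.measurableSet).2 hi)]
  congr 1
  rw [lapT, ← integral_indicator isOpen_cone.measurableSet]
  refine integral_congr_ae (.of_forall fun ξ => ?_)
  simp only [indicator, kerHat]
  split_ifs
  · rw [cexp_prC_cpt, cexp_prC_cpt, ← zero_smul ℝ (0 : Fin (d + 2) → ℝ), prR_smul_left,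
      prR_add_left, neg_add, Real.exp_add]
    push_cast; simp; ring
  · simp

lemma lor_smul {n : ℕ} [NeZero n] (c : ℝ) (y : Fin n → ℝ) : lor (c • y) = c ^ 2 * lor y := by
  simp only [lor, Pi.smul_apply, smul_eq_mul, mul_pow, ← Finset.mul_sum]; ring

lemma integral_lor_rpow_mul_lapT {a : ℝ} {M : ℕ} (ha : -1 < a) (haM : a + ((d + 2 : ℕ) : ℝ) / 2 = M) :
    ∃ c : ℝ, 0 < c ∧ ∀ g : (Fin (d + 2) → ℝ) → ℂ, LI g → ∀ x, ∀ y ∈ cone (d + 2),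
      ∫ v in cone (d + 2), ((lor v ^ a : ℝ) : ℂ) *
        lapT (fun ξ => g ξ * (lor ξ : ℂ) ^ M) (cpt x (y + (v + v))) = c * lapT g (cpt x y) := by
  obtain ⟨-, K, hK, h⟩ := ofReal_toReal_laplace (d := d) ha
  rw [haM] at h
  refine ⟨K * 4 ^ (-(M : ℝ)), by positivity, fun g hg x y hy => ?_⟩
  have hml := (continuous_lor (n := d + 2)).measurable
  have hgm := hg.1
  have hmeas : Measurable (fun q : (Fin (d + 2) → ℝ) × (Fin (d + 2) → ℝ) => ((lor q.1 ^ a : ℝ) : ℂ) *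
      (g q.2 * (lor q.2 : ℂ) ^ M * cexp (I * prC (cpt x (y + (q.1 + q.1))) q.2))) := by
    have h1 : Continuous fun q : (Fin (d + 2) → ℝ) × (Fin (d + 2) → ℝ) =>
        prC (cpt x (y + (q.1 + q.1))) q.2 := by unfold prC cpt; fun_prop
    have := h1.measurable
    fun_prop
  have hv : ∀ ξ ∈ cone (d + 2), ∫ v in cone (d + 2), lor v ^ a * Real.exp (-prR (v + v) ξ) =
      K * 4 ^ (-(M : ℝ)) * lor ξ ^ (-(M : ℝ)) := fun ξ hξ => by
    rw [mul_assoc, ← Real.mul_rpow (by norm_num) hξ.1.le,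
      show (4 : ℝ) * lor ξ = lor ((2 : ℝ) • ξ) by rw [lor_smul]; norm_num,
      ← h _ (smul_mem_cone hξ two_pos)]
    refine integral_congr_ae (.of_forall fun v => ?_)
    simp only
    rw [prR_smul_left, prR_comm (v + v), prR_add_right, two_mul]
  have hne : ∀ ξ ∈ cone (d + 2), K * 4 ^ (-(M : ℝ)) * lor ξ ^ (-(M : ℝ)) ≠ 0 := fun ξ hξ =>
    (mul_pos (by positivity) (Real.rpow_pos_of_pos hξ.1 _)).ne'
  have hvi : ∀ ξ ∈ cone (d + 2),
      IntegrableOn (fun v => lor v ^ a * Real.exp (-prR (v + v) ξ)) (cone (d + 2)) := fun ξ hξ => by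
    by_contra hcon
    exact hne ξ hξ (by rw [← hv ξ hξ, integral_undef hcon])
  have hfac : ∀ v ξ : Fin (d + 2) → ℝ, ((lor v ^ a : ℝ) : ℂ) *
      (g ξ * (lor ξ : ℂ) ^ M * cexp (I * prC (cpt x (y + (v + v))) ξ)) =
      (g ξ * (lor ξ : ℂ) ^ M * cexp (I * prC (cpt x y) ξ)) *
        ((lor v ^ a * Real.exp (-prR (v + v) ξ) : ℝ) : ℂ) := fun v ξ => by
    rw [cexp_prC_cpt, cexp_prC_cpt, prR_add_left, neg_add, Real.exp_add]
    push_cast; ring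
  have hpow : ∀ ξ ∈ cone (d + 2), lor ξ ^ M * lor ξ ^ (-(M : ℝ)) = 1 := fun ξ hξ => by
    rw [Real.rpow_neg hξ.1.le, Real.rpow_natCast, mul_inv_cancel₀ (pow_ne_zero _ hξ.1.ne')]
  have hint : Integrable (fun q : (Fin (d + 2) → ℝ) × (Fin (d + 2) → ℝ) => ((lor q.1 ^ a : ℝ) : ℂ) *
      (g q.2 * (lor q.2 : ℂ) ^ M * cexp (I * prC (cpt x (y + (q.1 + q.1))) q.2)))
      ((volume.restrict (cone (d + 2))).prod (volume.restrict (cone (d + 2)))) := by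
    rw [integrable_prod_iff' hmeas.aestronglyMeasurable]
    simp only [hfac]
    constructor
    · exact ae_restrict_of_forall_mem isOpen_cone.measurableSet fun ξ hξ =>
        ((hvi ξ hξ).ofReal).const_mul _
    · have h1 := (hg.2 y hy).const_mul (K * 4 ^ (-(M : ℝ)))
      refine h1.congr (ae_restrict_of_forall_mem isOpen_cone.measurableSet fun ξ hξ => ?_)
      simp only [norm_mul, norm_real]
      rw [integral_const_mul]
      have e1 : ∫ v in cone (d + 2), ‖lor v ^ a‖ * ‖Real.exp (-prR (v + v) ξ)‖ =
          ∫ v in cone (d + 2), lor v ^ a * Real.exp (-prR (v + v) ξ) :=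
        setIntegral_congr_fun isOpen_cone.measurableSet fun v hv => by
          simp only [Real.norm_eq_abs]
          rw [abs_of_pos (Real.exp_pos _), abs_of_pos (Real.rpow_pos_of_pos hv.1 _)]
      rw [e1, hv ξ hξ, norm_exp_prC, imP_cpt, norm_pow, norm_real, Real.norm_eq_abs,
        abs_of_pos hξ.1]
      linear_combination (-‖g ξ‖ * Real.exp (-prR y ξ) * K * 4 ^ (-(M : ℝ))) * hpow ξ hξ
  simp only [lapT, ← integral_const_mul]
  rw [integral_integral_swap hint]
  refine setIntegral_congr_fun isOpen_cone.measurableSet fun ξ hξ => ?_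
  simp only [hfac]
  rw [integral_const_mul, integral_complex_ofReal, hv ξ hξ]
  have h2 : (lor ξ : ℂ) ^ M * ((lor ξ ^ (-(M : ℝ)) : ℝ) : ℂ) = 1 := by exact_mod_cast hpow ξ hξ
  rw [ofReal_mul]
  linear_combination (g ξ * cexp (I * prC (cpt x y) ξ)) * ((K * 4 ^ (-(M : ℝ)) : ℝ) : ℂ) * h2

lemma lor_rpow_eq {y : Fin (d + 2) → ℝ} (hy : y ∈ cone (d + 2)) (a : ℝ) :
    lor y ^ a = cA y ^ a * cT y ^ a := by
  rw [mem_cone_iff] at hy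
  rw [lor_eq_mul hy.1.ne', Real.mul_rpow hy.1.le hy.2.le]

/-- The space of pairs `(v, u)` with `v` in the cone. -/
def cvol (d : ℕ) : Measure ((Fin (d + 2) → ℝ) × (Fin (d + 2) → ℝ)) :=
  (volume.restrict (cone (d + 2))).prod volume

/-- The integral operator recovering a function from its derivative. -/
def recOp (N : ℕ) (a : ℝ) (φ : (Fin (d + 2) → ℝ) × (Fin (d + 2) → ℝ) → ℂ) (x y : Fin (d + 2) → ℝ) : ℂ :=
  ∫ q, ((lor q.1 ^ a : ℝ) : ℂ) * ker N (y + q.1) (x - q.2) * φ q ∂(cvol d)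

lemma norm_lapT_le {g : (Fin (d + 2) → ℝ) → ℂ} {M : ℝ} (hM : ∀ ξ, ‖g ξ‖ ≤ M) (m : ℕ) :
    ∃ C : ℝ, 0 ≤ C ∧ ∀ x, ∀ y ∈ cone (d + 2), ‖lapT (fun ξ => g ξ * (lor ξ : ℂ) ^ m) (cpt x y)‖ ≤
      C * lor y ^ (-((m : ℝ) + ((d + 2 : ℕ) : ℝ) / 2)) := by
  have hM0 : 0 ≤ M := (norm_nonneg _).trans (hM 0)
  obtain ⟨-, K, hK, h⟩ := ofReal_toReal_laplace (d := d) (κ := m)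
    (lt_of_lt_of_le (by norm_num) (Nat.cast_nonneg m))
  have hLI := LI_lor_pow (d := d) m
  refine ⟨M * K, by positivity, fun x y hy => ?_⟩
  rw [mul_assoc, ← h y hy, ← integral_const_mul]
  refine norm_integral_le_of_norm_le ?_
    (ae_restrict_of_forall_mem isOpen_cone.measurableSet fun ξ hξ => ?_)
  · refine (((hLI.2 y hy)).const_mul M).congr
      (ae_restrict_of_forall_mem isOpen_cone.measurableSet fun ξ hξ => ?_)
    simp only [norm_pow, norm_real, Real.norm_eq_abs, abs_of_pos hξ.1, Real.rpow_natCast]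
  · rw [norm_mul, norm_exp_prC, imP_cpt, norm_mul, norm_pow, norm_real, Real.norm_eq_abs,
      abs_of_pos hξ.1, Real.rpow_natCast, mul_assoc]
    have := hξ.1
    gcongr
    exact hM ξ

lemma LI_of_bounded {g : (Fin (d + 2) → ℝ) → ℂ} (hg : Measurable g) {M : ℝ} (hM : ∀ ξ, ‖g ξ‖ ≤ M) : LI g := by
  refine ⟨hg, fun y hy => ?_⟩
  have h1 := ((LI_lor_pow (d := d) 0).2 y hy).const_mul M
  refine h1.mono' (Measurable.aestronglyMeasurable (by have := measurable_prR y; fun_prop)) ?_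
  refine .of_forall fun ξ => ?_
  simp only [norm_mul, pow_zero, norm_one, one_mul, Real.norm_eq_abs, Real.abs_exp]
  gcongr; rw [abs_norm]; exact hM ξ

lemma ae_cvol_of_forall_mem {p : (Fin (d + 2) → ℝ) × (Fin (d + 2) → ℝ) → Prop}
    (h : ∀ v ∈ cone (d + 2), ∀ u, p (v, u)) : ∀ᵐ q ∂(cvol d), p q := by
  have : cvol d = (volume.prod volume).restrict (cone (d + 2) ×ˢ univ) := by
    rw [cvol, ← Measure.prod_restrict, Measure.restrict_univ]
  rw [this]
  exact ae_restrict_of_forall_mem (isOpen_cone.measurableSet.prod .univ) fun q hq => h q.1 hq.1 q.2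

lemma measurable_recOp_integrand (N : ℕ) (a : ℝ) : Measurable
    fun r : ((Fin (d + 2) → ℝ) × (Fin (d + 2) → ℝ)) × ((Fin (d + 2) → ℝ) × (Fin (d + 2) → ℝ)) =>
      ((lor r.2.1 ^ a : ℝ) : ℂ) * ker N (r.1.2 + r.2.1) (r.1.1 - r.2.2) := by
  have hml := (continuous_lor (n := d + 2)).measurable
  have h1 := (measurable_ker (d := d) N).comp (f := fun r : ((Fin (d + 2) → ℝ) ×
    (Fin (d + 2) → ℝ)) × ((Fin (d + 2) → ℝ) × (Fin (d + 2) → ℝ)) => (r.1.2 + r.2.1, r.1.1 - r.2.2))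
    (by fun_prop)
  exact Measurable.mul (by fun_prop) h1

/-- The integral representation by means of a derivative of the Laplace transform. -/
lemma lapT_eq_recOp {N m : ℕ} {a : ℝ} (hN : (d : ℝ) + 1 < N)
    (haM : a + ((d + 2 : ℕ) : ℝ) / 2 = m + N) :
    ∃ c : ℂ, ∀ g : (Fin (d + 2) → ℝ) → ℂ, Measurable g → (∃ M, ∀ ξ, ‖g ξ‖ ≤ M) →
      ∀ x, ∀ y ∈ cone (d + 2),
      Integrable (fun q => ((lor q.1 ^ a : ℝ) : ℂ) * ker N (y + q.1) (x - q.2) *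
        lapT (fun ξ => g ξ * (lor ξ : ℂ) ^ m) (cpt q.2 q.1)) (cvol d) ∧
      lapT g (cpt x y) = c * recOp N a (fun q => lapT (fun ξ => g ξ * (lor ξ : ℂ) ^ m) (cpt q.2 q.1)) x y := by
  have hd0 : (0 : ℝ) ≤ d := Nat.cast_nonneg d
  have hm0 : (0 : ℝ) ≤ m := Nat.cast_nonneg m
  have ha : -1 < a := by push_cast at haM; linarith
  obtain ⟨c, hc, h⟩ := integral_lor_rpow_mul_lapT (d := d) (a := a) (M := m + N) ha
    (by rw [haM]; push_cast; ring)
  have hN2 : (d : ℝ) / 2 < N := by linarith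
  set P : ℂ := ((2 * Real.pi : ℝ) : ℂ) ^ (d + 2) with hP
  have hP0 : P ≠ 0 := pow_ne_zero _ (by exact_mod_cast (by positivity : (2 * Real.pi) ≠ 0))
  have hc0 : (c : ℂ) ≠ 0 := by exact_mod_cast hc.ne'
  refine ⟨(c * P)⁻¹, fun g hg ⟨M, hM⟩ x y hy => ?_⟩
  have hLI := LI_of_bounded hg hM
  have hLIm := hLI.mul_lor_pow m
  have hmlap := measurable_lapT hLIm.1
  have hml := (continuous_lor (n := d + 2)).measurable
  have hmc : Measurable fun q : (Fin (d + 2) → ℝ) × (Fin (d + 2) → ℝ) => cpt q.2 q.1 :=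
    (continuous_cpt.comp continuous_swap).measurable
  have hmk : Measurable fun q : (Fin (d + 2) → ℝ) × (Fin (d + 2) → ℝ) =>
      ((lor q.1 ^ a : ℝ) : ℂ) * ker N (y + q.1) (x - q.2) :=
    (measurable_recOp_integrand N a).comp (f := fun q => ((x, y), q)) (by fun_prop)
  have hint : Integrable (fun q => ((lor q.1 ^ a : ℝ) : ℂ) * ker N (y + q.1) (x - q.2) *
        lapT (fun ξ => g ξ * (lor ξ : ℂ) ^ m) (cpt q.2 q.1)) (cvol d) := by
    have hmm := hmk.mul (hmlap.comp hmc)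
    refine ⟨hmm.aestronglyMeasurable, ?_⟩
    obtain ⟨C, hC, hCb⟩ := norm_lapT_le (d := d) hM m
    obtain ⟨K, hK, hKe⟩ := lintegral_ker (d := d) hN2
    obtain ⟨B, hB, hBe⟩ := lintegral_cone_beta (d := d) (N - d - 2) (N - d - 2) N N (by linarith)
      (by linarith) (by linarith) (by linarith)
    have hfin : ENNReal.ofReal C * K * (B * ENNReal.ofReal (cA y ^ ((N : ℝ) - d - 2 + d / 2 + 1 - N) *
        cT y ^ ((N : ℝ) - d - 2 + d / 2 + 1 - N))) < ⊤ :=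
      ENNReal.mul_lt_top (ENNReal.mul_lt_top ENNReal.ofReal_lt_top hK.lt_top)
        (ENNReal.mul_lt_top hB.lt_top ENNReal.ofReal_lt_top)
    refine lt_of_le_of_lt ?_ hfin
    rw [cvol, lintegral_prod _ (by exact hmm.enorm.aemeasurable), ← hBe y hy,
      ← lintegral_const_mul' _ _ (ENNReal.mul_ne_top ENNReal.ofReal_ne_top hK)]
    refine setLIntegral_mono' isOpen_cone.measurableSet fun v hv => ?_
    have hyv := add_mem_cone hy hv
    calc ∫⁻ u, ‖((lor v ^ a : ℝ) : ℂ) * ker N (y + v) (x - u) *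
          lapT (fun ξ => g ξ * (lor ξ : ℂ) ^ m) (cpt u v)‖ₑ
        ≤ ∫⁻ u, ENNReal.ofReal (lor v ^ a * (C * lor v ^ (-((m : ℝ) + ((d + 2 : ℕ) : ℝ) / 2)))) *
          ‖ker N (y + v) (x - u)‖ₑ := by
          refine lintegral_mono fun u => ?_
          have hp := Real.rpow_pos_of_pos hv.1 a
          rw [enorm_mul, enorm_mul, mul_right_comm, ENNReal.ofReal_mul hp.le]
          gcongr
          · rw [← ofReal_norm, norm_real, Real.norm_eq_abs, abs_of_pos hp]
          · rw [← ofReal_norm]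
            exact ENNReal.ofReal_le_ofReal (hCb u v hv)
      _ = ENNReal.ofReal (lor v ^ a * (C * lor v ^ (-((m : ℝ) + ((d + 2 : ℕ) : ℝ) / 2)))) *
          (K * ENNReal.ofReal (lor (y + v) ^ (-(N : ℝ)))) := by
          rw [lintegral_const_mul' _ _ ENNReal.ofReal_ne_top,
            lintegral_sub_left_eq_self (fun u => ‖ker N (y + v) u‖ₑ), hKe _ hyv]
      _ = _ := by
          have hp := Real.rpow_pos_of_pos hv.1
          rw [mul_left_comm, ← ENNReal.ofReal_mul (by have := hp a; have := hp (-((m : ℝ) + ((d + 2 : ℕ) : ℝ) / 2)); positivity),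
            mul_comm _ K, mul_assoc K, ← ENNReal.ofReal_mul hC]
          congr 2
          rw [mul_left_comm (lor v ^ a),
            ← Real.rpow_add hv.1, lor_rpow_eq hv, lor_rpow_eq hyv]
          rw [show a + -((m : ℝ) + ((d + 2 : ℕ) : ℝ) / 2) = N - d - 2 by push_cast at haM ⊢; linarith]
          ring
  refine ⟨hint, ?_⟩
  rw [recOp, cvol, integral_prod _ hint, eq_inv_mul_iff_mul_eq₀ (mul_ne_zero hc0 hP0), mul_right_comm,
    ← h g hLI x y hy, mul_comm _ P, ← integral_const_mul]
  refine setIntegral_congr_fun isOpen_cone.measurableSet fun v hv => ?_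
  simp only [mul_assoc]
  rw [integral_const_mul, integral_ker_mul_lapT hN2 (add_mem_cone hy hv) hv hLIm]
  simp only [mul_assoc, ← pow_add, add_assoc]
  rw [mul_left_comm]

end representation

section layer

lemma lintegral_Ioo_rpow {b s : ℝ} (hs : 0 < s) (hb : 0 ≤ b) :
    ∫⁻ t in Ioo 0 b, ENNReal.ofReal (t ^ (s - 1)) = ENNReal.ofReal (b ^ s / s) := by
  rw [setLIntegral_congr Ioo_ae_eq_Ioc, ← ofReal_integral_eq_lintegral_ofReal]
  · rw [← intervalIntegral.integral_of_le hb, integral_rpow (by left; linarith)]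
    simp [hs.ne']
  · rw [← IntegrableOn, ← intervalIntegrable_iff_integrableOn_Ioc_of_le hb]
    exact intervalIntegral.intervalIntegrable_rpow' (by linarith)
  · exact ae_restrict_of_forall_mem measurableSet_Ioc fun t ht => Real.rpow_nonneg ht.1.le _

lemma lintegral_rpow_le_of_meas_le {X Q : Type*} [MeasurableSpace X] [MeasurableSpace Q]
    {μ : Measure X} {ρ : Measure Q} [SFinite ρ] {f : X → ℂ} (hf : AEMeasurable f μ) {b : Q → ℝ}
    (hb : Measurable b) (hb0 : ∀ q, 0 ≤ b q) {W : Q → ℝ≥0∞} (hW : Measurable W) {p : ℝ} (hp : 2 < p)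
    (h : ∀ l : ℝ, 0 < l → μ {x | l < ‖f x‖} ≤
      ENNReal.ofReal (l ^ (-2 : ℝ)) * ∫⁻ q, {q | l < b q}.indicator W q ∂ρ) :
    ∫⁻ x, ENNReal.ofReal (‖f x‖ ^ p) ∂μ ≤
      ENNReal.ofReal (p / (p - 2)) * ∫⁻ q, W q * ENNReal.ofReal (b q ^ (p - 2)) ∂ρ := by
  rw [lintegral_rpow_eq_lintegral_meas_lt_mul μ (.of_forall fun x => norm_nonneg _) hf.norm
    (by linarith), ENNReal.ofReal_div_of_pos (by linarith), div_eq_mul_inv, mul_assoc]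
  gcongr
  have hmeas : Measurable (fun r : ℝ × Q => {q | r.1 < b q}.indicator W r.2 *
      ENNReal.ofReal (r.1 ^ (p - 3))) := by
    refine Measurable.mul ?_ (by fun_prop)
    have : (fun r : ℝ × Q => {q | r.1 < b q}.indicator W r.2) =
      {r : ℝ × Q | r.1 < b r.2}.indicator fun r => W r.2 := by
      ext r; simp [indicator]
    rw [this]
    exact (hW.comp measurable_snd).indicator
      (measurableSet_lt measurable_fst (hb.comp measurable_snd))
  calc ∫⁻ t in Ioi (0 : ℝ), μ {x | t < ‖f x‖} * ENNReal.ofReal (t ^ (p - 1))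
      ≤ ∫⁻ t in Ioi (0 : ℝ), ∫⁻ q, {q | t < b q}.indicator W q * ENNReal.ofReal (t ^ (p - 3)) ∂ρ := by
        refine setLIntegral_mono' measurableSet_Ioi fun t (ht : 0 < t) => ?_
        rw [lintegral_mul_const' _ _ ENNReal.ofReal_ne_top]
        grw [h t ht]
        rw [mul_right_comm, ← ENNReal.ofReal_mul (by positivity), ← Real.rpow_add ht, mul_comm]
        apply le_of_eq; congr 3; ring
    _ = ∫⁻ q, (∫⁻ t in Ioi (0 : ℝ), {q | t < b q}.indicator W q * ENNReal.ofReal (t ^ (p - 3))) ∂ρ :=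
        lintegral_lintegral_swap hmeas.aemeasurable
    _ = ∫⁻ q, (ENNReal.ofReal (p - 2))⁻¹ * (W q * ENNReal.ofReal (b q ^ (p - 2))) ∂ρ := by
        refine lintegral_congr fun q => ?_
        have e : ∀ t ∈ Ioi (0 : ℝ), {q | t < b q}.indicator W q * ENNReal.ofReal (t ^ (p - 3)) =
            W q * (Iio (b q)).indicator (fun t => ENNReal.ofReal (t ^ (p - 3))) t := fun t _ => by
          simp only [indicator, mem_ofPred_eq, mem_Iio]; split_ifs <;> simp
        rw [setLIntegral_congr_fun measurableSet_Ioi e, lintegral_const_mul _ (by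
          exact Measurable.indicator (by fun_prop) measurableSet_Iio), mul_left_comm]
        congr 1
        rw [lintegral_indicator measurableSet_Iio, Measure.restrict_restrict measurableSet_Iio,
          inter_comm, Ioi_inter_Iio, ← ENNReal.ofReal_inv_of_pos (by linarith), ← ENNReal.ofReal_mul
          (by simp; linarith), ← div_eq_inv_mul, ← lintegral_Ioo_rpow (by linarith) (hb0 q)]
        congr with t; ring_nf
    _ = _ := by rw [lintegral_const_mul _ (by fun_prop)]

end layer

section generic

variable {X Q : Type*} [MeasurableSpace X] [MeasurableSpace Q]

lemma lintegral_sq_superposition {μ : Measure X} [SFinite μ] {ρ : Measure Q} [SFinite ρ]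
    {κ : Q → X → ℂ} (hκ : Measurable (Function.uncurry κ)) {ψ : Q → ℂ} (hψ : Measurable ψ)
    (hi : Integrable ψ ρ) {C : ℝ} (hC : ∀ᵐ q ∂ρ, ∀ x, ‖κ q x‖ ≤ C) {K : ℝ≥0∞} (hK : K ≠ ⊤)
    (hKi : ∀ᵐ q ∂ρ, ∫⁻ x, ‖κ q x‖ₑ ∂μ ≤ K) :
    ∫⁻ x, ‖∫ q, κ q x * ψ q ∂ρ‖ₑ ^ 2 ∂μ ≤ 2 * ∫⁻ q, ‖ψ q‖ₑ ^ 2 *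
      (∫⁻ q', ‖∫ x, κ q x * (starRingEnd ℂ) (κ q' x) ∂μ‖ₑ ∂ρ) ∂ρ := by
  set H : Q × Q → X → ℂ := fun r x => (κ r.1 x * ψ r.1) * (starRingEnd ℂ) (κ r.2 x * ψ r.2) with hH
  have hmk1 : Measurable fun s : (Q × Q) × X => κ s.1.1 s.2 :=
    hκ.comp (f := fun s : (Q × Q) × X => (s.1.1, s.2)) (by fun_prop)
  have hmk2 : Measurable fun s : (Q × Q) × X => κ s.1.2 s.2 :=
    hκ.comp (f := fun s : (Q × Q) × X => (s.1.2, s.2)) (by fun_prop)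
  have hmH : Measurable (Function.uncurry H) := by
    have h1 : Measurable fun s : (Q × Q) × X => ψ s.1.1 := by fun_prop
    have h2 : Measurable fun s : (Q × Q) × X => ψ s.1.2 := by fun_prop
    exact (hmk1.mul h1).mul (continuous_conj.measurable.comp (hmk2.mul h2))
  have hiH : Integrable (Function.uncurry H) ((ρ.prod ρ).prod μ) := by
    refine ⟨hmH.aestronglyMeasurable, ?_⟩
    rw [hasFiniteIntegral_iff_enorm, lintegral_prod _ hmH.enorm.aemeasurable]
    have hpp := (hi.norm.mul_prod hi.norm)
    calc ∫⁻ r, (∫⁻ x, ‖H r x‖ₑ ∂μ) ∂(ρ.prod ρ)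
        ≤ ∫⁻ r, ‖‖ψ r.1‖ * ‖ψ r.2‖‖ₑ * (ENNReal.ofReal C * K) ∂(ρ.prod ρ) := by
          refine lintegral_mono_ae ?_
          filter_upwards [Measure.quasiMeasurePreserving_fst.ae hC,
            Measure.quasiMeasurePreserving_snd.ae hKi] with r h1 h2
          grw [← h2]
          rw [← lintegral_const_mul' _ _ ENNReal.ofReal_ne_top, ← lintegral_const_mul' _ _ enorm_ne_top]
          refine lintegral_mono fun x => ?_
          simp only [hH, enorm_mul, enorm_norm, RCLike.enorm_conj]
          have : ‖κ r.1 x‖ₑ ≤ ENNReal.ofReal C := by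
            rw [← ofReal_norm]; exact ENNReal.ofReal_le_ofReal (h1 x)
          grw [this]
          apply le_of_eq; ring
      _ < ⊤ := by
          rw [lintegral_mul_const' _ _ (by finiteness)]
          exact ENNReal.mul_lt_top hpp.2 (by finiteness)
  have hff : ∀ x, (∫ q, κ q x * ψ q ∂ρ) * (starRingEnd ℂ) (∫ q, κ q x * ψ q ∂ρ) =
      ∫ r, H r x ∂(ρ.prod ρ) := fun x => by
    rw [← integral_conj, ← integral_prod_mul]
  have hfi : Integrable (fun x => (∫ q, κ q x * ψ q ∂ρ) * (starRingEnd ℂ) (∫ q, κ q x * ψ q ∂ρ)) μ := by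
    simp only [hff]
    exact hiH.integral_prod_right
  have e1 : ∫⁻ x, ‖∫ q, κ q x * ψ q ∂ρ‖ₑ ^ 2 ∂μ =
      ‖∫ x, (∫ q, κ q x * ψ q ∂ρ) * (starRingEnd ℂ) (∫ q, κ q x * ψ q ∂ρ) ∂μ‖ₑ := by
    have h1 : ∀ z : ℂ, z * (starRingEnd ℂ) z = ((‖z‖ ^ 2 : ℝ) : ℂ) :=
      fun z => by rw [mul_conj, normSq_eq_norm_sq]
    simp only [h1] at hfi ⊢
    rw [integral_complex_ofReal, ← ofReal_norm, norm_real, Real.norm_eq_abs,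
      abs_of_nonneg (integral_nonneg fun x => by positivity),
      ofReal_integral_eq_lintegral_ofReal _ (.of_forall fun x => by positivity)]
    · refine lintegral_congr fun x => ?_
      rw [ENNReal.ofReal_pow (norm_nonneg _), ofReal_norm]
    · have h2 := hfi.re
      simp only [RCLike.re_to_complex, ofReal_re] at h2
      exact h2
  rw [e1]
  simp only [hff]
  rw [← integral_integral_swap hiH]
  set k : Q → Q → ℝ≥0∞ := fun q q' => ‖∫ x, κ q x * (starRingEnd ℂ) (κ q' x) ∂μ‖ₑ with hk
  have hksymm : ∀ q q', k q q' = k q' q := fun q q' => by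
    simp only [hk]
    rw [← RCLike.enorm_conj, ← integral_conj]
    simp only [map_mul, conj_conj, mul_comm]
  have hmk : Measurable fun r : Q × Q => k r.1 r.2 :=
    ((hmk1.mul (continuous_conj.measurable.comp hmk2)).stronglyMeasurable.integral_prod_right
      (ν := μ)).measurable.enorm
  have hJ : ∫⁻ r, ‖ψ r.1‖ₑ ^ 2 * k r.1 r.2 ∂(ρ.prod ρ) =
      ∫⁻ q, ‖ψ q‖ₑ ^ 2 * (∫⁻ q', k q q' ∂ρ) ∂ρ := by
    rw [lintegral_prod _ (by fun_prop)]
    refine lintegral_congr fun q => ?_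
    simp only
    rw [lintegral_const_mul' _ _ (by finiteness)]
  have hJ' : ∫⁻ r, ‖ψ r.2‖ₑ ^ 2 * k r.1 r.2 ∂(ρ.prod ρ) =
      ∫⁻ r, ‖ψ r.1‖ₑ ^ 2 * k r.1 r.2 ∂(ρ.prod ρ) := by
    rw [← lintegral_prod_swap]
    refine lintegral_congr fun r => ?_
    simp only [Prod.fst_swap, Prod.snd_swap]
    rw [hksymm]
  calc ‖∫ r, (∫ x, H r x ∂μ) ∂(ρ.prod ρ)‖ₑ
      ≤ ∫⁻ r, ‖∫ x, H r x ∂μ‖ₑ ∂(ρ.prod ρ) := enorm_integral_le_lintegral_enorm _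
    _ ≤ ∫⁻ r, (‖ψ r.1‖ₑ ^ 2 * k r.1 r.2 + ‖ψ r.2‖ₑ ^ 2 * k r.1 r.2) ∂(ρ.prod ρ) := by
        refine lintegral_mono fun r => ?_
        have e : ∫ x, H r x ∂μ = ψ r.1 * (starRingEnd ℂ) (ψ r.2) *
            ∫ x, κ r.1 x * (starRingEnd ℂ) (κ r.2 x) ∂μ := by
          rw [← integral_const_mul]
          refine integral_congr_ae (.of_forall fun x => ?_)
          simp only [hH, map_mul]; ring
        simp only [e, enorm_mul, RCLike.enorm_conj]
        have hab : ∀ a b : ℝ≥0∞, a * b ≤ a ^ 2 + b ^ 2 := fun a b => by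
          rcases le_total a b with h | h
          · exact (mul_le_mul_left h b).trans (by rw [← sq]; exact le_add_self)
          · exact (mul_le_mul_right h a).trans (by rw [← sq]; exact le_self_add)
        rw [← add_mul]
        exact mul_le_mul_left (hab _ _) _
    _ ≤ _ := by
        rw [lintegral_add_left (by fun_prop), hJ', ← two_mul, hJ]

end generic

section square

variable {d : ℕ}

instance : SigmaFinite (cvol d) := by unfold cvol; infer_instance

/-- The superposition of kernels with density `ψ`. -/
def kerOp (N : ℕ) (ψ : (Fin (d + 2) → ℝ) × (Fin (d + 2) → ℝ) → ℂ) (x y : Fin (d + 2) → ℝ) : ℂ :=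
  ∫ q, ker N (y + q.1) (x - q.2) * ψ q ∂(cvol d)

lemma ae_mem_cvol : ∀ᵐ q ∂(cvol d), q.1 ∈ cone (d + 2) :=
  ae_cvol_of_forall_mem fun _ hv _ => hv

lemma lintegral_cvol {f : (Fin (d + 2) → ℝ) × (Fin (d + 2) → ℝ) → ℝ≥0∞} (hf : Measurable f) :
    ∫⁻ q, f q ∂(cvol d) = ∫⁻ v in cone (d + 2), ∫⁻ u, f (v, u) := by
  rw [cvol, lintegral_prod _ hf.aemeasurable]

lemma norm_ker_add_le (N : ℕ) {y : Fin (d + 2) → ℝ} (hy : y ∈ cone (d + 2)) :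
    ∃ C : ℝ, 0 ≤ C ∧ ∀ v ∈ cone (d + 2), ∀ x, ‖ker N (y + v) x‖ ≤ C := by
  obtain ⟨K, hK, h⟩ := norm_ker_le (d := d) N
  refine ⟨K * lor y ^ (-((N : ℝ) + ((d + 2 : ℕ) : ℝ) / 2)), ?_, fun v hv x =>
    (h _ (add_mem_cone hy hv) x).trans ?_⟩
  · have := hy.1; positivity
  · have hN : -((N : ℝ) + ((d + 2 : ℕ) : ℝ) / 2) ≤ 0 := neg_nonpos.2 (by positivity)
    exact mul_le_mul_of_nonneg_left (Real.rpow_le_rpow_of_nonpos hy.1 (lor_le_add hy hv) hN) hK.le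

lemma measurable_ker_sub (N : ℕ) : Measurable
    fun r : ((Fin (d + 2) → ℝ) × (Fin (d + 2) → ℝ)) × ((Fin (d + 2) → ℝ) × (Fin (d + 2) → ℝ)) =>
      ker N (r.1.2 + r.2.1) (r.1.1 - r.2.2) :=
  (measurable_ker (d := d) N).comp (f := fun r : ((Fin (d + 2) → ℝ) ×
    (Fin (d + 2) → ℝ)) × ((Fin (d + 2) → ℝ) × (Fin (d + 2) → ℝ)) => (r.1.2 + r.2.1, r.1.1 - r.2.2))
    (by fun_prop)

lemma integrable_ker_mul (N : ℕ) {ψ : (Fin (d + 2) → ℝ) × (Fin (d + 2) → ℝ) → ℂ}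
    (hi : Integrable ψ (cvol d)) (x : Fin (d + 2) → ℝ) {y : Fin (d + 2) → ℝ} (hy : y ∈ cone (d + 2)) :
    Integrable (fun q => ker N (y + q.1) (x - q.2) * ψ q) (cvol d) := by
  obtain ⟨C, hC, h⟩ := norm_ker_add_le N hy
  refine hi.bdd_mul (c := C) ?_ (ae_mem_cvol.mono fun q hq => h _ hq _)
  exact ((measurable_ker_sub N).comp (f := fun q => ((x, y), q)) (by fun_prop)).aestronglyMeasurable

lemma measurable_kerOp (N : ℕ) {ψ : (Fin (d + 2) → ℝ) × (Fin (d + 2) → ℝ) → ℂ} (hψ : Measurable ψ) :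
    Measurable fun r : (Fin (d + 2) → ℝ) × (Fin (d + 2) → ℝ) => kerOp N ψ r.1 r.2 := by
  have h1 := (measurable_ker_sub (d := d) N).mul (hψ.comp measurable_snd)
  exact (h1.stronglyMeasurable.integral_prod_right (ν := cvol d)).measurable

lemma lintegral_sq_kerOp {N : ℕ} (hN : (d : ℝ) + 1 < N) :
    ∃ K : ℝ≥0∞, K ≠ ⊤ ∧ ∀ ψ : (Fin (d + 2) → ℝ) × (Fin (d + 2) → ℝ) → ℂ, Measurable ψ →
      Integrable ψ (cvol d) → ∀ y ∈ cone (d + 2),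
      ∫⁻ x, ‖kerOp N ψ x y‖ₑ ^ 2 ≤ K * ∫⁻ q, ‖ψ q‖ₑ ^ 2 *
        ENNReal.ofReal (cA (y + q.1) ^ ((d : ℝ) / 2 + 1 - 2 * N) *
          cT (y + q.1) ^ ((d : ℝ) / 2 + 1 - 2 * N)) ∂(cvol d) := by
  have hd0 : (0 : ℝ) ≤ d := Nat.cast_nonneg d
  obtain ⟨K1, hK1, hK1e⟩ := lintegral_ker (d := d) (N := N) (by linarith)
  obtain ⟨K2, hK2, hK2e⟩ := lintegral_ker (d := d) (N := N + N) (by push_cast; linarith)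
  obtain ⟨B, hB, hBe⟩ := lintegral_cone_beta (d := d) 0 0 (2 * N) (2 * N) (by linarith)
      (by linarith) (by linarith) (by linarith)
  have hP : ‖((2 * Real.pi : ℝ) : ℂ) ^ (d + 2)‖ₑ ≠ ⊤ := enorm_ne_top
  set P : ℂ := ((2 * Real.pi : ℝ) : ℂ) ^ (d + 2)
  have hKK : ‖P‖ₑ * (K2 * B) ≠ ⊤ := ENNReal.mul_ne_top hP (ENNReal.mul_ne_top hK2 hB)
  refine ⟨2 * (‖P‖ₑ * (K2 * B)), ENNReal.mul_ne_top (by simp) hKK, fun ψ hψ hi y hy => ?_⟩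
  obtain ⟨C, -, hCb⟩ := norm_ker_add_le N hy
  have hker : ∀ v ∈ cone (d + 2), ∀ u, ∫⁻ x, ‖ker N (y + v) (x - u)‖ₑ ≤
      K1 * ENNReal.ofReal (lor y ^ (-(N : ℝ))) := fun v hv u => by
    rw [lintegral_sub_right_eq_self (fun x => ‖ker N (y + v) x‖ₑ), hK1e _ (add_mem_cone hy hv)]
    exact mul_le_mul_right (ENNReal.ofReal_le_ofReal (Real.rpow_le_rpow_of_nonpos hy.1
      (lor_le_add hy hv) (neg_nonpos.2 (Nat.cast_nonneg N)))) _
  have hm : Measurable (Function.uncurry fun (q : (Fin (d + 2) → ℝ) × (Fin (d + 2) → ℝ))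
      (x : Fin (d + 2) → ℝ) => ker N (y + q.1) (x - q.2)) :=
    (measurable_ker_sub (d := d) N).comp (f := fun s : ((Fin (d + 2) → ℝ) × (Fin (d + 2) → ℝ)) ×
      (Fin (d + 2) → ℝ) => ((s.2, y), s.1)) (by fun_prop)
  have hfin : K1 * ENNReal.ofReal (lor y ^ (-(N : ℝ))) ≠ ⊤ := ENNReal.mul_ne_top hK1 ENNReal.ofReal_ne_top
  have key := lintegral_sq_superposition (μ := volume) hm hψ hi
    (ae_mem_cvol.mono fun q hq x => hCb _ hq _) hfin (ae_mem_cvol.mono fun q hq => hker _ hq _)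
  simp only [kerOp]
  refine key.trans ?_
  rw [mul_assoc 2]
  refine mul_le_mul_right ?_ _
  rw [← lintegral_const_mul' _ _ hKK]
  refine lintegral_mono_ae (ae_mem_cvol.mono fun q hq => ?_)
  have hyq := add_mem_cone hy hq
  rw [mul_left_comm]
  refine mul_le_mul_right ?_ _
  have e : ∀ᵐ q' ∂(cvol d), ‖∫ x, ker N (y + q.1) (x - q.2) *
      (starRingEnd ℂ) (ker N (y + q'.1) (x - q'.2))‖ₑ =
      ‖P‖ₑ * ‖ker (N + N) ((y + q.1) + (y + q'.1)) (q'.2 - q.2)‖ₑ := ae_mem_cvol.mono fun q' hq' => by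
    rw [integral_ker_mul_ker (by linarith) (add_mem_cone hy hq) (add_mem_cone hy hq'), enorm_mul]
  rw [lintegral_congr_ae e, lintegral_const_mul' _ _ hP, mul_assoc]
  refine mul_le_mul_right ?_ _
  rw [lintegral_cvol (f := fun q' => ‖ker (N + N) ((y + q.1) + (y + q'.1)) (q'.2 - q.2)‖ₑ)]
  swap
  · exact ((measurable_ker (d := d) (N + N)).comp (f := fun q' : (Fin (d + 2) → ℝ) ×
      (Fin (d + 2) → ℝ) => ((y + q.1) + (y + q'.1), q'.2 - q.2)) (by fun_prop)).enorm
  have := hBe _ hyq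
  simp only [Real.rpow_zero, one_mul, zero_add] at this
  rw [mul_assoc, ← this, ← lintegral_const_mul' _ _ hK2]
  refine setLIntegral_mono' isOpen_cone.measurableSet fun v hv => ?_
  have hyqv := add_mem_cone hyq hv
  simp only
  rw [lintegral_sub_right_eq_self (fun x => ‖ker (N + N) (y + q.1 + (y + v)) x‖ₑ),
    hK2e _ (add_mem_cone hyq (add_mem_cone hy hv)), ← lor_rpow_eq hyqv]
  refine mul_le_mul_right (ENNReal.ofReal_le_ofReal ?_) _
  push_cast
  rw [two_mul]
  refine Real.rpow_le_rpow_of_nonpos hyqv.1 ?_ (neg_nonpos.2 (by positivity))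
  rw [add_comm y v, ← add_assoc]
  exact lor_le_add hyqv hy

end square

section weights

variable {d : ℕ}

/-- The product of powers of the two light-cone coordinates. -/
def wt (s t : ℝ) (y : Fin (d + 2) → ℝ) : ℝ := cA y ^ s * cT y ^ t

lemma wt_pos {y : Fin (d + 2) → ℝ} (hy : y ∈ cone (d + 2)) (s t : ℝ) : 0 < wt s t y := by
  have := mem_cone_iff.1 hy
  exact mul_pos (Real.rpow_pos_of_pos this.1 _) (Real.rpow_pos_of_pos this.2 _)

lemma wt_mul_wt {y : Fin (d + 2) → ℝ} (hy : y ∈ cone (d + 2)) (s t s' t' : ℝ) :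
    wt s t y * wt s' t' y = wt (s + s') (t + t') y := by
  have := mem_cone_iff.1 hy
  simp only [wt]
  rw [Real.rpow_add this.1, Real.rpow_add this.2]; ring

lemma wt_rpow {y : Fin (d + 2) → ℝ} (hy : y ∈ cone (d + 2)) (s t r : ℝ) :
    wt s t y ^ r = wt (s * r) (t * r) y := by
  have := mem_cone_iff.1 hy
  simp only [wt]
  rw [Real.mul_rpow (Real.rpow_nonneg this.1.le _) (Real.rpow_nonneg this.2.le _),
    Real.rpow_mul this.1.le, Real.rpow_mul this.2.le]

lemma lor_rpow_eq_wt {y : Fin (d + 2) → ℝ} (hy : y ∈ cone (d + 2)) (a : ℝ) :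
    lor y ^ a = wt a a y := lor_rpow_eq hy a

@[fun_prop]
lemma measurable_wt (s t : ℝ) : Measurable (wt s t : (Fin (d + 2) → ℝ) → ℝ) :=
  (continuous_cA.measurable.pow_const s).mul (measurable_cT.pow_const t)

lemma lintegral_cone_wt (A B C D : ℝ) (hA : -1 < A + d / 2) (hC : A + d + 1 < C) (hB : -1 < B)
    (hD : B + d / 2 + 1 < D) :
    ∃ K : ℝ≥0∞, K ≠ ⊤ ∧ ∀ y ∈ cone (d + 2),
      ∫⁻ v in cone (d + 2), ENNReal.ofReal (wt A B v * wt (-C) (-D) (y + v)) =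
      K * ENNReal.ofReal (wt (A + d / 2 + 1 - C) (B + d / 2 + 1 - D) y) := by
  obtain ⟨K, hK, h⟩ := lintegral_cone_beta A B C D hA hC hB hD
  refine ⟨K, hK, fun y hy => ?_⟩
  simp only [wt, ← h y hy, mul_assoc]

/-- The threshold at which a density is cut into a small and a large part. -/
def thr (α γ η : ℝ) (y v : Fin (d + 2) → ℝ) : ℝ :=
  wt α α v * wt (-γ) (-η) (y + v) * wt γ η y

lemma thr_pos {α γ η : ℝ} {y v : Fin (d + 2) → ℝ} (hy : y ∈ cone (d + 2)) (hv : v ∈ cone (d + 2)) :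
    0 < thr α γ η y v :=
  mul_pos (mul_pos (wt_pos hv _ _) (wt_pos (add_mem_cone hy hv) _ _)) (wt_pos hy _ _)

lemma measurable_thr (α γ η : ℝ) : Measurable
    fun r : (Fin (d + 2) → ℝ) × (Fin (d + 2) → ℝ) => thr α γ η r.1 r.2 := by
  unfold thr
  have h := measurable_wt (d := d)
  exact (((h α α).comp measurable_snd).mul ((h (-γ) (-η)).comp (measurable_fst.add measurable_snd))).mul
    ((h γ η).comp measurable_fst)

lemma norm_kerOp_le_of_le_thr {N : ℕ} (hN : (d : ℝ) / 2 < N) {γ η : ℝ} (hγ : (d : ℝ) / 2 < γ) (hη : 0 < η) :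
    ∃ K : ℝ, 0 < K ∧ ∀ (ψ : (Fin (d + 2) → ℝ) × (Fin (d + 2) → ℝ) → ℂ) (r : ℝ), 0 ≤ r →
      ∀ x, ∀ y ∈ cone (d + 2),
      (∀ q : (Fin (d + 2) → ℝ) × (Fin (d + 2) → ℝ), q.1 ∈ cone (d + 2) →
        ‖ψ q‖ ≤ r * thr (N - d / 2 - 1) γ η y q.1) → ‖kerOp N ψ x y‖ ≤ K * r := by
  obtain ⟨K1, hK1, h1⟩ := lintegral_ker (d := d) hN
  obtain ⟨K2, hK2, h2⟩ := lintegral_cone_wt (d := d) (N - d / 2 - 1) (N - d / 2 - 1) (N + γ) (N + η)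
    (by linarith [(Nat.cast_nonneg d : (0 : ℝ) ≤ d)]) (by linarith) (by linarith) (by linarith)
  refine ⟨(K1 * K2).toReal + 1, by positivity, fun ψ r hr x y hy h => ?_⟩
  have hm : Measurable fun q : (Fin (d + 2) → ℝ) × (Fin (d + 2) → ℝ) => ‖ker N (y + q.1) (x - q.2)‖ₑ *
      ENNReal.ofReal (r * thr (N - d / 2 - 1) γ η y q.1) := by
    have h3 := ((measurable_ker_sub (d := d) N).comp (f := fun q => ((x, y), q)) (by fun_prop)).enorm
    exact h3.mul ((((measurable_thr _ _ _).comp (f := fun q : (Fin (d + 2) → ℝ) ×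
        (Fin (d + 2) → ℝ) => (y, q.1)) (by fun_prop)).const_mul r).ennreal_ofReal)
  have key : ‖kerOp N ψ x y‖ₑ ≤ ENNReal.ofReal r * (K1 * K2) := by
    calc ‖kerOp N ψ x y‖ₑ ≤ ∫⁻ q, ‖ker N (y + q.1) (x - q.2) * ψ q‖ₑ ∂(cvol d) :=
          enorm_integral_le_lintegral_enorm _
      _ ≤ ∫⁻ q, ‖ker N (y + q.1) (x - q.2)‖ₑ *
          ENNReal.ofReal (r * thr (N - d / 2 - 1) γ η y q.1) ∂(cvol d) := by
          refine lintegral_mono_ae (ae_mem_cvol.mono fun q hq => ?_)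
          rw [enorm_mul]
          refine mul_le_mul_right ?_ _
          rw [← ofReal_norm]
          exact ENNReal.ofReal_le_ofReal (h q hq)
      _ = ∫⁻ v in cone (d + 2), ENNReal.ofReal r * ENNReal.ofReal (wt γ η y) * K1 *
          ENNReal.ofReal (wt (N - d / 2 - 1) (N - d / 2 - 1) v * wt (-(N + γ)) (-(N + η)) (y + v)) := by
          rw [lintegral_cvol hm]
          refine setLIntegral_congr_fun isOpen_cone.measurableSet fun v hv => ?_
          have hyv := add_mem_cone hy hv
          simp only
          rw [lintegral_mul_const' _ _ ENNReal.ofReal_ne_top,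
            lintegral_sub_left_eq_self (fun u => ‖ker N (y + v) u‖ₑ), h1 _ hyv, lor_rpow_eq_wt hyv,
            ← ENNReal.ofReal_mul hr, mul_comm, ← mul_assoc, mul_right_comm _ K1,
            mul_comm (ENNReal.ofReal (r * thr _ _ _ _ _)), mul_right_comm _ K1,
            ← ENNReal.ofReal_mul (wt_pos hyv _ _).le,
            ← ENNReal.ofReal_mul (mul_nonneg hr (wt_pos hy _ _).le)]
          congr 2
          rw [thr, neg_add, neg_add, ← wt_mul_wt hyv]; ring
      _ = _ := by
          rw [lintegral_const_mul' _ _ (by finiteness), h2 y hy]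
          have e : wt γ η y * wt (N - d / 2 - 1 + d / 2 + 1 - (N + γ)) (N - d / 2 - 1 + d / 2 + 1 - (N + η)) y
              = 1 := by
            rw [wt_mul_wt hy]
            have e1 : γ + ((N : ℝ) - d / 2 - 1 + d / 2 + 1 - (N + γ)) = 0 := by ring
            have e2 : η + ((N : ℝ) - d / 2 - 1 + d / 2 + 1 - (N + η)) = 0 := by ring
            rw [e1, e2, wt, Real.rpow_zero, Real.rpow_zero, one_mul]
          rw [mul_assoc, mul_assoc, mul_left_comm (ENNReal.ofReal (wt γ η y)), mul_left_comm (ENNReal.ofReal (wt γ η y)),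
            ← ENNReal.ofReal_mul (wt_pos hy _ _).le, e]
          simp
  have := ENNReal.toReal_mono (by finiteness) key
  rw [ENNReal.toReal_mul, toReal_enorm, ENNReal.toReal_ofReal hr] at this
  nlinarith

end weights

section interpolation

variable {d : ℕ}

lemma lintegral_rpow_kerOp_le {N : ℕ} (hN : (d : ℝ) + 1 < N) {γ η : ℝ} (hγ : (d : ℝ) / 2 < γ) (hη : 0 < η)
    {p : ℝ} (hp : 2 ≤ p) :
    ∃ C : ℝ≥0∞, C ≠ ⊤ ∧ ∀ ψ : (Fin (d + 2) → ℝ) × (Fin (d + 2) → ℝ) → ℂ, Measurable ψ →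
      Integrable ψ (cvol d) → ∀ y ∈ cone (d + 2),
      ∫⁻ x, ENNReal.ofReal (‖kerOp N ψ x y‖ ^ p) ≤ C * ∫⁻ q, ENNReal.ofReal (‖ψ q‖ ^ (2 : ℝ) *
        wt ((d : ℝ) / 2 + 1 - 2 * N) ((d : ℝ) / 2 + 1 - 2 * N) (y + q.1) *
          |‖ψ q‖ / thr (N - d / 2 - 1) γ η y q.1| ^ (p - 2)) ∂(cvol d) := by
  have hd0 : (0 : ℝ) ≤ d := Nat.cast_nonneg d
  obtain ⟨K, hK, hsq⟩ := lintegral_sq_kerOp (d := d) hN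
  have hsq' : ∀ ψ : (Fin (d + 2) → ℝ) × (Fin (d + 2) → ℝ) → ℂ, Measurable ψ →
      Integrable ψ (cvol d) → ∀ y ∈ cone (d + 2),
      ∫⁻ x, ENNReal.ofReal (‖kerOp N ψ x y‖ ^ (2 : ℝ)) ≤ K * ∫⁻ q, ENNReal.ofReal (‖ψ q‖ ^ (2 : ℝ) *
        wt ((d : ℝ) / 2 + 1 - 2 * N) ((d : ℝ) / 2 + 1 - 2 * N) (y + q.1)) ∂(cvol d) := by
    intro ψ hψ hi y hy
    have e : ∀ z : ℂ, ENNReal.ofReal (‖z‖ ^ (2 : ℝ)) = ‖z‖ₑ ^ 2 := fun z => by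
      rw [Real.rpow_two, ENNReal.ofReal_pow (norm_nonneg _), ofReal_norm]
    simp only [ENNReal.ofReal_mul (Real.rpow_nonneg (norm_nonneg _) _), e]
    exact hsq ψ hψ hi y hy
  rcases hp.eq_or_lt with rfl | hp
  · refine ⟨K, hK, fun ψ hψ hi y hy => ?_⟩
    simpa using hsq' ψ hψ hi y hy
  obtain ⟨L, hL, hsm⟩ := norm_kerOp_le_of_le_thr (d := d) (N := N) (by linarith) hγ hη
  refine ⟨ENNReal.ofReal (p / (p - 2)) * (4 * K * ENNReal.ofReal ((2 * L) ^ (p - 2))),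
    by finiteness, fun ψ hψ hi y hy => ?_⟩
  have hthr : Measurable fun q : (Fin (d + 2) → ℝ) × (Fin (d + 2) → ℝ) =>
      thr (N - d / 2 - 1) γ η y q.1 :=
    (measurable_thr _ _ _).comp (f := fun q : (Fin (d + 2) → ℝ) × (Fin (d + 2) → ℝ) => (y, q.1))
      (by fun_prop)
  have hwt : Measurable fun q : (Fin (d + 2) → ℝ) × (Fin (d + 2) → ℝ) =>
      wt ((d : ℝ) / 2 + 1 - 2 * N) ((d : ℝ) / 2 + 1 - 2 * N) (y + q.1) :=
    (measurable_wt _ _).comp (f := fun q : (Fin (d + 2) → ℝ) × (Fin (d + 2) → ℝ) => y + q.1)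
      (by fun_prop)
  set T := fun q : (Fin (d + 2) → ℝ) × (Fin (d + 2) → ℝ) => thr (N - d / 2 - 1) γ η y q.1 with hT
  set V := fun q : (Fin (d + 2) → ℝ) × (Fin (d + 2) → ℝ) =>
      wt ((d : ℝ) / 2 + 1 - 2 * N) ((d : ℝ) / 2 + 1 - 2 * N) (y + q.1) with hV
  have hb : Measurable fun q => 2 * L * |‖ψ q‖ / T q| := by
    have : Measurable fun q => ‖ψ q‖ / T q := hψ.norm.div hthr
    exact (this.norm).const_mul _
  have hW : Measurable fun q => 4 * K * ENNReal.ofReal (‖ψ q‖ ^ (2 : ℝ) * V q) := by fun_prop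
  have hker : Measurable fun x => kerOp N ψ x y :=
    (measurable_kerOp N hψ).comp (f := fun x => (x, y)) (by fun_prop)
  refine (lintegral_rpow_le_of_meas_le (ρ := cvol d) hker.aemeasurable hb
    (fun q => by positivity) hW hp fun l hl => ?_).trans ?_
  · set S := {q | l < 2 * L * |‖ψ q‖ / T q|} with hS
    have hSm : MeasurableSet S := measurableSet_lt measurable_const hb
    have hsplit : ∀ x, kerOp N ψ x y = kerOp N (S.indicator ψ) x y + kerOp N (Sᶜ.indicator ψ) x y := by
      intro x
      rw [kerOp, kerOp, kerOp, ← integral_add (integrable_ker_mul N (hi.indicator hSm) x hy)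
        (integrable_ker_mul N (hi.indicator hSm.compl) x hy)]
      refine integral_congr_ae (.of_forall fun q => ?_)
      by_cases hq : q ∈ S <;> simp [hq]
    have hsmall : ∀ x, ‖kerOp N (Sᶜ.indicator ψ) x y‖ ≤ l / 2 := by
      intro x
      refine (hsm _ (l / (2 * L)) (by positivity) x y hy fun q hq => ?_).trans (le_of_eq (by field_simp))
      have ht := thr_pos (α := N - d / 2 - 1) (γ := γ) (η := η) hy hq
      by_cases hqS : q ∈ S
      · simp only [indicator, mem_compl_iff, hqS, not_true, if_false, norm_zero]; positivity
      · simp only [indicator, mem_compl_iff, hqS, not_false_iff, if_true]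
        have h1 : 2 * L * |‖ψ q‖ / T q| ≤ l := not_lt.1 hqS
        rw [abs_of_nonneg (div_nonneg (norm_nonneg _) ht.le), ← mul_div_assoc, div_le_iff₀ ht] at h1
        rw [div_mul_eq_mul_div, le_div_iff₀ (by positivity)]
        linarith
    have hlarge : ∀ x, l < ‖kerOp N ψ x y‖ →
        ENNReal.ofReal ((l / 2) ^ (2 : ℝ)) ≤ ENNReal.ofReal (‖kerOp N (S.indicator ψ) x y‖ ^ (2 : ℝ)) := by
      intro x hx
      refine ENNReal.ofReal_le_ofReal (Real.rpow_le_rpow (by positivity) ?_ (by norm_num))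
      have h1 := hsplit x ▸ norm_add_le (kerOp N (S.indicator ψ) x y) (kerOp N (Sᶜ.indicator ψ) x y)
      linarith [hsmall x]
    have hl0 : ENNReal.ofReal ((l / 2) ^ (2 : ℝ)) ≠ 0 := by
      simp only [ne_eq, ENNReal.ofReal_eq_zero, not_le]; positivity
    have hker' : Measurable fun x => kerOp N (S.indicator ψ) x y :=
      (measurable_kerOp N (hψ.indicator hSm)).comp (f := fun x => (x, y)) (by fun_prop)
    have h1 := (measure_mono (μ := volume) (fun x hx => hlarge x hx)).trans
      (meas_ge_le_lintegral_div (μ := volume) (ε := ENNReal.ofReal ((l / 2) ^ (2 : ℝ)))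
      (f := fun x => ENNReal.ofReal (‖kerOp N (S.indicator ψ) x y‖ ^ (2 : ℝ))) (by fun_prop) hl0
      ENNReal.ofReal_ne_top)
    refine h1.trans ?_
    rw [ENNReal.div_eq_inv_mul]
    have h2 := hsq' _ (hψ.indicator hSm) (hi.indicator hSm) y hy
    refine (mul_le_mul_right h2 _).trans (le_of_eq ?_)
    rw [← ENNReal.ofReal_inv_of_pos (by positivity)]
    have e1 : ((l / 2) ^ (2 : ℝ))⁻¹ = l ^ (-2 : ℝ) * 4 := by
      rw [Real.rpow_neg hl.le, Real.rpow_two, Real.rpow_two]; field_simp; norm_num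
    have e2 : ∀ q, S.indicator (fun q => 4 * K * ENNReal.ofReal (‖ψ q‖ ^ (2 : ℝ) * V q)) q =
        4 * K * ENNReal.ofReal (‖S.indicator ψ q‖ ^ (2 : ℝ) * V q) := fun q => by
      by_cases hq : q ∈ S <;> simp [hq]
    simp only [e2]
    rw [e1, ENNReal.ofReal_mul (by positivity), lintegral_const_mul' _ _ (by finiteness)]
    simp only [ENNReal.ofReal_ofNat]
    ring
  · rw [mul_assoc (ENNReal.ofReal _)]
    refine mul_le_mul_right (le_of_eq ?_) _
    rw [← lintegral_const_mul' _ _ (by finiteness)]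
    refine lintegral_congr fun q => ?_
    rw [mul_assoc (4 * K), mul_assoc (4 * K)]
    congr 1
    rw [Real.mul_rpow (by positivity) (abs_nonneg _),
      ENNReal.ofReal_mul (by positivity : 0 ≤ (2 * L) ^ (p - 2)),
      ENNReal.ofReal_mul' (by positivity : 0 ≤ |‖ψ q‖ / thr (N - d / 2 - 1) γ η y q.1| ^ (p - 2))]
    ring

end interpolation

section mixed

variable {d : ℕ}

lemma rpow_mul_wt_mul_thr {y v : Fin (d + 2) → ℝ} (hy : y ∈ cone (d + 2)) (hv : v ∈ cone (d + 2))
    {r p : ℝ} (hr : 0 ≤ r) (hp : 2 ≤ p) (α γ η e f : ℝ) :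
    r ^ (2 : ℝ) * wt f f (y + v) * |r / thr α γ η y v| ^ (p - 2) * lor y ^ e =
      r ^ p * wt (-(α * (p - 2))) (-(α * (p - 2))) v *
        (wt (e - γ * (p - 2)) (e - η * (p - 2)) y *
          wt (-(-f - γ * (p - 2))) (-(-f - η * (p - 2))) (v + y)) := by
  have hyv := add_mem_cone hy hv
  have ht := thr_pos (α := α) (γ := γ) (η := η) hy hv
  have e1 : r ^ p = r ^ (2 : ℝ) * r ^ (p - 2) := by
    rw [← Real.rpow_add_of_nonneg hr (by norm_num) (by linarith)]; congr 1; ring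
  have e2 : ∀ s t : ℝ, ∀ {w : Fin (d + 2) → ℝ}, w ∈ cone (d + 2) →
      (wt s t w ^ (p - 2))⁻¹ = wt (-(s * (p - 2))) (-(t * (p - 2))) w := fun s t w hw => by
    rw [← Real.rpow_neg (wt_pos hw _ _).le, wt_rpow hw]; congr 1 <;> ring
  rw [abs_of_nonneg (by positivity), Real.div_rpow hr ht.le, thr,
    Real.mul_rpow (mul_pos (wt_pos hv _ _) (wt_pos hyv _ _)).le (wt_pos hy _ _).le,
    Real.mul_rpow (wt_pos hv _ _).le (wt_pos hyv _ _).le, div_eq_mul_inv, mul_inv, mul_inv,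
    e2 _ _ hv, e2 _ _ hyv, e2 _ _ hy, lor_rpow_eq_wt hy, e1, add_comm v y]
  have e3 : wt (e - γ * (p - 2)) (e - η * (p - 2)) y =
      wt (-(γ * (p - 2))) (-(η * (p - 2))) y * wt e e y := by
    rw [wt_mul_wt hy]; congr 1 <;> ring
  have e4 : wt (-(-f - γ * (p - 2))) (-(-f - η * (p - 2))) (y + v) =
      wt (-(-γ * (p - 2))) (-(-η * (p - 2))) (y + v) * wt f f (y + v) := by
    rw [wt_mul_wt hyv]; congr 1 <;> ring
  rw [e3, e4]; ring

lemma lintegral_lintegral_kerOp_le {N : ℕ} (hN : (d : ℝ) + 1 < N) {p μ : ℝ} (hp : 2 ≤ p)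
    (hμ : (d : ℝ) / 2 < μ) (hμp : (d : ℝ) / 2 * (p - 2) < μ) (hNμ : μ + d + 1 < 2 * N) :
    ∃ C : ℝ≥0∞, C ≠ ⊤ ∧ ∀ ψ : (Fin (d + 2) → ℝ) × (Fin (d + 2) → ℝ) → ℂ, Measurable ψ →
      Integrable ψ (cvol d) →
      ∫⁻ y in cone (d + 2), (∫⁻ x, ENNReal.ofReal (‖kerOp N ψ x y‖ ^ p)) *
        ENNReal.ofReal (lor y ^ (μ - d / 2 - 1)) ≤
      C * ∫⁻ q, ENNReal.ofReal (‖ψ q‖ ^ p *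
        lor q.1 ^ (μ - d / 2 - 1 - (N - d / 2 - 1) * p)) ∂(cvol d) := by
  have hd0 : (0 : ℝ) ≤ d := Nat.cast_nonneg d
  obtain ⟨η, hη, h1, h2⟩ : ∃ η : ℝ, 0 < η ∧ ((d : ℝ) / 2 + η) * (p - 2) < μ ∧
      η * (p - 2) < μ - d / 2 := by
    have hm : 0 < min (μ - (d : ℝ) / 2 * (p - 2)) (μ - d / 2) := lt_min (by linarith) (by linarith)
    have hp1 : 0 < p - 1 := by linarith
    refine ⟨min (μ - (d : ℝ) / 2 * (p - 2)) (μ - d / 2) / (p - 1), by positivity, ?_⟩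
    have : min (μ - (d : ℝ) / 2 * (p - 2)) (μ - d / 2) / (p - 1) * (p - 2) <
        min (μ - (d : ℝ) / 2 * (p - 2)) (μ - d / 2) := by
      rw [div_mul_eq_mul_div, div_lt_iff₀ hp1]; nlinarith
    constructor
    · linarith [this.trans_le (min_le_left _ _)]
    · linarith [this.trans_le (min_le_right _ _)]
  set γ : ℝ := d / 2 + η with hγ
  obtain ⟨C, hC, hfix⟩ := lintegral_rpow_kerOp_le (d := d) hN (γ := γ) (by linarith) hη hp
  obtain ⟨K, hK, hbeta⟩ := lintegral_cone_wt (d := d) (μ - d / 2 - 1 - γ * (p - 2))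
    (μ - d / 2 - 1 - η * (p - 2)) (-((d : ℝ) / 2 + 1 - 2 * N) - γ * (p - 2))
    (-((d : ℝ) / 2 + 1 - 2 * N) - η * (p - 2)) (by linarith) (by linarith) (by linarith) (by linarith)
  refine ⟨C * K, by finiteness, fun ψ hψ hi => ?_⟩
  set Φ := fun (y : Fin (d + 2) → ℝ) (q : (Fin (d + 2) → ℝ) × (Fin (d + 2) → ℝ)) =>
    ‖ψ q‖ ^ (2 : ℝ) * wt ((d : ℝ) / 2 + 1 - 2 * N) ((d : ℝ) / 2 + 1 - 2 * N) (y + q.1) *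
          |‖ψ q‖ / thr (N - d / 2 - 1) γ η y q.1| ^ (p - 2) with hΦ
  have hΦm : Measurable (Function.uncurry fun y q =>
      ENNReal.ofReal (Φ y q) * ENNReal.ofReal (lor y ^ (μ - d / 2 - 1))) := by
    have m1 : Measurable fun r : (Fin (d + 2) → ℝ) × ((Fin (d + 2) → ℝ) × (Fin (d + 2) → ℝ)) =>
        thr (N - d / 2 - 1) γ η r.1 r.2.1 :=
      (measurable_thr _ _ _).comp (f := fun r : (Fin (d + 2) → ℝ) × ((Fin (d + 2) → ℝ) ×
        (Fin (d + 2) → ℝ)) => (r.1, r.2.1)) (by fun_prop)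
    have m2 : Measurable fun r : (Fin (d + 2) → ℝ) × ((Fin (d + 2) → ℝ) × (Fin (d + 2) → ℝ)) =>
        wt ((d : ℝ) / 2 + 1 - 2 * N) ((d : ℝ) / 2 + 1 - 2 * N) (r.1 + r.2.1) :=
      (measurable_wt _ _).comp (f := fun r : (Fin (d + 2) → ℝ) × ((Fin (d + 2) → ℝ) ×
        (Fin (d + 2) → ℝ)) => r.1 + r.2.1) (by fun_prop)
    have m3 : Measurable fun r : (Fin (d + 2) → ℝ) × ((Fin (d + 2) → ℝ) × (Fin (d + 2) → ℝ)) =>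
        ‖ψ r.2‖ := (hψ.comp measurable_snd).norm
    have m4 : Measurable fun r : (Fin (d + 2) → ℝ) × ((Fin (d + 2) → ℝ) × (Fin (d + 2) → ℝ)) =>
        lor r.1 := continuous_lor.measurable.comp measurable_fst
    have m5 := ((m3.div m1).norm).pow_const (p - 2)
    exact ((((m3.pow_const 2).mul m2).mul m5).ennreal_ofReal).mul
      (m4.pow_const (μ - d / 2 - 1)).ennreal_ofReal
  calc ∫⁻ y in cone (d + 2), (∫⁻ x, ENNReal.ofReal (‖kerOp N ψ x y‖ ^ p)) *
        ENNReal.ofReal (lor y ^ (μ - d / 2 - 1))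
      ≤ ∫⁻ y in cone (d + 2), C * ∫⁻ q, ENNReal.ofReal (Φ y q) *
        ENNReal.ofReal (lor y ^ (μ - d / 2 - 1)) ∂(cvol d) := by
        refine setLIntegral_mono' isOpen_cone.measurableSet fun y hy => ?_
        rw [lintegral_mul_const' _ _ ENNReal.ofReal_ne_top, ← mul_assoc]
        exact mul_le_mul_left (hfix ψ hψ hi y hy) _
    _ = C * ∫⁻ q, (∫⁻ y in cone (d + 2), ENNReal.ofReal (Φ y q) *
        ENNReal.ofReal (lor y ^ (μ - d / 2 - 1))) ∂(cvol d) := by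
        rw [lintegral_const_mul' _ _ hC, lintegral_lintegral_swap hΦm.aemeasurable]
    _ = _ := by
        rw [mul_assoc]
        congr 1
        rw [← lintegral_const_mul' _ _ hK]
        refine lintegral_congr_ae (ae_mem_cvol.mono fun q hq => ?_)
        have h0 : 0 ≤ ‖ψ q‖ ^ p * wt (-((N - d / 2 - 1) * (p - 2))) (-((N - d / 2 - 1) * (p - 2))) q.1 :=
          mul_nonneg (by positivity) (wt_pos hq _ _).le
        have e : ∀ y ∈ cone (d + 2), ENNReal.ofReal (Φ y q) * ENNReal.ofReal (lor y ^ (μ - d / 2 - 1)) =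
            ENNReal.ofReal (‖ψ q‖ ^ p * wt (-((N - d / 2 - 1) * (p - 2))) (-((N - d / 2 - 1) * (p - 2))) q.1) *
            ENNReal.ofReal (wt (μ - d / 2 - 1 - γ * (p - 2)) (μ - d / 2 - 1 - η * (p - 2)) y *
              wt (-(-((d : ℝ) / 2 + 1 - 2 * N) - γ * (p - 2)))
                (-(-((d : ℝ) / 2 + 1 - 2 * N) - η * (p - 2))) (q.1 + y)) := fun y hy => by
          rw [← ENNReal.ofReal_mul' (Real.rpow_nonneg hy.1.le _), ← ENNReal.ofReal_mul h0,
            rpow_mul_wt_mul_thr hy hq (norm_nonneg _) hp]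
        simp only
        rw [setLIntegral_congr_fun isOpen_cone.measurableSet e,
          lintegral_const_mul' _ _ ENNReal.ofReal_ne_top, hbeta _ hq, mul_left_comm,
          ← ENNReal.ofReal_mul h0, mul_assoc, wt_mul_wt hq, lor_rpow_eq_wt hq]
        congr 4 <;> ring

end mixed

section fatou

lemma lintegral_le_of_tendsto_of_le {X : Type*} [MeasurableSpace X] {μ : Measure X}
    {f : ℕ → X → ℝ≥0∞} {g : X → ℝ≥0∞} {B : ℝ≥0∞} (hf : ∀ n, AEMeasurable (f n) μ)
    (hlim : ∀ᵐ x ∂μ, Filter.Tendsto (fun n => f n x) Filter.atTop (nhds (g x)))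
    (hB : ∀ n, ∫⁻ x, f n x ∂μ ≤ B) : ∫⁻ x, g x ∂μ ≤ B := by
  rw [lintegral_congr_ae (hlim.mono fun x hx => hx.liminf_eq.symm)]
  exact (lintegral_liminf_le' hf).trans
    (Filter.liminf_le_of_frequently_le' (Filter.Frequently.of_forall hB))

end fatou

section hardy_laplace

variable {d : ℕ}

/-- The weighted integral of `‖F‖ ^ p` over the tube, with the imaginary part in the first variable. -/
def mixInt (d : ℕ) (p s : ℝ) (F : (Fin (d + 2) → ℂ) → ℂ) : ℝ≥0∞ :=
  ∫⁻ q, ENNReal.ofReal (‖F (cpt q.2 q.1)‖ ^ p * lor q.1 ^ s) ∂(cvol d)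

lemma tendsto_kerOp_truncate {N : ℕ} {ψ : (Fin (d + 2) → ℝ) × (Fin (d + 2) → ℝ) → ℂ}
    (hψ : Measurable ψ) {x y : Fin (d + 2) → ℝ}
    (hi : Integrable (fun q => ker N (y + q.1) (x - q.2) * ψ q) (cvol d)) :
    Filter.Tendsto (fun R : ℕ => kerOp N ({q | ‖ψ q‖ ≤ R ∧ ‖q‖ ≤ R}.indicator ψ) x y) Filter.atTop
      (nhds (kerOp N ψ x y)) := by
  have hk : Measurable fun q : (Fin (d + 2) → ℝ) × (Fin (d + 2) → ℝ) => ker N (y + q.1) (x - q.2) :=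
    (measurable_ker_sub N).comp (f := fun q => ((x, y), q)) (by fun_prop)
  have hS : ∀ R : ℕ, MeasurableSet {q | ‖ψ q‖ ≤ R ∧ ‖q‖ ≤ R} := fun R =>
    (measurableSet_le hψ.norm measurable_const).inter (measurableSet_le measurable_norm measurable_const)
  refine tendsto_integral_of_dominated_convergence _ (fun R =>
    (hk.mul (hψ.indicator (hS R))).aestronglyMeasurable) hi.norm (fun R => .of_forall fun q => ?_)
    (.of_forall fun q => ?_)
  · rw [norm_mul, norm_mul]
    exact mul_le_mul_of_nonneg_left (norm_indicator_le_norm_self _ _) (norm_nonneg _)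
  · refine tendsto_const_nhds.congr' ?_
    filter_upwards [Filter.eventually_ge_atTop ⌈max ‖ψ q‖ ‖q‖⌉₊] with R hR
    have := (Nat.le_ceil _).trans (Nat.cast_le (α := ℝ).2 hR)
    rw [indicator_of_mem]
    exact ⟨(le_max_left _ _).trans this, (le_max_right _ _).trans this⟩

lemma integrable_truncate {ψ : (Fin (d + 2) → ℝ) × (Fin (d + 2) → ℝ) → ℂ} (hψ : Measurable ψ) (R : ℕ) :
    Integrable ({q | ‖ψ q‖ ≤ R ∧ ‖q‖ ≤ R}.indicator ψ) (cvol d) := by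
  have hS : MeasurableSet {q | ‖ψ q‖ ≤ R ∧ ‖q‖ ≤ R} :=
    (measurableSet_le hψ.norm measurable_const).inter (measurableSet_le measurable_norm measurable_const)
  rw [integrable_indicator_iff hS]
  have hle : cvol d ≤ volume.prod volume := Measure.prod_mono Measure.restrict_le_self le_rfl
  refine Measure.integrableOn_of_bounded (M := R) (ne_of_lt ?_) hψ.aestronglyMeasurable
    (ae_restrict_of_forall_mem hS fun q hq => hq.1)
  refine (measure_mono (t := Metric.closedBall 0 R) fun q hq => by simpa using hq.2).trans_lt ?_
  refine (hle _).trans_lt ?_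
  exact (isCompact_closedBall _ _).measure_lt_top

lemma mixInt_lapT_le {p μ : ℝ} (hp : 2 ≤ p) (hμ : (d : ℝ) / 2 < μ) (hμp : (d : ℝ) / 2 * (p - 2) < μ)
    (m : ℕ) : ∃ C : ℝ≥0∞, C ≠ ⊤ ∧ ∀ g : (Fin (d + 2) → ℝ) → ℂ, Measurable g → (∃ M, ∀ ξ, ‖g ξ‖ ≤ M) →
      mixInt d p (μ - d / 2 - 1) (lapT g) ≤
        C * mixInt d p (μ + m * p - d / 2 - 1) (lapT fun ξ => g ξ * (lor ξ : ℂ) ^ m) := by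
  obtain ⟨N, hN⟩ := exists_nat_gt (max ((d : ℝ) + 1) (μ + d + 1))
  have hN1 := (le_max_left _ _).trans_lt hN
  have hN2 := (le_max_right _ _).trans_lt hN
  have hd0 : (0 : ℝ) ≤ d := Nat.cast_nonneg d
  set a : ℝ := m + (N - d / 2 - 1) with ha
  obtain ⟨c, hc⟩ := lapT_eq_recOp (d := d) (N := N) (m := m) (a := a) hN1 (by rw [ha]; push_cast; ring)
  obtain ⟨C, hC, hop⟩ := lintegral_lintegral_kerOp_le hN1 hp hμ hμp (by linarith)
  refine ⟨ENNReal.ofReal (‖c‖ ^ p) * C, by finiteness, fun g hg hM => ?_⟩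
  have hcg := hc g hg hM
  have hφ : Measurable fun q : (Fin (d + 2) → ℝ) × (Fin (d + 2) → ℝ) =>
      lapT (fun ξ => g ξ * (lor ξ : ℂ) ^ m) (cpt q.2 q.1) := by
    have h1 : Measurable (fun ξ : Fin (d + 2) → ℝ => g ξ * (lor ξ : ℂ) ^ m) :=
      hg.mul ((measurable_ofReal.comp continuous_lor.measurable).pow_const m)
    exact (measurable_lapT h1).comp (continuous_cpt.comp continuous_swap).measurable
  set φ := fun q : (Fin (d + 2) → ℝ) × (Fin (d + 2) → ℝ) =>
      lapT (fun ξ => g ξ * (lor ξ : ℂ) ^ m) (cpt q.2 q.1) with hφd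
  set ψ := fun q : (Fin (d + 2) → ℝ) × (Fin (d + 2) → ℝ) => ((lor q.1 ^ a : ℝ) : ℂ) * φ q with hψd
  have hlor : Measurable fun q : (Fin (d + 2) → ℝ) × (Fin (d + 2) → ℝ) => lor q.1 :=
    continuous_lor.measurable.comp measurable_fst
  have hψ : Measurable ψ := (measurable_ofReal.comp (hlor.pow_const a)).mul hφ
  have hrec : ∀ x y, recOp N a φ x y = kerOp N ψ x y := fun x y => by
    simp only [recOp, kerOp, hψd]; congr with q; ring
  have hS : ∀ R : ℕ, MeasurableSet {q | ‖ψ q‖ ≤ R ∧ ‖q‖ ≤ R} := fun R =>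
    (measurableSet_le hψ.norm measurable_const).inter (measurableSet_le measurable_norm measurable_const)
  have hms : ∀ {χ : (Fin (d + 2) → ℝ) × (Fin (d + 2) → ℝ) → ℂ}, Measurable χ → Measurable
      fun q : (Fin (d + 2) → ℝ) × (Fin (d + 2) → ℝ) => ENNReal.ofReal (‖kerOp N χ q.2 q.1‖ ^ p) *
        ENNReal.ofReal (lor q.1 ^ (μ - d / 2 - 1)) := fun {χ} hχ =>
    ((((measurable_kerOp N hχ).comp measurable_swap).norm.pow_const p).ennreal_ofReal).mul
      (hlor.pow_const _).ennreal_ofReal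
  have key : ∫⁻ q, ENNReal.ofReal (‖kerOp N ψ q.2 q.1‖ ^ p) *
      ENNReal.ofReal (lor q.1 ^ (μ - d / 2 - 1)) ∂(cvol d) ≤
      C * ∫⁻ q, ENNReal.ofReal (‖ψ q‖ ^ p *
        lor q.1 ^ (μ - d / 2 - 1 - (N - d / 2 - 1) * p)) ∂(cvol d) := by
    refine lintegral_le_of_tendsto_of_le (fun R => (hms (hψ.indicator (hS R))).aemeasurable)
      (ae_mem_cvol.mono fun q hq => ?_) fun R => ?_
    · refine ENNReal.Tendsto.mul_const (ENNReal.tendsto_ofReal ?_) (.inr ENNReal.ofReal_ne_top)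
      refine Filter.Tendsto.rpow_const (tendsto_kerOp_truncate hψ ?_).norm (.inr (by linarith))
      refine (hcg q.2 q.1 hq).1.congr (.of_forall fun r => ?_)
      simp only [hψd, hφd]; ring
    · rw [lintegral_cvol (hms (hψ.indicator (hS R)))]
      simp only [lintegral_mul_const' _ _ ENNReal.ofReal_ne_top]
      refine (hop _ (hψ.indicator (hS R)) (integrable_truncate hψ R)).trans (mul_le_mul_right ?_ _)
      refine lintegral_mono_ae (ae_mem_cvol.mono fun q hq => ENNReal.ofReal_le_ofReal ?_)
      have := hq.1
      refine mul_le_mul_of_nonneg_right ?_ (by positivity)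
      exact Real.rpow_le_rpow (norm_nonneg _) (norm_indicator_le_norm_self _ _) (by linarith)
  have e1 : mixInt d p (μ - d / 2 - 1) (lapT g) = ENNReal.ofReal (‖c‖ ^ p) *
      ∫⁻ q, ENNReal.ofReal (‖kerOp N ψ q.2 q.1‖ ^ p) *
      ENNReal.ofReal (lor q.1 ^ (μ - d / 2 - 1)) ∂(cvol d) := by
    rw [mixInt, ← lintegral_const_mul' _ _ ENNReal.ofReal_ne_top]
    refine lintegral_congr_ae (ae_mem_cvol.mono fun q hq => ?_)
    simp only
    rw [(hcg q.2 q.1 hq).2, hrec, norm_mul, Real.mul_rpow (norm_nonneg _) (norm_nonneg _), mul_assoc,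
      ENNReal.ofReal_mul (by positivity), ENNReal.ofReal_mul (by positivity)]
  have e2 : ∫⁻ q, ENNReal.ofReal (‖ψ q‖ ^ p *
        lor q.1 ^ (μ - d / 2 - 1 - (N - d / 2 - 1) * p)) ∂(cvol d) =
      mixInt d p (μ + m * p - d / 2 - 1) (lapT fun ξ => g ξ * (lor ξ : ℂ) ^ m) := by
    refine lintegral_congr_ae (ae_mem_cvol.mono fun q hq => ?_)
    simp only [hψd, norm_mul, norm_real, Real.norm_eq_abs]
    have h0 := hq.1
    rw [abs_of_nonneg (by positivity), Real.mul_rpow (by positivity) (norm_nonneg _),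
      ← Real.rpow_mul h0.le, mul_right_comm, ← Real.rpow_add h0, mul_comm]
    congr 3
    rw [ha]; ring
  rw [e1, mul_assoc, ← e2]
  exact mul_le_mul_right key _

end hardy_laplace

section holomorphy

open Metric

variable {n : ℕ}

lemma fderiv_apply_eq_circleIntegral {F : (Fin n → ℂ) → ℂ} {U : Set (Fin n → ℂ)} (hU : IsOpen U)
    (hF : DifferentiableOn ℂ F U) {z v : Fin n → ℂ} {r : ℝ} (hr : 0 < r)
    (h : ∀ ζ ∈ closedBall (0 : ℂ) r, z + ζ • v ∈ U) :
    fderiv ℂ F z v = (2 * Real.pi * I)⁻¹ * ∮ ζ in C(0, r), (ζ ^ 2)⁻¹ * F (z + ζ • v) := by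
  have hd : ∀ ζ ∈ closedBall (0 : ℂ) r, HasDerivAt (fun ζ : ℂ => F (z + ζ • v)) (fderiv ℂ F (z + ζ • v) v) ζ := by
    intro ζ hζ
    have h1 := (hF.differentiableAt (hU.mem_nhds (h ζ hζ))).hasFDerivAt
    have h2 : HasDerivAt (fun ζ : ℂ => z + ζ • v) v ζ := by
      simpa using ((hasDerivAt_id ζ).smul_const v).const_add z
    exact h1.comp_hasDerivAt ζ h2
  have h0 := (hd 0 (mem_closedBall_self hr.le)).deriv
  have hc : DifferentiableOn ℂ (fun ζ : ℂ => F (z + ζ • v)) (closedBall 0 r) :=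
    fun ζ hζ => (hd ζ hζ).differentiableAt.differentiableWithinAt
  have key := hc.deriv_eq_smul_circleIntegral hr
  simp only [zero_smul, add_zero, sub_zero, one_div, smul_eq_mul] at h0 key
  rw [key, h0, ← mul_assoc, inv_mul_cancel₀ (by simp [Real.pi_ne_zero]), one_mul]

lemma differentiableOn_fderiv_apply {F : (Fin n → ℂ) → ℂ} {U : Set (Fin n → ℂ)} (hU : IsOpen U)
    (hF : DifferentiableOn ℂ F U) (v : Fin n → ℂ) :
    DifferentiableOn ℂ (fun z => fderiv ℂ F z v) U := by
  intro z₀ hz₀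
  obtain ⟨ε, hε, hball⟩ := nhds_basis_closedBall.mem_iff.1 (hU.mem_nhds hz₀)
  set R : ℝ := ε / 3 with hR
  have hRpos : 0 < R := by positivity
  set r : ℝ := R / (‖v‖ + 1) with hr
  have hrpos : 0 < r := by positivity
  have hrv : r * ‖v‖ ≤ R := by
    rw [hr, div_mul_eq_mul_div, div_le_iff₀ (by positivity)]; nlinarith [norm_nonneg v]
  have hnear : ∀ ζ : ℂ, ‖ζ‖ ≤ r → ∀ z ∈ ball z₀ R, dist (z + ζ • v) z₀ < 2 * R := by
    intro ζ hζ z hz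
    have h1 : ‖ζ • v‖ ≤ R := by
      rw [norm_smul]; exact (mul_le_mul_of_nonneg_right hζ (norm_nonneg _)).trans hrv
    rw [mem_ball] at hz
    calc dist (z + ζ • v) z₀ ≤ dist (z + ζ • v) z + dist z z₀ := dist_triangle _ _ _
      _ < R + R := by
        have : dist (z + ζ • v) z ≤ R := by rw [dist_eq_norm]; simpa using h1
        linarith
      _ = 2 * R := by ring
  have hinU : ∀ ζ : ℂ, ‖ζ‖ ≤ r → ∀ z ∈ ball z₀ R, z + ζ • v ∈ U := fun ζ hζ z hz =>
    hball (mem_closedBall.2 (by have := hnear ζ hζ z hz; rw [hR] at this; linarith))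
  obtain ⟨M, hM⟩ := (isCompact_closedBall z₀ ε).exists_bound_of_continuousOn (hF.continuousOn.mono hball)
  have hfd : ∀ ζ : ℂ, ‖ζ‖ ≤ r → ∀ z ∈ ball z₀ R, ‖fderiv ℂ F (z + ζ • v)‖ ≤ 2 * M / R := by
    intro ζ hζ z hz
    have h1 := hnear ζ hζ z hz
    have hsub : ball (z + ζ • v) R ⊆ closedBall z₀ ε := fun w hw => by
      rw [mem_ball] at hw
      have := dist_triangle w (z + ζ • v) z₀
      rw [mem_closedBall]; rw [hR] at *; linarith
    refine Complex.norm_fderiv_le_div_of_mapsTo_ball (hF.mono (hsub.trans hball)) (fun w hw => ?_) hRpos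
    rw [mem_closedBall, dist_eq_norm]
    have h2 := hM _ (hsub hw)
    have h3 := hM _ (hsub (mem_ball_self hRpos))
    exact (norm_sub_le _ _).trans (by linarith)
  have hcm : ∀ θ : ℝ, ‖circleMap 0 r θ‖ ≤ r := fun θ => by simp [abs_of_pos hrpos]
  have hcm' : ∀ θ : ℝ, ‖circleMap 0 r θ‖ = r := fun θ => by simp [abs_of_pos hrpos]
  set k : ℝ → ℂ := fun θ => deriv (circleMap 0 r) θ * ((circleMap 0 r θ) ^ 2)⁻¹ with hk
  have hkc : Continuous k := by
    have : Continuous fun θ : ℝ => circleMap 0 r θ := continuous_circleMap 0 r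
    simp only [hk, deriv_circleMap]
    exact (this.mul continuous_const).mul ((this.pow 2).inv₀ fun θ => by
      rw [← norm_ne_zero_iff, Pi.pow_apply, norm_pow, hcm']; positivity)
  have hkn : ∀ θ, ‖k θ‖ = r⁻¹ := by
    intro θ
    simp only [hk, deriv_circleMap, norm_mul, norm_inv, norm_pow, hcm', norm_I]
    field_simp
  have hcont : ∀ z ∈ ball z₀ R, Continuous fun θ : ℝ => F (z + circleMap 0 r θ • v) := by
    intro z hz
    refine hF.continuousOn.comp_continuous ?_ fun θ => hinU _ (hcm θ) z hz
    have : Continuous fun θ : ℝ => circleMap 0 r θ := continuous_circleMap 0 r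
    fun_prop
  have hrep : ∀ z ∈ ball z₀ R, fderiv ℂ F z v =
      (2 * Real.pi * I)⁻¹ * ∫ θ in (0 : ℝ)..2 * Real.pi, k θ * F (z + circleMap 0 r θ • v) := by
    intro z hz
    rw [fderiv_apply_eq_circleIntegral hU hF hrpos fun ζ hζ => hinU ζ (by simpa using hζ) z hz,
      circleIntegral]
    simp only [hk, smul_eq_mul, mul_assoc]
  have hmain : HasFDerivAt (fun z => ∫ θ in (0 : ℝ)..2 * Real.pi, k θ * F (z + circleMap 0 r θ • v))
      (∫ θ in (0 : ℝ)..2 * Real.pi, k θ • fderiv ℂ F (z₀ + circleMap 0 r θ • v)) z₀ := by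
    refine intervalIntegral.hasFDerivAt_integral_of_dominated_of_fderiv_le
      (F' := fun z θ => k θ • fderiv ℂ F (z + circleMap 0 r θ • v))
      (bound := fun _ => r⁻¹ * (2 * M / R)) (ball_mem_nhds z₀ hRpos) ?_ ?_ ?_ ?_ ?_ ?_
    · filter_upwards [ball_mem_nhds z₀ hRpos] with z hz
      exact (hkc.mul (hcont z hz)).aestronglyMeasurable
    · exact (hkc.mul (hcont z₀ (mem_ball_self hRpos))).intervalIntegrable _ _
    · have h1 : Measurable fun θ : ℝ => fderiv ℂ F (z₀ + circleMap 0 r θ • v) := by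
        refine (measurable_fderiv ℂ F).comp ?_
        have : Continuous fun θ : ℝ => circleMap 0 r θ := continuous_circleMap 0 r
        exact Continuous.measurable (by fun_prop)
      exact (hkc.measurable.smul h1).aestronglyMeasurable
    · refine Filter.Eventually.of_forall fun θ _ z hz => ?_
      rw [norm_smul, hkn]
      exact mul_le_mul_of_nonneg_left (hfd _ (hcm θ) z hz) (by positivity)
    · exact intervalIntegrable_const
    · refine Filter.Eventually.of_forall fun θ _ z hz => ?_
      have h1 := (hF.differentiableAt (hU.mem_nhds (hinU _ (hcm θ) z hz))).hasFDerivAt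
      have h2 := h1.comp z ((hasFDerivAt_id z).add_const (circleMap 0 r θ • v))
      rw [ContinuousLinearMap.comp_id] at h2
      exact h2.const_smul (k θ)
  have h4 : DifferentiableAt ℂ (fun z => fderiv ℂ F z v) z₀ := by
    refine ((hmain.differentiableAt).const_mul (2 * Real.pi * I)⁻¹).congr_of_eventuallyEq ?_
    filter_upwards [ball_mem_nhds z₀ hRpos] with z hz using hrep z hz
  exact h4.differentiableWithinAt

lemma differentiableOn_pd {F : (Fin n → ℂ) → ℂ} {U : Set (Fin n → ℂ)} (hU : IsOpen U)
    (hF : DifferentiableOn ℂ F U) (j : Fin n) : DifferentiableOn ℂ (pd j F) U :=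
  differentiableOn_fderiv_apply hU hF _

lemma differentiableOn_BoxOp [NeZero n] {F : (Fin n → ℂ) → ℂ} {U : Set (Fin n → ℂ)} (hU : IsOpen U)
    (hF : DifferentiableOn ℂ F U) : DifferentiableOn ℂ (BoxOp F) U := by
  have h := fun j : Fin n => differentiableOn_pd hU (differentiableOn_pd hU hF j) j
  exact (((h 0).const_mul 2).sub (DifferentiableOn.fun_sum fun j _ => h j)).neg

lemma differentiableOn_BoxOp_iterate [NeZero n] {F : (Fin n → ℂ) → ℂ} {U : Set (Fin n → ℂ)}
    (hU : IsOpen U) (hF : DifferentiableOn ℂ F U) (m : ℕ) : DifferentiableOn ℂ (BoxOp^[m] F) U := by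
  induction m with
  | zero => exact hF
  | succ m ih => rw [Function.iterate_succ_apply']; exact differentiableOn_BoxOp hU ih

end holomorphy

section transfer

/-- The pair (imaginary part, real part) as a measurable equivalence. -/
def cptEquiv (n : ℕ) : (Fin n → ℝ) × (Fin n → ℝ) ≃ᵐ (Fin n → ℂ) where
  toFun q := cpt q.2 q.1
  invFun z := (imP z, fun i => (z i).re)
  left_inv q := by ext i <;> simp [cpt, imP]
  right_inv z := by ext i; simp [cpt, imP]
  measurable_toFun := by
    refine measurable_pi_lambda _ fun i => ?_
    change Measurable fun q : (Fin n → ℝ) × (Fin n → ℝ) => (q.2 i : ℂ) + (q.1 i : ℂ) * I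
    fun_prop
  measurable_invFun := by
    change Measurable fun z : Fin n → ℂ => ((fun i => (z i).im : Fin n → ℝ), fun i => (z i).re)
    fun_prop

lemma measurePreserving_cptEquiv (n : ℕ) : MeasurePreserving (cptEquiv n) := by
  have h1 := volume_preserving_pi (ι := Fin n) (α' := fun _ => ℝ × ℝ) (β' := fun _ => ℂ)
    (fun _ => (Complex.volume_preserving_equiv_real_prod.symm _))
  have h2 := (volume_measurePreserving_arrowProdEquivProdArrow ℝ ℝ (Fin n)).symm
  have h3 : MeasurePreserving (Prod.swap : (Fin n → ℝ) × (Fin n → ℝ) → _) := Measure.measurePreserving_swap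
  have h := h1.comp (h2.comp h3)
  have e : (cptEquiv n : (Fin n → ℝ) × (Fin n → ℝ) → _) =
      (fun a i => (Complex.measurableEquivRealProd.symm) (a i)) ∘
      (MeasurableEquiv.arrowProdEquivProdArrow ℝ ℝ (Fin n)).symm ∘ Prod.swap := by
    funext q i
    change (q.2 i : ℂ) + (q.1 i : ℂ) * I = (⟨q.2 i, q.1 i⟩ : ℂ)
    exact (Complex.mk_eq_add_mul_I _ _).symm
  rw [e]
  exact h

variable {d : ℕ}

lemma lintegral_tube (h : (Fin (d + 2) → ℂ) → ℝ≥0∞) :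
    ∫⁻ z in tube (d + 2), h z = ∫⁻ q, h (cpt q.2 q.1) ∂(cvol d) := by
  rw [← (measurePreserving_cptEquiv _).setLIntegral_comp_preimage_emb (cptEquiv _).measurableEmbedding]
  have : cptEquiv (d + 2) ⁻¹' tube (d + 2) = cone (d + 2) ×ˢ univ := by
    ext q
    simp only [mem_preimage, mem_prod, mem_univ, and_true]
    exact cpt_mem_tube
  have hc : cvol d = (volume : Measure ((Fin (d + 2) → ℝ) × (Fin (d + 2) → ℝ))).restrict
      (cone (d + 2) ×ˢ univ) := by
    rw [Measure.volume_eq_prod, ← Measure.prod_restrict, Measure.restrict_univ, cvol]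
  rw [this, hc]
  rfl

lemma measurable_lor_imP_rpow (s : ℝ) : Measurable fun z : Fin (d + 2) → ℂ => ENNReal.ofReal (lor (imP z) ^ s) := by
  have := (continuous_lor (n := d + 2)).measurable.comp (continuous_imP (n := d + 2)).measurable
  simp only [Function.comp_def] at this
  fun_prop

lemma lpInt_eq_mixInt (p μ : ℝ) (F : (Fin (d + 2) → ℂ) → ℂ) :
    lpInt (d + 2) p μ F = mixInt d p (μ - d / 2 - 1) F := by
  rw [lpInt, dV, lintegral_withDensity_eq_lintegral_mul_non_measurable _ (measurable_lor_imP_rpow _)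
    (Filter.Eventually.of_forall fun z => ENNReal.ofReal_lt_top), lintegral_tube, mixInt]
  refine lintegral_congr_ae (ae_mem_cvol.mono fun q hq => ?_)
  simp only [Pi.mul_apply, imP_cpt]
  rw [← ENNReal.ofReal_mul (Real.rpow_nonneg hq.1.le _), mul_comm]
  congr 3
  push_cast; ring

end transfer

section shear

variable {d : ℕ}

lemma le_ofReal_mul_of_ofReal_mul_eq {x y : ℝ≥0∞} {r c : ℝ} (hr : 0 < r) (hc : 1 ≤ c * r)
    (h : y = ENNReal.ofReal r * x) : x ≤ ENNReal.ofReal c * y := by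
  have hc0 : 0 ≤ c := by by_contra hh; push Not at hh; nlinarith
  rw [h, ← mul_assoc, ← ENNReal.ofReal_mul hc0]
  exact le_mul_of_one_le_left (by simp) (by simpa using hc)

lemma lintegral_cone_shear {f : (Fin (d + 2) → ℝ) → ℝ≥0∞} (hf : Measurable f) {α τ β : ℝ}
    (hα : 1 / 2 ≤ α) (hτ : 1 / 2 ≤ τ) (hβ : 1 / 2 ≤ β) {b : ℝ × ℝ → Fin d → ℝ} (hb : Measurable b) :
    ∫⁻ v in cone (d + 2), f (mkY (α * cA v) (τ * cT v) (β • cW v + b (cA v, cT v))) ≤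
      ENNReal.ofReal (2 ^ (d + 2)) * ∫⁻ v in cone (d + 2), f v := by
  have hfm : Measurable fun q : ℝ × ℝ × (Fin d → ℝ) => f (mkY q.1 q.2.1 q.2.2) := hf.comp measurable_mkY
  have hm : Measurable fun v : Fin (d + 2) → ℝ =>
      f (mkY (α * cA v) (τ * cT v) (β • cW v + b (cA v, cT v))) := by
    have h1 := (continuous_cA (d := d)).measurable
    have h2 := measurable_cT (d := d)
    have h3 := (continuous_cW (d := d)).measurable
    exact hfm.comp (f := fun v : Fin (d + 2) → ℝ =>
      (α * cA v, τ * cT v, β • cW v + b (cA v, cT v))) (by fun_prop)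
  rw [lintegral_cone _ hm, lintegral_cone _ hf]
  simp only [cA_mkY, cT_mkY, cW_mkY]
  have hw : ∀ a t, ∫⁻ w, f (mkY (α * a) (τ * t) (β • w + b (a, t))) ≤
      ENNReal.ofReal (2 ^ d) * ∫⁻ w, f (mkY (α * a) (τ * t) w) := by
    intro a t
    have h1 : Measurable fun w => f (mkY (α * a) (τ * t) w) :=
      hfm.comp (f := fun w : Fin d → ℝ => (α * a, τ * t, w)) (by fun_prop)
    have h2 := lintegral_comp_smul_pos (fun w => f (mkY (α * a) (τ * t) (w + b (a, t))))
      (h1.comp (f := fun w => w + b (a, t)) (by fun_prop)) (show 0 < β by linarith)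
    rw [lintegral_add_right_eq_self (fun w => f (mkY (α * a) (τ * t) w))] at h2
    refine le_ofReal_mul_of_ofReal_mul_eq (by positivity) ?_ h2
    rw [← mul_pow]
    exact one_le_pow₀ (by linarith)
  have hI : Measurable fun q : ℝ × ℝ => ∫⁻ w, f (mkY q.1 q.2 w) :=
    Measurable.lintegral_prod_right' (f := fun q : (ℝ × ℝ) × (Fin d → ℝ) => f (mkY q.1.1 q.1.2 q.2))
      (hfm.comp (f := fun q : (ℝ × ℝ) × (Fin d → ℝ) => (q.1.1, q.1.2, q.2)) (by fun_prop))
  have ht : ∀ a, ∫⁻ t in Ioi (0 : ℝ), ∫⁻ w, f (mkY (α * a) (τ * t) w) ≤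
      ENNReal.ofReal 2 * ∫⁻ t in Ioi (0 : ℝ), ∫⁻ w, f (mkY (α * a) t w) := by
    intro a
    exact le_ofReal_mul_of_ofReal_mul_eq (by linarith) (by linarith)
      (lintegral_Ioi_comp_mul (fun t => ∫⁻ w, f (mkY (α * a) t w))
        (hI.comp (f := fun t => (α * a, t)) (by fun_prop)) (show 0 < τ by linarith))
  have hJ : Measurable fun a => ∫⁻ t in Ioi (0 : ℝ), ∫⁻ w, f (mkY a t w) :=
    Measurable.lintegral_prod_right' (f := fun q : ℝ × ℝ => ∫⁻ w, f (mkY q.1 q.2 w)) hI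
  have ha : ∫⁻ a in Ioi (0 : ℝ), ∫⁻ t in Ioi (0 : ℝ), ∫⁻ w, f (mkY (α * a) t w) ≤
      ENNReal.ofReal 2 * ∫⁻ a in Ioi (0 : ℝ), ∫⁻ t in Ioi (0 : ℝ), ∫⁻ w, f (mkY a t w) :=
    le_ofReal_mul_of_ofReal_mul_eq (by linarith) (by linarith)
      (lintegral_Ioi_comp_mul _ hJ (show 0 < α by linarith))
  calc (1 / 2) * ∫⁻ a in Ioi (0 : ℝ), ∫⁻ t in Ioi (0 : ℝ), ∫⁻ w, f (mkY (α * a) (τ * t) (β • w + b (a, t)))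
      ≤ (1 / 2) * ∫⁻ a in Ioi (0 : ℝ), ∫⁻ t in Ioi (0 : ℝ),
        ENNReal.ofReal (2 ^ d) * ∫⁻ w, f (mkY (α * a) (τ * t) w) := by
        gcongr with a t; exact hw a t
    _ = (1 / 2) * (ENNReal.ofReal (2 ^ d) * ∫⁻ a in Ioi (0 : ℝ), ∫⁻ t in Ioi (0 : ℝ),
        ∫⁻ w, f (mkY (α * a) (τ * t) w)) := by
        simp only [lintegral_const_mul' _ _ ENNReal.ofReal_ne_top]
    _ ≤ (1 / 2) * (ENNReal.ofReal (2 ^ d) * ∫⁻ a in Ioi (0 : ℝ), (ENNReal.ofReal 2 *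
        ∫⁻ t in Ioi (0 : ℝ), ∫⁻ w, f (mkY (α * a) t w))) := by
        gcongr with a; exact ht a
    _ ≤ (1 / 2) * (ENNReal.ofReal (2 ^ d) * (ENNReal.ofReal 2 * (ENNReal.ofReal 2 *
        ∫⁻ a in Ioi (0 : ℝ), ∫⁻ t in Ioi (0 : ℝ), ∫⁻ w, f (mkY a t w)))) := by
        rw [lintegral_const_mul' _ _ ENNReal.ofReal_ne_top]
        gcongr
    _ = _ := by
        rw [pow_succ, pow_succ, ENNReal.ofReal_mul (by positivity), ENNReal.ofReal_mul (by positivity)]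
        ring

/-- Jensen's inequality for lower integrals. -/
lemma lintegral_rpow_le_measure_univ {X : Type*} [MeasurableSpace X] {μ : Measure X} {p : ℝ} (hp : 1 ≤ p)
    {f : X → ℝ≥0∞} (hf : AEMeasurable f μ) :
    (∫⁻ x, f x ∂μ) ^ p ≤ μ univ ^ (p - 1) * ∫⁻ x, f x ^ p ∂μ := by
  have h := eLpNorm'_le_eLpNorm'_mul_rpow_measure_univ (μ := μ) (f := f) one_pos hp hf.aestronglyMeasurable
  simp only [eLpNorm', enorm_eq_self, ENNReal.rpow_one, div_one] at h
  have hp0 : 0 < p := by linarith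
  refine (ENNReal.rpow_le_rpow h hp0.le).trans_eq ?_
  rw [ENNReal.mul_rpow_of_nonneg _ _ hp0.le, ← ENNReal.rpow_mul, ← ENNReal.rpow_mul, mul_comm]
  congr 2
  · field_simp
  · field_simp; simp

end shear

section secondCauchy

open Metric

variable {n : ℕ}

/-- The second directional derivative of `F` at `z` along `h`. -/
def quad (F : (Fin n → ℂ) → ℂ) (z h : Fin n → ℂ) : ℂ := ∑ i, ∑ j, h i * h j * pd i (pd j F) z

lemma fderiv_apply_eq_sum (F : (Fin n → ℂ) → ℂ) (z h : Fin n → ℂ) :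
    fderiv ℂ F z h = ∑ j, h j * pd j F z := by
  conv_lhs => rw [pi_eq_sum_univ' h]
  simp only [map_sum, map_smul, pd, smul_eq_mul]

lemma quad_eq_circleIntegral {F : (Fin n → ℂ) → ℂ} {U : Set (Fin n → ℂ)} (hU : IsOpen U)
    (hF : DifferentiableOn ℂ F U) {z h : Fin n → ℂ} {r : ℝ} (hr : 0 < r)
    (hz : ∀ ζ ∈ closedBall (0 : ℂ) r, z + ζ • h ∈ U) :
    quad F z h = (Real.pi * I)⁻¹ * ∮ ζ in C(0, r), (ζ ^ 3)⁻¹ * F (z + ζ • h) := by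
  have hd : ∀ {G : (Fin n → ℂ) → ℂ}, DifferentiableOn ℂ G U → ∀ ζ ∈ closedBall (0 : ℂ) r,
      HasDerivAt (fun ζ : ℂ => G (z + ζ • h)) (∑ j, h j * pd j G (z + ζ • h)) ζ := by
    intro G hG ζ hζ
    have h1 := (hG.differentiableAt (hU.mem_nhds (hz ζ hζ))).hasFDerivAt
    have h2 : HasDerivAt (fun ζ : ℂ => z + ζ • h) h ζ := by
      simpa using ((hasDerivAt_id ζ).smul_const h).const_add z
    rw [← fderiv_apply_eq_sum]
    exact h1.comp_hasDerivAt ζ h2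
  have hc : DifferentiableOn ℂ (fun ζ : ℂ => F (z + ζ • h)) (closedBall 0 r) :=
    fun ζ hζ => (hd hF ζ hζ).differentiableAt.differentiableWithinAt
  have key := hc.circleIntegral_one_div_sub_center_pow_smul hr 2
  have h0 : iteratedDeriv 2 (fun ζ : ℂ => F (z + ζ • h)) 0 = quad F z h := by
    rw [iteratedDeriv_succ, iteratedDeriv_one]
    have h1 : deriv (fun ζ : ℂ => F (z + ζ • h)) =ᶠ[nhds 0] fun ζ => ∑ j, h j * pd j F (z + ζ • h) := by
      filter_upwards [closedBall_mem_nhds (0 : ℂ) hr] with ζ hζ using (hd hF ζ hζ).deriv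
    rw [h1.deriv_eq]
    have h2 : HasDerivAt (fun ζ : ℂ => ∑ j, h j * pd j F (z + ζ • h))
        (∑ j, h j * ∑ i, h i * pd i (pd j F) (z + (0 : ℂ) • h)) 0 :=
      HasDerivAt.fun_sum fun j _ => (hd (differentiableOn_pd hU hF j) 0 (mem_closedBall_self hr.le)).const_mul _
    rw [h2.deriv, quad, Finset.sum_comm]
    simp only [zero_smul, add_zero, Finset.mul_sum]
    exact Finset.sum_congr rfl fun i _ => Finset.sum_congr rfl fun j _ => by ring
  simp only [sub_zero, one_div, smul_eq_mul] at key
  rw [key, h0, ← mul_assoc]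
  have : (Real.pi : ℂ) ≠ 0 := by simp [Real.pi_ne_zero]
  simp only [Nat.factorial]
  field_simp
  norm_num

lemma quad_rpow_le {p : ℝ} (hp : 1 ≤ p) : ∃ K : ℝ≥0∞, K ≠ ⊤ ∧ ∀ {n : ℕ} {F : (Fin n → ℂ) → ℂ}
    {U : Set (Fin n → ℂ)}, IsOpen U → DifferentiableOn ℂ F U → ∀ {z h : Fin n → ℂ},
    (∀ ζ ∈ closedBall (0 : ℂ) (1 / 2), z + ζ • h ∈ U) →
    ENNReal.ofReal (‖quad F z h‖ ^ p) ≤ K * ∫⁻ θ in Ioc 0 (2 * Real.pi),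
      ENNReal.ofReal (‖F (z + circleMap 0 (1 / 2) θ • h)‖ ^ p) := by
  have hp0 : 0 ≤ p := by linarith
  refine ⟨(‖(Real.pi * I)⁻¹‖ₑ * 4) ^ p * ENNReal.ofReal (2 * Real.pi) ^ (p - 1), ?_, ?_⟩
  · exact ENNReal.mul_ne_top (ENNReal.rpow_ne_top_of_nonneg hp0 (by finiteness))
      (ENNReal.rpow_ne_top_of_nonneg (by linarith) (by finiteness))
  intro n F U hU hF z h hz
  have hcm : ∀ θ : ℝ, ‖circleMap 0 (1 / 2) θ‖ = 1 / 2 := fun θ => by simp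
  have hcont : Continuous fun θ : ℝ => F (z + circleMap 0 (1 / 2) θ • h) := by
    refine hF.continuousOn.comp_continuous ?_ fun θ => hz _ (by simp)
    have : Continuous fun θ : ℝ => circleMap 0 (1 / 2) θ := continuous_circleMap 0 _
    fun_prop
  simp only [← ENNReal.ofReal_rpow_of_nonneg (norm_nonneg _) hp0, ofReal_norm]
  have h1 : ‖quad F z h‖ₑ ≤ ‖(Real.pi * I)⁻¹‖ₑ * 4 * ∫⁻ θ in Ioc 0 (2 * Real.pi),
      ‖F (z + circleMap 0 (1 / 2) θ • h)‖ₑ := by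
    rw [quad_eq_circleIntegral hU hF (by norm_num) hz, enorm_mul, mul_assoc, circleIntegral,
      intervalIntegral.integral_of_le (by positivity)]
    refine mul_le_mul_right ?_ _
    refine (enorm_integral_le_lintegral_enorm _).trans_eq ?_
    rw [← lintegral_const_mul' _ _ (by finiteness)]
    refine lintegral_congr fun θ => ?_
    rw [deriv_circleMap, smul_eq_mul, ← mul_assoc, enorm_mul]
    congr 1
    rw [← ofReal_norm]
    simp only [norm_mul, norm_inv, norm_pow, hcm, norm_I]
    norm_num
  refine (ENNReal.rpow_le_rpow h1 hp0).trans ?_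
  rw [ENNReal.mul_rpow_of_nonneg _ _ hp0, mul_assoc]
  refine mul_le_mul_right ((lintegral_rpow_le_measure_univ hp ?_).trans_eq ?_) _
  · exact hcont.enorm.measurable.aemeasurable
  · simp

end secondCauchy

section frame

variable {d : ℕ}

/-- A Lorentz-orthogonal frame at `v`, all of whose members have Lorentz norm `± lor v`. -/
def frame (v : Fin (d + 2) → ℝ) : Fin (d + 2) → Fin (d + 2) → ℝ :=
  Fin.cons v (Fin.cons (mkV (cA v) (cS v - 2 * cT v) (cW v))
    (fun j => mkV 0 (2 * √(lor v) * cW v j / cA v) (√(lor v) • Pi.single j 1)))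

lemma frame_sum {v : Fin (d + 2) → ℝ} (hv : v ∈ cone (d + 2)) (i k : Fin (d + 2)) :
    v i * v k - ∑ l : Fin (d + 1), frame v l.succ i * frame v l.succ k =
      if i = k then (if i = 0 then lor v else -lor v) else 0 := by
  obtain ⟨hA, hT⟩ := mem_cone_iff.1 hv
  have hr := Real.sq_sqrt hv.1.le
  have hl := lor_eq_mul hA.ne'
  have hS : cS v = cT v + (∑ j, cW v j ^ 2) / cA v := by rw [cT]; ring
  have h0 : v 0 = (cA v + cS v) / 2 := by rw [cA, cS]; ring
  have h1 : v (Fin.succ 0) = (cA v - cS v) / 2 := by rw [cA, cS, Fin.succ_zero_eq_one]; ring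
  have h2 : ∀ j : Fin d, v j.succ.succ = cW v j := fun j => rfl
  have e1 : ∀ j, frame v (Fin.succ (Fin.succ j)) = 
    mkV 0 (2 * √(lor v) * cW v j / cA v) (√(lor v) • Pi.single j 1) := fun j => rfl
  have e0 : frame v (Fin.succ 0) = mkV (cA v) (cS v - 2 * cT v) (cW v) := rfl
  have m0 : ∀ (a s : ℝ) (w : Fin d → ℝ), mkV a s w 0 = (a + s) / 2 := fun _ _ _ => rfl
  have m1 : ∀ (a s : ℝ) (w : Fin d → ℝ), mkV a s w (Fin.succ 0) = (a - s) / 2 := fun _ _ _ => rfl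
  have m2 : ∀ (a s : ℝ) (w : Fin d → ℝ) (j : Fin d), mkV a s w j.succ.succ = w j := fun _ _ _ _ => rfl
  rw [Fin.sum_univ_succ, e0]
  simp only [e1]
  set A := cA v
  set T := cT v
  set r := √(lor v)
  have hsq : ∀ c : ℝ, ∑ j, (c * cW v j) * (c * cW v j) = c ^ 2 * ∑ j, cW v j ^ 2 := by
    intro c; rw [Finset.mul_sum]; exact Finset.sum_congr rfl fun j _ => by ring
  have hc : r ^ 2 / A ^ 2 = T / A := by rw [hr, hl]; field_simp
  have c00 : ∑ j, (0 + 2 * r * cW v j / A) / 2 * ((0 + 2 * r * cW v j / A) / 2) = 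
      T / A * ∑ j, cW v j ^ 2 := by
    rw [← hc, ← div_pow, ← hsq]; exact Finset.sum_congr rfl fun j _ => by ring
  have c01 : ∑ j, (0 + 2 * r * cW v j / A) / 2 * ((0 - 2 * r * cW v j / A) / 2) = 
      - (T / A * ∑ j, cW v j ^ 2) := by
    rw [← hc, ← div_pow, ← hsq, ← Finset.sum_neg_distrib]; exact Finset.sum_congr rfl fun j _ => by ring
  have c10 : ∑ j, (0 - 2 * r * cW v j / A) / 2 * ((0 + 2 * r * cW v j / A) / 2) = 
      - (T / A * ∑ j, cW v j ^ 2) := by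
    rw [← hc, ← div_pow, ← hsq, ← Finset.sum_neg_distrib]; exact Finset.sum_congr rfl fun j _ => by ring
  have c11 : ∑ j, (0 - 2 * r * cW v j / A) / 2 * ((0 - 2 * r * cW v j / A) / 2) = 
      T / A * ∑ j, cW v j ^ 2 := by
    rw [← hc, ← div_pow, ← hsq]; exact Finset.sum_congr rfl fun j _ => by ring
  have hQ : (∑ j, cW v j ^ 2) = A * (cS v - T) := by rw [hS]; field_simp; ring
  have hc' : r * r = A * T := by rw [← sq, hr, hl]
  refine Fin.cases ?_ (fun i => Fin.cases ?_ (fun i => ?_) i) i <;>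
  refine Fin.cases ?_ (fun k => Fin.cases ?_ (fun k => ?_) k) k <;>
  simp only [h0, h1, h2, m0, m1, m2, c00, c01, c10, c11, hQ, hl, Pi.smul_apply, Pi.single_apply, smul_eq_mul,
    mul_ite, ite_mul, mul_one, mul_zero, zero_mul, Finset.sum_ite_eq, Finset.mem_univ, if_true,
    Fin.succ_inj, Fin.succ_ne_zero, if_false, (Fin.succ_ne_zero _).symm]
  all_goals try split_ifs
  all_goals try subst_vars
  all_goals field_simp
  all_goals first
    | ring1
    | linear_combination (-1 : ℝ) * hc'
    | linear_combination (-2 * cW v k) * hc'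
    | linear_combination (2 * cW v k) * hc'
    | linear_combination (-2 * cW v i) * hc'
    | linear_combination (2 * cW v i) * hc'

/-- Coordinatewise complexification. -/
def toC {n : ℕ} (h : Fin n → ℝ) : Fin n → ℂ := fun i => (h i : ℂ)

lemma lor_mul_BoxOp (F : (Fin (d + 2) → ℂ) → ℂ) (z : Fin (d + 2) → ℂ) {v : Fin (d + 2) → ℝ}
    (hv : v ∈ cone (d + 2)) : (lor v : ℂ) * BoxOp F z =
      -(quad F z (toC v) - ∑ l : Fin (d + 1), quad F z (toC (frame v l.succ))) := by
  have h1 : quad F z (toC v) - ∑ l : Fin (d + 1), quad F z (toC (frame v l.succ)) =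
      ∑ i, ∑ k, ((v i * v k - ∑ l : Fin (d + 1), frame v l.succ i * frame v l.succ k : ℝ) : ℂ) *
        pd i (pd k F) z := by
    simp only [quad, toC, ofReal_sub, ofReal_sum, ofReal_mul, sub_mul, Finset.sum_sub_distrib, Finset.sum_mul]
    congr 1
    rw [Finset.sum_comm]
    exact Finset.sum_congr rfl fun i _ => Finset.sum_comm
  rw [h1, BoxOp]
  simp only [frame_sum hv]
  have h2 : ∀ i, ∑ k, ((if i = k then (if i = 0 then lor v else -lor v) else 0 : ℝ) : ℂ) * pd i (pd k F) z =
      (if i = 0 then (lor v : ℂ) else -(lor v : ℂ)) * pd i (pd i F) z := by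
    intro i
    rw [Finset.sum_eq_single i (fun k _ hk => by simp [hk.symm]) (by simp)]
    simp only [if_true]; split_ifs <;> simp
  simp only [h2, Fin.sum_univ_succ (n := d + 1), if_true, Fin.succ_ne_zero, if_false, ← Finset.mul_sum]
  ring

lemma mkV_eta (y : Fin (d + 2) → ℝ) : mkV (cA y) (cS y) (cW y) = y := by
  ext i
  refine Fin.cases ?_ (fun i => Fin.cases ?_ (fun i => ?_) i) i
  · change (cA y + cS y) / 2 = _; rw [cA, cS]; ring
  · change (cA y - cS y) / 2 = _; rw [cA, cS, Fin.succ_zero_eq_one]; ring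
  · rfl

lemma ext_coords {x y : Fin (d + 2) → ℝ} (hA : cA x = cA y) (hS : cS x = cS y) (hW : cW x = cW y) :
    x = y := by
  rw [← mkV_eta x, ← mkV_eta y, hA, hS, hW]

lemma add_smul_frame (k : Fin (d + 2)) {s : ℝ} (hs : |s| ≤ 1 / 2) : ∃ (α τ β : ℝ) (b : ℝ × ℝ → Fin d → ℝ),
    1 / 2 ≤ α ∧ 1 / 2 ≤ τ ∧ 1 / 2 ≤ β ∧ α ≤ 3 / 2 ∧ τ ≤ 3 / 2 ∧ Measurable b ∧ ∀ v ∈ cone (d + 2),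
      v + s • frame v k = mkY (α * cA v) (τ * cT v) (β • cW v + b (cA v, cT v)) := by
  obtain ⟨hs1, hs2⟩ := abs_le.1 hs
  have sA : ∀ y : Fin (d + 2) → ℝ, cA (s • y) = s * cA y := fun y => by simp [cA]; ring
  have sS : ∀ y : Fin (d + 2) → ℝ, cS (s • y) = s * cS y := fun y => by simp [cS]; ring
  have sW : ∀ x y : Fin (d + 2) → ℝ, cW (x + s • y) = cW x + s • cW y := fun x y => rfl
  refine Fin.cases ?_ (fun k => Fin.cases ?_ (fun j => ?_) k) k
  · refine ⟨1 + s, 1 + s, 1 + s, fun _ => 0, by linarith, by linarith, by linarith, by linarith, by linarith, by fun_prop, fun v hv => ?_⟩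
    obtain ⟨hA, hT⟩ := mem_cone_iff.1 hv
    have e : frame v 0 = v := rfl
    have : 0 < 1 + s := by linarith
    rw [e]
    refine ext_coords ?_ ?_ ?_
    · rw [cA_add, sA, cA_mkY]; ring
    · rw [cS_add, sS, cS_mkY, cT]
      simp only [add_zero, Pi.smul_apply, smul_eq_mul, mul_pow, ← Finset.mul_sum]
      field_simp; ring
    · rw [sW, cW_mkY, add_smul, one_smul, add_zero]
  · refine ⟨1 + s, 1 - s, 1 + s, fun _ => 0, by linarith, by linarith, by linarith, by linarith, by linarith, by fun_prop, fun v hv => ?_⟩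
    obtain ⟨hA, hT⟩ := mem_cone_iff.1 hv
    have e : frame v (Fin.succ 0) = mkV (cA v) (cS v - 2 * cT v) (cW v) := rfl
    have : 0 < 1 + s := by linarith
    rw [e]
    refine ext_coords ?_ ?_ ?_
    · rw [cA_add, sA, cA_mkY, cA_mkV]; ring
    · rw [cS_add, sS, cS_mkY, cS_mkV, cT]
      simp only [add_zero, Pi.smul_apply, smul_eq_mul, mul_pow, ← Finset.mul_sum]
      field_simp; ring
    · rw [sW, cW_mkY, cW_mkV, add_smul, one_smul, add_zero]
  · refine ⟨1, 1 - s ^ 2, 1, fun q => s • √(q.1 * q.2) • Pi.single j 1, by norm_num, by nlinarith, by norm_num,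
      by norm_num, by nlinarith, by fun_prop, fun v hv => ?_⟩
    obtain ⟨hA, hT⟩ := mem_cone_iff.1 hv
    have e : frame v j.succ.succ = mkV 0 (2 * √(lor v) * cW v j / cA v) (√(lor v) • Pi.single j 1) := rfl
    have hl := lor_eq_mul hA.ne'
    have hr : √(cA v * cT v) ^ 2 = cA v * cT v := Real.sq_sqrt (by positivity)
    rw [e, hl]
    refine ext_coords ?_ ?_ ?_
    · rw [cA_add, sA, cA_mkY, cA_mkV]; ring
    · rw [cS_add, sS, cS_mkY, cS_mkV]
      have hS : cS v = cT v + (∑ j, cW v j ^ 2) / cA v := by rw [cT]; ring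
      simp only [one_smul, Pi.add_apply, Pi.smul_apply, smul_eq_mul, Pi.single_apply, mul_ite, mul_one, mul_zero]
      have : ∀ i, (cW v i + if i = j then s * √(cA v * cT v) else 0) ^ 2 = cW v i ^ 2 +
          if i = j then (2 * cW v i * (s * √(cA v * cT v)) + s ^ 2 * (cA v * cT v)) else 0 := by
        intro i
        split_ifs
        · linear_combination s ^ 2 * hr
        · ring
      simp only [this, Finset.sum_add_distrib, Finset.sum_ite_eq', Finset.mem_univ, if_true]
      rw [hS]
      field_simp; ring
    · rw [sW, cW_mkY, cW_mkV, one_smul]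

end frame

section mixCauchy

open Metric

variable {d : ℕ}

lemma measurable_frame (k : Fin (d + 2)) : Measurable fun v : Fin (d + 2) → ℝ => frame v k := by
  have hA := (continuous_cA (d := d)).measurable
  have hS := (continuous_cS (d := d)).measurable
  have hW := (continuous_cW (d := d)).measurable
  have hT := measurable_cT (d := d)
  have hL := (continuous_lor (n := d + 2)).measurable
  have hW' : ∀ j, Measurable fun v : Fin (d + 2) → ℝ => cW v j := fun j => (measurable_pi_apply j).comp hW
  refine Fin.cases ?_ (fun k => Fin.cases ?_ (fun j => ?_) k) k
  · exact measurable_id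
  · exact measurable_mkV.comp (f := fun v : Fin (d + 2) → ℝ => (cA v, cS v - 2 * cT v, cW v)) (by fun_prop)
  · have := hW' j
    refine measurable_mkV.comp (f := fun v : Fin (d + 2) → ℝ => ((0 : ℝ), 2 * √(lor v) * cW v j / cA v,
      √(lor v) • (Pi.single j 1 : Fin d → ℝ))) ?_
    fun_prop

lemma cpt_add_smul_toC {n : ℕ} (x y h : Fin n → ℝ) (ζ : ℂ) :
    cpt x y + ζ • toC h = cpt (x + ζ.re • h) (y + ζ.im • h) := by
  ext i
  simp only [cpt, toC, Pi.add_apply, Pi.smul_apply, smul_eq_mul]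
  apply Complex.ext <;> simp

lemma add_smul_frame_mem {v : Fin (d + 2) → ℝ} (hv : v ∈ cone (d + 2)) (k : Fin (d + 2)) {s : ℝ}
    (hs : |s| ≤ 1 / 2) : v + s • frame v k ∈ cone (d + 2) := by
  obtain ⟨α, τ, β, b, hα, hτ, -, -, -, -, h⟩ := add_smul_frame (d := d) k hs
  obtain ⟨hA, hT⟩ := mem_cone_iff.1 hv
  rw [h v hv]
  exact mkY_mem (by positivity) (by positivity) _

lemma lintegral_add_smul_frame_le {f : (Fin (d + 2) → ℝ) → ℝ≥0∞} (hf : Measurable f) (k : Fin (d + 2)) {s σ : ℝ}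
    (hs : |s| ≤ 1 / 2) :
    ∫⁻ v in cone (d + 2), f (v + s • frame v k) * ENNReal.ofReal (lor v ^ σ) ≤
      ENNReal.ofReal (4 ^ |σ| * 2 ^ (d + 2)) * ∫⁻ v in cone (d + 2), f v * ENNReal.ofReal (lor v ^ σ) := by
  obtain ⟨α, τ, β, b, hα, hτ, hβ, hα', hτ', hb, h⟩ := add_smul_frame (d := d) k hs
  have hL := (continuous_lor (n := d + 2)).measurable
  have hm : Measurable fun v : Fin (d + 2) → ℝ => f v * ENNReal.ofReal (lor v ^ σ) := by fun_prop
  have key := lintegral_cone_shear hm hα hτ hβ hb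
  rw [ENNReal.ofReal_mul (by positivity), mul_assoc]
  refine le_trans ?_ (mul_le_mul_right key _)
  rw [← lintegral_const_mul' _ _ ENNReal.ofReal_ne_top]
  refine setLIntegral_mono' isOpen_cone.measurableSet fun v hv => ?_
  obtain ⟨hA, hT⟩ := mem_cone_iff.1 hv
  have e : lor (mkY (α * cA v) (τ * cT v) (β • cW v + b (cA v, cT v))) = α * τ * lor v := by
    rw [lor_eq_mul (by rw [cA_mkY]; positivity), lor_eq_mul hA.ne', cA_mkY, cT_mkY]; ring
  rw [h v hv, e, mul_left_comm, ← ENNReal.ofReal_mul (by positivity)]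
  refine mul_le_mul_right (ENNReal.ofReal_le_ofReal ?_) _
  have hv0 := hv.1
  have h1 : 1 / 4 ≤ α * τ := by nlinarith
  have h2 : α * τ ≤ 4 := by nlinarith
  rw [Real.mul_rpow (by positivity) hv0.le, ← mul_assoc]
  refine le_mul_of_one_le_left (by positivity) ?_
  rcases le_total 0 σ with hσ | hσ
  · rw [abs_of_nonneg hσ, ← Real.mul_rpow (by norm_num) (by positivity)]
    exact Real.one_le_rpow (by linarith) hσ
  · rw [abs_of_nonpos hσ, Real.rpow_neg (by norm_num), ← Real.inv_rpow (by norm_num),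
      ← Real.mul_rpow (by norm_num) (by positivity)]
    exact Real.one_le_rpow_of_pos_of_le_one_of_nonpos (by positivity) (by linarith) hσ

lemma measurable_cpt_pair {n : ℕ} {X : Type*} [MeasurableSpace X] {a b : X → Fin n → ℝ} (ha : Measurable a)
    (hb : Measurable b) : Measurable fun x => cpt (a x) (b x) := by
  have := (continuous_cpt (n := n)).measurable.comp (ha.prodMk hb)
  exact this

lemma mixInt_eq {p s : ℝ} {G : (Fin (d + 2) → ℂ) → ℂ} (hG : Measurable G) :
    mixInt d p s G = ∫⁻ v in cone (d + 2), (∫⁻ u, ENNReal.ofReal (‖G (cpt u v)‖ ^ p)) *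
      ENNReal.ofReal (lor v ^ s) := by
  have hL := (continuous_lor (n := d + 2)).measurable
  have h1 : Measurable fun q : (Fin (d + 2) → ℝ) × (Fin (d + 2) → ℝ) => G (cpt q.2 q.1) :=
    hG.comp (measurable_cpt_pair measurable_snd measurable_fst)
  refine (lintegral_cvol ((h1.norm.pow_const p).mul
    ((hL.comp measurable_fst).pow_const s)).ennreal_ofReal).trans ?_
  refine setLIntegral_congr_fun isOpen_cone.measurableSet fun v hv => ?_
  simp only [Pi.mul_apply, Function.comp_apply]
  rw [← lintegral_mul_const' _ _ ENNReal.ofReal_ne_top]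
  refine lintegral_congr fun u => ?_
  rw [ENNReal.ofReal_mul (by positivity)]

lemma mixInt_quad_le {p s : ℝ} (hp : 1 ≤ p) : ∃ C : ℝ≥0∞, C ≠ ⊤ ∧
    ∀ (k : Fin (d + 2)) {G : (Fin (d + 2) → ℂ) → ℂ}, Measurable G → DifferentiableOn ℂ G (tube (d + 2)) →
    ∫⁻ q, ENNReal.ofReal (‖quad G (cpt q.2 q.1) (toC (frame q.1 k))‖ ^ p * lor q.1 ^ s) ∂(cvol d) ≤
      C * mixInt d p s G := by
  obtain ⟨K, hK, hquad⟩ := quad_rpow_le hp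
  refine ⟨K * (ENNReal.ofReal (2 * Real.pi) * ENNReal.ofReal (4 ^ |s| * 2 ^ (d + 2))), by finiteness, ?_⟩
  intro k G hGm hG
  have hfr := measurable_frame (d := d) k
  have hL := (continuous_lor (n := d + 2)).measurable
  have hcirc : Measurable fun θ : ℝ => circleMap 0 (1 / 2) θ := (continuous_circleMap 0 _).measurable
  have him : ∀ ζ : ℂ, ‖ζ‖ ≤ 1 / 2 → |ζ.im| ≤ 1 / 2 := fun ζ hζ => (abs_im_le_norm ζ).trans hζ
  have hcm : ∀ θ : ℝ, ‖circleMap 0 (1 / 2) θ‖ ≤ 1 / 2 := fun θ => by simp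
  set Φ : (Fin (d + 2) → ℝ) × (Fin (d + 2) → ℝ) → ℝ → ℝ≥0∞ := fun q θ =>
    ENNReal.ofReal (‖G (cpt (q.2 + (circleMap 0 (1 / 2) θ).re • frame q.1 k)
      (q.1 + (circleMap 0 (1 / 2) θ).im • frame q.1 k))‖ ^ p) * ENNReal.ofReal (lor q.1 ^ s) with hΦ
  have hΦm : Measurable (Function.uncurry Φ) := by
    have h1 : Measurable fun x : ((Fin (d + 2) → ℝ) × (Fin (d + 2) → ℝ)) × ℝ =>
        G (cpt (x.1.2 + (circleMap 0 (1 / 2) x.2).re • frame x.1.1 k)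
      (x.1.1 + (circleMap 0 (1 / 2) x.2).im • frame x.1.1 k)) :=
      hGm.comp (measurable_cpt_pair (by fun_prop) (by fun_prop))
    change Measurable fun x : ((Fin (d + 2) → ℝ) × (Fin (d + 2) → ℝ)) × ℝ => _ * _
    exact (h1.norm.pow_const p).ennreal_ofReal.mul
      ((hL.comp (measurable_fst.comp measurable_fst)).pow_const s).ennreal_ofReal
  have h1 : ∫⁻ q, ENNReal.ofReal (‖quad G (cpt q.2 q.1) (toC (frame q.1 k))‖ ^ p * lor q.1 ^ s) ∂(cvol d) ≤
      ∫⁻ q, K * (∫⁻ θ in Ioc 0 (2 * Real.pi), Φ q θ) ∂(cvol d) := by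
    refine lintegral_mono_ae (ae_mem_cvol.mono fun q hq => ?_)
    have := hquad isOpen_tube hG (z := cpt q.2 q.1) (h := toC (frame q.1 k)) (fun ζ hζ => by
      rw [cpt_add_smul_toC, cpt_mem_tube]
      exact add_smul_frame_mem hq k (him ζ (by simpa using hζ)))
    simp only [cpt_add_smul_toC] at this
    rw [ENNReal.ofReal_mul (by positivity)]
    simp only [hΦ]
    rw [lintegral_mul_const' _ _ ENNReal.ofReal_ne_top, ← mul_assoc]
    exact mul_le_mul_left this _
  refine h1.trans ?_
  rw [lintegral_const_mul' _ _ hK, lintegral_lintegral_swap hΦm.aemeasurable, mul_assoc]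
  refine mul_le_mul_right ?_ _
  have h2 : ∀ θ, ∫⁻ q, Φ q θ ∂(cvol d) ≤ ENNReal.ofReal (4 ^ |s| * 2 ^ (d + 2)) * mixInt d p s G := by
    intro θ
    have hm : Measurable fun q => Φ q θ := hΦm.comp (f := fun q => (q, θ)) (by fun_prop)
    have h3 : Measurable fun q : (Fin (d + 2) → ℝ) × (Fin (d + 2) → ℝ) => G (cpt q.2 q.1) :=
      hGm.comp (measurable_cpt_pair measurable_snd measurable_fst)
    have h4 : Measurable fun v => ∫⁻ u, ENNReal.ofReal (‖G (cpt u v)‖ ^ p) :=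
      Measurable.lintegral_prod_right' (f := fun q : (Fin (d + 2) → ℝ) × (Fin (d + 2) → ℝ) =>
        ENNReal.ofReal (‖G (cpt q.2 q.1)‖ ^ p)) (h3.norm.pow_const p).ennreal_ofReal
    rw [lintegral_cvol hm, mixInt_eq hGm]
    refine le_trans (le_of_eq ?_) (lintegral_add_smul_frame_le h4 k (him _ (hcm θ)))
    refine lintegral_congr fun v => ?_
    simp only [hΦ]
    rw [lintegral_mul_const' _ _ ENNReal.ofReal_ne_top]
    congr 1
    exact lintegral_add_right_eq_self (fun u => ENNReal.ofReal (‖G (cpt u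
      (v + (circleMap 0 (1 / 2) θ).im • frame v k))‖ ^ p)) _
  refine (lintegral_mono fun θ => h2 θ).trans_eq ?_
  simp only [lintegral_const, Measure.restrict_apply, MeasurableSet.univ, univ_inter, Real.volume_Ioc, sub_zero]
  ring

lemma mixInt_congr {p s : ℝ} {F G : (Fin (d + 2) → ℂ) → ℂ} (h : EqOn F G (tube (d + 2))) :
    mixInt d p s F = mixInt d p s G := by
  refine lintegral_congr_ae (ae_mem_cvol.mono fun q hq => ?_)
  simp only [h (cpt_mem_tube.2 hq)]

lemma measurable_indicator_tube {F : (Fin (d + 2) → ℂ) → ℂ} (hF : ContinuousOn F (tube (d + 2))) :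
    Measurable ((tube (d + 2)).indicator F) := by
  classical
  rw [← Set.piecewise_eq_indicator]
  exact hF.measurable_piecewise continuousOn_const isOpen_tube.measurableSet

lemma mixInt_BoxOp_le {p s : ℝ} (hp : 1 ≤ p) : ∃ C : ℝ≥0∞, C ≠ ⊤ ∧
    ∀ {G : (Fin (d + 2) → ℂ) → ℂ}, DifferentiableOn ℂ G (tube (d + 2)) →
      mixInt d p (s + p) (BoxOp G) ≤ C * mixInt d p s G := by
  obtain ⟨C, hC, hquad⟩ := mixInt_quad_le (d := d) (s := s) hp
  have hp0 : 0 ≤ p := by linarith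
  refine ⟨ENNReal.ofReal ((d + 2 : ℕ) ^ (p - 1)) * ((d + 2 : ℕ) * C), by finiteness, ?_⟩
  intro G₀ hG₀
  set G := (tube (d + 2)).indicator G₀ with hGdef
  have hEq : EqOn G₀ G (tube (d + 2)) := fun z hz => (Set.indicator_of_mem hz _).symm
  rw [mixInt_congr hEq, mixInt_congr (BoxOp_congr isOpen_tube hEq)]
  have hGm : Measurable G := measurable_indicator_tube hG₀.continuousOn
  have hG : DifferentiableOn ℂ G (tube (d + 2)) := hG₀.congr fun z hz => (hEq hz).symm
  have h1 : mixInt d p (s + p) (BoxOp G) ≤ ∫⁻ q, ENNReal.ofReal ((d + 2 : ℕ) ^ (p - 1)) * ∑ k,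
      ENNReal.ofReal (‖quad G (cpt q.2 q.1) (toC (frame q.1 k))‖ ^ p * lor q.1 ^ s) ∂(cvol d) := by
    refine lintegral_mono_ae (ae_mem_cvol.mono fun q hq => ?_)
    have hl := hq.1
    rw [← ENNReal.ofReal_sum_of_nonneg fun k _ => by positivity, ← ENNReal.ofReal_mul (by positivity)]
    refine ENNReal.ofReal_le_ofReal ?_
    rw [← Finset.sum_mul, ← mul_assoc, add_comm s p, Real.rpow_add hl, ← mul_assoc]
    refine mul_le_mul_of_nonneg_right ?_ (by positivity)
    have e : ‖BoxOp G (cpt q.2 q.1)‖ ^ p * lor q.1 ^ p = ‖(lor q.1 : ℂ) * BoxOp G (cpt q.2 q.1)‖ ^ p := by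
      rw [norm_mul, norm_real, Real.norm_of_nonneg hl.le, Real.mul_rpow hl.le (norm_nonneg _), mul_comm]
    rw [e, lor_mul_BoxOp G _ hq, norm_neg]
    have h3 : ‖quad G (cpt q.2 q.1) (toC q.1) - ∑ l : Fin (d + 1), quad G (cpt q.2 q.1) (toC (frame q.1 l.succ))‖ ≤
        ∑ k, |‖quad G (cpt q.2 q.1) (toC (frame q.1 k))‖| := by
      simp only [abs_norm]
      rw [Fin.sum_univ_succ (n := d + 1) (f := fun k => ‖quad G (cpt q.2 q.1) (toC (frame q.1 k))‖)]
      exact (norm_sub_le _ _).trans (add_le_add le_rfl (norm_sum_le _ _))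
    refine (Real.rpow_le_rpow (norm_nonneg _) h3 hp0).trans ?_
    refine (Real.rpow_sum_le_const_mul_sum_rpow _ _ hp).trans_eq ?_
    simp
  refine h1.trans ?_
  rw [lintegral_const_mul' _ _ ENNReal.ofReal_ne_top, mul_assoc]
  refine mul_le_mul_right ?_ _
  have hmeas : ∀ k, Measurable fun q : (Fin (d + 2) → ℝ) × (Fin (d + 2) → ℝ) =>
      ENNReal.ofReal (‖quad G (cpt q.2 q.1) (toC (frame q.1 k))‖ ^ p * lor q.1 ^ s) := by
    intro k
    have hc : Measurable fun q : (Fin (d + 2) → ℝ) × (Fin (d + 2) → ℝ) => cpt q.2 q.1 :=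
      measurable_cpt_pair measurable_snd measurable_fst
    have hf : ∀ i, Measurable fun q : (Fin (d + 2) → ℝ) × (Fin (d + 2) → ℝ) => (frame q.1 k i : ℂ) := fun i =>
      Complex.measurable_ofReal.comp ((measurable_pi_apply i).comp ((measurable_frame k).comp measurable_fst))
    have hq : Measurable fun q : (Fin (d + 2) → ℝ) × (Fin (d + 2) → ℝ) =>
        quad G (cpt q.2 q.1) (toC (frame q.1 k)) :=
      Finset.measurable_fun_sum _ fun i _ => Finset.measurable_fun_sum _ fun j _ =>
        ((hf i).mul (hf j)).mul ((measurable_fderiv_apply_const ℂ _ _).comp hc)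
    exact ((hq.norm.pow_const p).mul ((continuous_lor.measurable.comp measurable_fst).pow_const s)).ennreal_ofReal
  rw [lintegral_finsetSum _ fun k _ => hmeas k]
  refine (Finset.sum_le_sum fun k _ => hquad k hGm hG).trans_eq ?_
  simp [mul_assoc]

end mixCauchy

section subMean

open Metric

variable {n : ℕ}

lemma norm_rpow_le_lintegral_circle {p : ℝ} (hp : 1 ≤ p) : ∃ K : ℝ≥0∞, K ≠ ⊤ ∧ ∀ {F : (Fin n → ℂ) → ℂ}
    {U : Set (Fin n → ℂ)}, DifferentiableOn ℂ F U → ∀ {z h : Fin n → ℂ},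
    (∀ ζ ∈ closedBall (0 : ℂ) 1, z + ζ • h ∈ U) →
    ENNReal.ofReal (‖F z‖ ^ p) ≤ K * ∫⁻ θ in Ioc 0 (2 * Real.pi),
      ENNReal.ofReal (‖F (z + circleMap 0 1 θ • h)‖ ^ p) := by
  have hp0 : 0 ≤ p := by linarith
  refine ⟨‖(2 * Real.pi)⁻¹‖ₑ ^ p * ENNReal.ofReal (2 * Real.pi) ^ (p - 1), ?_, ?_⟩
  · exact ENNReal.mul_ne_top (ENNReal.rpow_ne_top_of_nonneg hp0 (by finiteness))
      (ENNReal.rpow_ne_top_of_nonneg (by linarith) (by finiteness))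
  intro F U hF z h hz
  have hcont : Continuous fun θ : ℝ => F (z + circleMap 0 1 θ • h) := by
    refine hF.continuousOn.comp_continuous ?_ fun θ => hz _ (by simp)
    have : Continuous fun θ : ℝ => circleMap 0 1 θ := continuous_circleMap 0 _
    fun_prop
  have hd : DifferentiableOn ℂ (fun ζ : ℂ => F (z + ζ • h)) (closedBall 0 |1|) := by
    refine hF.comp (by fun_prop) fun ζ hζ => hz ζ (by simpa using hζ)
  simp only [← ENNReal.ofReal_rpow_of_nonneg (norm_nonneg _) hp0, ofReal_norm]
  have h1 : ‖F z‖ₑ ≤ ‖(2 * Real.pi)⁻¹‖ₑ * ∫⁻ θ in Ioc 0 (2 * Real.pi), ‖F (z + circleMap 0 1 θ • h)‖ₑ := by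
    have := (hd.diffContOnCl_ball le_rfl).circleAverage
    rw [Real.circleAverage_def, zero_smul, add_zero, intervalIntegral.integral_of_le (by positivity)] at this
    rw [← this, enorm_smul]
    exact mul_le_mul_right (enorm_integral_le_lintegral_enorm _) _
  refine (ENNReal.rpow_le_rpow h1 hp0).trans ?_
  rw [ENNReal.mul_rpow_of_nonneg _ _ hp0, mul_assoc]
  refine mul_le_mul_right ((lintegral_rpow_le_measure_univ hp ?_).trans_eq ?_) _
  · exact hcont.enorm.measurable.aemeasurable
  · simp

lemma lintegral_ball_rotate {f : (Fin n → ℂ) → ℝ≥0∞} (hf : Measurable f) (z : Fin n → ℂ) (r θ : ℝ) :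
    ∫⁻ h in ball 0 r, f (z + circleMap 0 1 θ • h) = ∫⁻ w in ball z r, f w := by
  have h1 : MeasurePreserving (fun h : Fin n → ℂ => fun i => rotation (Circle.exp θ) (h i)) :=
    volume_preserving_pi (f := fun _ => rotation (Circle.exp θ)) fun i => LinearIsometryEquiv.measurePreserving _
  have h2 : MeasurePreserving (fun h : Fin n → ℂ => z + circleMap 0 1 θ • h) := by
    have e : (fun h : Fin n → ℂ => z + circleMap 0 1 θ • h) =
        (fun h => z + h) ∘ (fun h : Fin n → ℂ => fun i => rotation (Circle.exp θ) (h i)) := by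
      funext h
      ext i
      simp [circleMap]
    rw [e]
    exact (measurePreserving_add_left volume z).comp h1
  have h3 : (fun h : Fin n → ℂ => z + circleMap 0 1 θ • h) ⁻¹' ball z r = ball 0 r := by
    ext h
    simp [norm_smul]
  rw [← h3]
  exact h2.setLIntegral_comp_preimage isOpen_ball.measurableSet hf

lemma norm_rpow_mul_volume_le {p : ℝ} (hp : 1 ≤ p) : ∃ K : ℝ≥0∞, K ≠ ⊤ ∧ ∀ {F : (Fin n → ℂ) → ℂ}, Measurable F →
    ∀ {z : Fin n → ℂ} {r : ℝ}, DifferentiableOn ℂ F (ball z r) →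
    ENNReal.ofReal (‖F z‖ ^ p) * volume (ball (0 : Fin n → ℂ) r) ≤
      K * ∫⁻ w in ball z r, ENNReal.ofReal (‖F w‖ ^ p) := by
  obtain ⟨K, hK, h⟩ := norm_rpow_le_lintegral_circle (n := n) hp
  refine ⟨K * ENNReal.ofReal (2 * Real.pi), by finiteness, fun {F} hFm {z r} hF => ?_⟩
  have hm : Measurable fun w => ENNReal.ofReal (‖F w‖ ^ p) := (hFm.norm.pow_const p).ennreal_ofReal
  have hm2 : Measurable fun q : (Fin n → ℂ) × ℝ => ENNReal.ofReal (‖F (z + circleMap 0 1 q.2 • q.1)‖ ^ p) := by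
    have : Measurable fun θ : ℝ => circleMap 0 1 θ := (continuous_circleMap 0 _).measurable
    exact hm.comp (f := fun q : (Fin n → ℂ) × ℝ => z + circleMap 0 1 q.2 • q.1) (by fun_prop)
  calc ENNReal.ofReal (‖F z‖ ^ p) * volume (ball (0 : Fin n → ℂ) r)
      = ∫⁻ _ in ball (0 : Fin n → ℂ) r, ENNReal.ofReal (‖F z‖ ^ p) := by rw [setLIntegral_const]
    _ ≤ ∫⁻ k in ball (0 : Fin n → ℂ) r, K * ∫⁻ θ in Ioc 0 (2 * Real.pi),
          ENNReal.ofReal (‖F (z + circleMap 0 1 θ • k)‖ ^ p) := by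
        refine setLIntegral_mono' isOpen_ball.measurableSet fun k hk => h hF fun ζ hζ => ?_
        rw [mem_closedBall_zero_iff] at hζ
        rw [mem_ball_zero_iff] at hk
        rw [mem_ball, dist_eq_norm, add_sub_cancel_left, norm_smul]
        exact (mul_le_of_le_one_left (norm_nonneg _) hζ).trans_lt hk
    _ = K * ∫⁻ θ in Ioc 0 (2 * Real.pi), ∫⁻ w in ball z r, ENNReal.ofReal (‖F w‖ ^ p) := by
        rw [lintegral_const_mul' _ _ hK, lintegral_lintegral_swap hm2.aemeasurable]
        simp only [lintegral_ball_rotate hm]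
    _ = _ := by
        simp only [lintegral_const, Measure.restrict_apply, MeasurableSet.univ, univ_inter, Real.volume_Ioc,
          sub_zero]
        ring

end subMean

section shift

open Metric

variable {d : ℕ}

/-- Translation of a function on the tube by `iεe₀`. -/
def shiftI (ε : ℝ) (G : (Fin (d + 2) → ℂ) → ℂ) (z : Fin (d + 2) → ℂ) : ℂ := G (z + cpt 0 (ε • e0))

lemma cpt_add (x y x' y' : Fin (d + 2) → ℝ) : cpt x y + cpt x' y' = cpt (x + x') (y + y') := by
  ext i; simp [cpt]; ring

lemma cpt_re_imP (z : Fin (d + 2) → ℂ) : cpt (fun i => (z i).re) (imP z) = z := by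
  ext i; exact Complex.re_add_im (z i)

lemma imP_add (z w : Fin (d + 2) → ℂ) : imP (z + w) = imP z + imP w := by
  ext i; simp [imP]

lemma shiftI_mem {ε : ℝ} (hε : 0 < ε) {z : Fin (d + 2) → ℂ} (hz : z ∈ tube (d + 2)) :
    z + cpt 0 (ε • e0) ∈ tube (d + 2) := by
  rw [tube, mem_ofPred_eq, imP_add, imP_cpt]
  exact add_mem_cone hz (smul_mem_cone e0_mem hε)

lemma differentiableOn_shiftI {ε : ℝ} (hε : 0 < ε) {G : (Fin (d + 2) → ℂ) → ℂ}
    (hG : DifferentiableOn ℂ G (tube (d + 2))) : DifferentiableOn ℂ (shiftI ε G) (tube (d + 2)) :=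
  hG.comp (by fun_prop) fun _ hz => shiftI_mem hε hz

lemma mixInt_shiftI_le {p s ε : ℝ} (hs : 0 ≤ s) (hε : 0 < ε) {G : (Fin (d + 2) → ℂ) → ℂ}
    (hG : ContinuousOn G (tube (d + 2))) : mixInt d p s (shiftI ε G) ≤ mixInt d p s G := by
  set G' := (tube (d + 2)).indicator G with hG'
  have hEq : EqOn G G' (tube (d + 2)) := fun z hz => (Set.indicator_of_mem hz _).symm
  have hEq' : EqOn (shiftI ε G) (shiftI ε G') (tube (d + 2)) := fun z hz => hEq (shiftI_mem hε hz)
  have hm : Measurable G' := measurable_indicator_tube hG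
  have hm' : Measurable (shiftI ε G') := hm.comp (measurable_id.add_const _)
  rw [mixInt_congr hEq, mixInt_congr hEq', mixInt_eq hm, mixInt_eq hm', ← lintegral_indicator
    isOpen_cone.measurableSet, ← lintegral_indicator isOpen_cone.measurableSet]
  refine le_trans (lintegral_mono fun v => ?_) (lintegral_add_right_eq_self _ (ε • e0)).le
  by_cases hv : v ∈ cone (d + 2)
  · have hv' := add_mem_cone hv (smul_mem_cone e0_mem hε)
    rw [indicator_of_mem hv, indicator_of_mem hv']
    simp only [shiftI, cpt_add, add_zero]
    exact mul_le_mul_right (ENNReal.ofReal_le_ofReal (Real.rpow_le_rpow hv.1.le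
      (lor_le_add hv (smul_mem_cone e0_mem hε)) hs)) _
  · rw [indicator_of_notMem hv]; exact zero_le

lemma norm_shiftI_le {p s ε : ℝ} (hp : 1 ≤ p) (hs : 0 ≤ s) (hε : 0 < ε) {G : (Fin (d + 2) → ℂ) → ℂ}
    (hG : DifferentiableOn ℂ G (tube (d + 2))) (hfin : mixInt d p s G ≠ ⊤) :
    ∃ M : ℝ, ∀ z ∈ tube (d + 2), ‖shiftI ε G z‖ ≤ M := by
  have hp0 : 0 ≤ p := by linarith
  set G' := (tube (d + 2)).indicator G with hG'
  have hEq : EqOn G G' (tube (d + 2)) := fun z hz => (Set.indicator_of_mem hz _).symm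
  have hm : Measurable G' := measurable_indicator_tube hG.continuousOn
  have hGd : DifferentiableOn ℂ G' (tube (d + 2)) := hG.congr fun z hz => (hEq hz).symm
  rw [mixInt_congr hEq] at hfin
  obtain ⟨K, hK, hsub⟩ := norm_rpow_mul_volume_le (n := d + 2) hp
  have hy0 : (ε / 2) • (e0 : Fin (d + 2) → ℝ) ∈ cone (d + 2) := smul_mem_cone e0_mem (half_pos hε)
  obtain ⟨r, hr, hball⟩ := Metric.isOpen_iff.1 isOpen_cone _ hy0
  set c := lor ((ε / 2) • (e0 : Fin (d + 2) → ℝ)) ^ s with hc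
  have hc0 : 0 < c := Real.rpow_pos_of_pos hy0.1 _
  have hV : volume (ball (0 : Fin (d + 2) → ℂ) r) ≠ 0 := (isOpen_ball.measure_pos _ ⟨0, mem_ball_self hr⟩).ne'
  have hVt : volume (ball (0 : Fin (d + 2) → ℂ) r) ≠ ⊤ := measure_ball_lt_top.ne
  set B := K * (ENNReal.ofReal c⁻¹ * mixInt d p s G') / volume (ball (0 : Fin (d + 2) → ℂ) r) with hB
  have hBt : B ≠ ⊤ := ENNReal.div_ne_top (by finiteness) hV
  refine ⟨1 + B.toReal, fun z hz => ?_⟩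
  have hw : ∀ w ∈ ball (z + cpt 0 (ε • e0)) r, w ∈ tube (d + 2) ∧ c ≤ lor (imP w) ^ s := by
    intro w hw
    have h1 : imP w - imP z - (ε / 2) • e0 ∈ cone (d + 2) := by
      refine hball ?_
      rw [mem_ball, dist_eq_norm, pi_norm_lt_iff hr] at hw ⊢
      intro i
      refine lt_of_le_of_lt ?_ (hw i)
      refine le_trans (le_of_eq ?_) (Complex.abs_im_le_norm _)
      simp [imP, cpt]
      ring_nf
    have h2 := add_mem_cone hz hy0
    have e : imP w = (ε / 2) • e0 + (imP z + (imP w - imP z - (ε / 2) • e0)) := by abel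
    have h3 : imP z + (imP w - imP z - (ε / 2) • e0) ∈ cone (d + 2) := add_mem_cone hz h1
    refine ⟨?_, Real.rpow_le_rpow hy0.1.le ?_ hs⟩
    · rw [tube, mem_ofPred_eq, e]; exact add_mem_cone hy0 h3
    · rw [e]; exact lor_le_add hy0 h3
  have h4 : ∫⁻ w in ball (z + cpt 0 (ε • e0)) r, ENNReal.ofReal (‖G' w‖ ^ p) ≤
      ENNReal.ofReal c⁻¹ * mixInt d p s G' := by
    have e : mixInt d p s G' = ∫⁻ w in tube (d + 2), ENNReal.ofReal (‖G' w‖ ^ p * lor (imP w) ^ s) := by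
      rw [lintegral_tube, mixInt]; simp only [imP_cpt]
    rw [e, ← lintegral_const_mul' _ _ ENNReal.ofReal_ne_top]
    refine (setLIntegral_mono' isOpen_ball.measurableSet fun w h => ?_).trans
      (lintegral_mono_set fun w h => (hw w h).1)
    rw [← ENNReal.ofReal_mul (by positivity)]
    refine ENNReal.ofReal_le_ofReal ?_
    rw [mul_left_comm]
    refine le_mul_of_one_le_right (by positivity) ?_
    rw [inv_mul_eq_div, one_le_div hc0]
    exact (hw w h).2
  have h5 : ENNReal.ofReal (‖shiftI ε G z‖ ^ p) ≤ B := by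
    rw [hB, ENNReal.le_div_iff_mul_le (Or.inl hV) (Or.inl hVt), shiftI, hEq (shiftI_mem hε hz)]
    exact (hsub hm (hGd.mono fun w h => (hw w h).1)).trans (mul_le_mul_right h4 _)
  have h6 := (ENNReal.ofReal_le_iff_le_toReal hBt).1 h5
  rcases le_total ‖shiftI ε G z‖ 1 with h | h
  · have : 0 ≤ B.toReal := ENNReal.toReal_nonneg
    linarith
  · have := Real.self_le_rpow_of_one_le h hp
    linarith

end shift

section contourShift

open Metric

variable {d : ℕ}

lemma one_add_norm_rpow_neg_le {E : Type*} [NormedAddCommGroup E] {M R : ℝ} (hM : 0 ≤ M) {u : E} (hu : ‖u‖ ≤ R)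
    (x : E) : (1 + ‖x + u‖) ^ (-M) ≤ (1 + R) ^ M * (1 + ‖x‖) ^ (-M) := by
  have hR : 0 ≤ R := (norm_nonneg u).trans hu
  have h1 : ‖x‖ ≤ ‖x + u‖ + ‖u‖ := by simpa using norm_sub_le (x + u) u
  have h2 : 1 + ‖x‖ ≤ (1 + R) * (1 + ‖x + u‖) := by nlinarith [norm_nonneg (x + u)]
  have h3 := Real.rpow_le_rpow (by positivity) h2 hM
  rw [Real.mul_rpow (by positivity) (by positivity)] at h3
  rw [Real.rpow_neg (by positivity), Real.rpow_neg (by positivity), ← div_eq_mul_inv, inv_eq_one_div,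
    div_le_div_iff₀ (by positivity) (by positivity)]
  linarith

lemma hasDerivAt_integral_line {Φ : (Fin (d + 2) → ℂ) → ℂ} (hΦ : DifferentiableOn ℂ Φ (tube (d + 2))) {M : ℝ}
    (hM : ((d + 2 : ℕ) : ℝ) < M) {E : (Fin (d + 2) → ℝ) → ℝ} (hE : Continuous E)
    (hb : ∀ x, ∀ y ∈ cone (d + 2), ‖Φ (cpt x y)‖ ≤ E y * (1 + ‖x‖) ^ (-M)) (y h : Fin (d + 2) → ℝ) {ζ₀ : ℂ}
    (hζ₀ : y + ζ₀.im • h ∈ cone (d + 2)) :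
    HasDerivAt (fun ζ : ℂ => ∫ x, Φ (cpt (x + ζ.re • h) (y + ζ.im • h)))
      (∫ x, fderiv ℂ Φ (cpt x y + ζ₀ • toC h) (toC h)) ζ₀ := by
  have hM0 : 0 ≤ M := le_trans (by positivity) hM.le
  have hV : IsOpen {ζ : ℂ | y + ζ.im • h ∈ cone (d + 2)} :=
    isOpen_cone.preimage (by fun_prop : Continuous fun ζ : ℂ => y + ζ.im • h)
  obtain ⟨R', hR', hball⟩ := Metric.isOpen_iff.1 hV ζ₀ hζ₀
  set R := R' / 3 with hR
  have hR0 : 0 < R := by positivity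
  obtain ⟨B, hB⟩ := (isCompact_closedBall ζ₀ (2 * R)).exists_bound_of_continuousOn
    (f := fun ζ : ℂ => E (y + ζ.im • h)) (by fun_prop : Continuous fun ζ : ℂ => E (y + ζ.im • h)).continuousOn
  have hmem : ∀ ζ ∈ closedBall ζ₀ (2 * R), y + ζ.im • h ∈ cone (d + 2) := fun ζ hζ =>
    hball (closedBall_subset_ball (by rw [hR]; linarith) hζ)
  set ρ := (‖ζ₀‖ + 2 * R) * ‖h‖ with hρ
  set A : (Fin (d + 2) → ℝ) → ℝ := fun x => B * ((1 + ρ) ^ M * (1 + ‖x‖) ^ (-M)) with hA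
  have hAi : Integrable A := by
    refine ((integrable_one_add_norm (E := Fin (d + 2) → ℝ) (r := M) ?_).const_mul _).const_mul _
    rwa [Module.finrank_fin_fun]
  have hbd : ∀ ζ ∈ closedBall ζ₀ (2 * R), ∀ x, ‖Φ (cpt x y + ζ • toC h)‖ ≤ A x := by
    intro ζ hζ x
    rw [cpt_add_smul_toC]
    refine (hb _ _ (hmem ζ hζ)).trans ?_
    refine mul_le_mul ((le_abs_self _).trans (hB ζ hζ)) (one_add_norm_rpow_neg_le hM0 ?_ x) (by positivity)
      ((norm_nonneg _).trans (hB ζ hζ))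
    rw [norm_smul, hρ]
    refine mul_le_mul_of_nonneg_right ((Complex.abs_re_le_norm ζ).trans ?_) (norm_nonneg _)
    have := norm_le_norm_add_norm_sub' ζ ζ₀
    rw [mem_closedBall, dist_eq_norm] at hζ
    linarith
  have hd : ∀ ζ ∈ closedBall ζ₀ (2 * R), ∀ x, HasDerivAt (fun ζ : ℂ => Φ (cpt x y + ζ • toC h))
      (fderiv ℂ Φ (cpt x y + ζ • toC h) (toC h)) ζ := by
    intro ζ hζ x
    have hz : cpt x y + ζ • toC h ∈ tube (d + 2) := by
      rw [cpt_add_smul_toC, cpt_mem_tube]; exact hmem ζ hζ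
    have h1 := (hΦ.differentiableAt (isOpen_tube.mem_nhds hz)).hasFDerivAt
    have h2 : HasDerivAt (fun ζ : ℂ => cpt x y + ζ • toC h) (toC h) ζ := by
      simpa using ((hasDerivAt_id ζ).smul_const (toC h)).const_add (cpt x y)
    exact h1.comp_hasDerivAt ζ h2
  have hdb : ∀ ζ ∈ ball ζ₀ R, ∀ x, ‖fderiv ℂ Φ (cpt x y + ζ • toC h) (toC h)‖ ≤ A x / R := by
    intro ζ hζ x
    have hsub : closedBall ζ R ⊆ closedBall ζ₀ (2 * R) := by
      refine closedBall_subset_closedBall' ?_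
      rw [mem_ball] at hζ; linarith
    rw [← (hd ζ (hsub (mem_closedBall_self hR0.le)) x).deriv]
    refine Complex.norm_deriv_le_of_forall_mem_sphere_norm_le hR0 ?_
      fun w hw => hbd w (hsub (sphere_subset_closedBall hw)) x
    refine DifferentiableOn.diffContOnCl_ball (U := closedBall ζ₀ (2 * R)) (fun w hw =>
      (hd w hw x).differentiableAt.differentiableWithinAt) hsub
  have hc : ∀ ζ ∈ closedBall ζ₀ (2 * R), Continuous fun x => Φ (cpt x y + ζ • toC h) := by
    intro ζ hζ
    refine hΦ.continuousOn.comp_continuous ?_ fun x => ?_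
    · have := continuous_cpt.comp (f := fun x : Fin (d + 2) → ℝ => (x, y)) (by fun_prop)
      exact this.add continuous_const
    · rw [cpt_add_smul_toC, cpt_mem_tube]; exact hmem ζ hζ
  have hmc : Measurable fun x => cpt x y + ζ₀ • toC h :=
    (measurable_cpt_pair measurable_id measurable_const).add_const _
  have hin : ∀ ζ ∈ ball ζ₀ R, ζ ∈ closedBall ζ₀ (2 * R) := fun ζ hζ =>
    ball_subset_closedBall (ball_subset_ball (by linarith) hζ)
  have key := (hasDerivAt_integral_of_dominated_loc_of_deriv_le (μ := volume) (bound := fun x => A x / R)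
    (F := fun ζ x => Φ (cpt x y + ζ • toC h)) (F' := fun ζ x => fderiv ℂ Φ (cpt x y + ζ • toC h) (toC h))
    (x₀ := ζ₀) (ball_mem_nhds ζ₀ hR0)
    (Filter.eventually_of_mem (ball_mem_nhds ζ₀ hR0) fun ζ hζ => (hc ζ (hin ζ hζ)).aestronglyMeasurable)
    (hAi.mono' (hc ζ₀ (mem_closedBall_self (by positivity))).aestronglyMeasurable
      (Filter.Eventually.of_forall fun x => hbd ζ₀ (mem_closedBall_self (by positivity)) x))
    ((measurable_fderiv_apply_const ℂ _ _).comp hmc).aestronglyMeasurable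
    (Filter.Eventually.of_forall fun x ζ hζ => hdb ζ hζ x) (hAi.div_const R)
    (Filter.Eventually.of_forall fun x ζ hζ => hd ζ (hin ζ hζ) x)).2
  simp only [cpt_add_smul_toC] at key
  simp only [cpt_add_smul_toC]
  exact key

lemma integral_contour_shift {Φ : (Fin (d + 2) → ℂ) → ℂ} (hΦ : DifferentiableOn ℂ Φ (tube (d + 2))) {M : ℝ}
    (hM : ((d + 2 : ℕ) : ℝ) < M) {E : (Fin (d + 2) → ℝ) → ℝ} (hE : Continuous E)
    (hb : ∀ x, ∀ y ∈ cone (d + 2), ‖Φ (cpt x y)‖ ≤ E y * (1 + ‖x‖) ^ (-M)) {y y' : Fin (d + 2) → ℝ}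
    (hy : y ∈ cone (d + 2)) (hy' : y' ∈ cone (d + 2)) : ∫ x, Φ (cpt x y') = ∫ x, Φ (cpt x y) := by
  set h := y' - y with hh
  set f : ℂ → ℂ := fun ζ => ∫ x, Φ (cpt (x + ζ.re • h) (y + ζ.im • h)) with hf
  have hmem : ∀ t ∈ Icc (0 : ℝ) 1, y + t • h ∈ cone (d + 2) := fun t ht =>
    convex_cone.add_smul_sub_mem hy hy' ht
  have hre : ∀ ζ : ℂ, f ζ = f (ζ.im * I) := by
    intro ζ
    simp only [hf]
    rw [integral_add_right_eq_self (fun x => Φ (cpt x (y + ζ.im • h))) (ζ.re • h)]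
    simp
  have hder : ∀ t ∈ Icc (0 : ℝ) 1, HasDerivAt (fun t : ℝ => f (t * I)) 0 t := by
    intro t ht
    have h1 := hasDerivAt_integral_line hΦ hM hE hb y h (ζ₀ := t * I) (by simpa using hmem t ht)
    set D := ∫ x, fderiv ℂ Φ (cpt x y + (t * I : ℂ) • toC h) (toC h)
    have h2 : HasDerivAt (fun s : ℝ => f (s + t * I)) (D * 1) 0 := by
      refine HasDerivAt.comp (h₂ := f) (0 : ℝ) ?_ ((ofRealCLM.hasDerivAt (x := (0 : ℝ))).add_const (t * I))
      simpa using h1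
    have h3 : (fun s : ℝ => f (s + t * I)) = fun _ => f (t * I) := by
      funext s; rw [hre]; simp
    rw [h3, mul_one] at h2
    have hD : D = 0 := h2.unique (hasDerivAt_const _ _)
    have h4 : HasDerivAt (fun s : ℝ => f (s * I)) (D * (1 * I)) t :=
      HasDerivAt.comp (h₂ := f) t h1 ((ofRealCLM.hasDerivAt (x := t)).mul_const I)
    rwa [hD, zero_mul] at h4
  have := constant_of_has_deriv_right_zero (fun t ht => (hder t ht).continuousAt.continuousWithinAt)
    (fun t ht => (hder t (Ico_subset_Icc_self ht)).hasDerivWithinAt) 1 (right_mem_Icc.2 zero_le_one)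
  simpa [hf, hh] using this

end contourShift

section paleyWiener

variable {d : ℕ}

lemma prR_self (x : Fin (d + 2) → ℝ) : prR x x = lor x := by
  simp only [prR, lor, sq, mul_assoc]

lemma lor_add_smul_e0 (ξ : Fin (d + 2) → ℝ) (c : ℝ) : lor (ξ + c • e0) = lor ξ + c ^ 2 + 2 * c * ξ 0 := by
  rw [lor_add, prR_smul_right, prR_comm, prR_e0, lor_smul, ← prR_self (e0 : Fin (d + 2) → ℝ), prR_e0]
  simp [e0]; ring

lemma exists_prR_neg {ξ : Fin (d + 2) → ℝ} (h : ξ ∉ cone (d + 2)) (hf : ξ ∉ frontier (cone (d + 2))) :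
    ∃ y ∈ cone (d + 2), prR y ξ < 0 := by
  rcases lt_or_ge (ξ 0) 0 with h0 | h0
  · exact ⟨e0, e0_mem, by rwa [prR_e0]⟩
  rcases lt_or_ge (lor ξ) 0 with hl | hl
  · set R := √(ξ 0 ^ 2 - lor ξ) with hR
    have hR2 : R ^ 2 = ξ 0 ^ 2 - lor ξ := Real.sq_sqrt (by nlinarith)
    have hR1 : ξ 0 < R := Real.lt_sqrt_of_sq_lt (by linarith)
    have hs : 0 < R + ξ 0 := by linarith
    set ρ := 2 * R ^ 2 / (R + ξ 0) with hρ
    have h1 : R < ρ := by rw [hρ, lt_div_iff₀ hs]; nlinarith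
    have h2 : ρ * ξ 0 < R ^ 2 := by
      rw [hρ, div_mul_eq_mul_div, div_lt_iff₀ hs]; nlinarith [mul_pos (sq_pos_of_pos (h0.trans_lt hR1)) (sub_pos.2 hR1)]
    refine ⟨ξ + (ρ - ξ 0) • e0, ⟨?_, ?_⟩, ?_⟩
    · rw [lor_add_smul_e0]; nlinarith
    · simp [e0]; linarith
    · rw [prR_add_left, prR_smul_left, prR_e0, prR_self]; nlinarith
  · exfalso
    refine hf ?_
    rw [isOpen_cone.frontier_eq]
    refine ⟨?_, h⟩
    have hc : Filter.Tendsto (fun t : ℝ => ξ + t • (e0 : Fin (d + 2) → ℝ)) (nhdsWithin 0 (Ioi 0)) (nhds ξ) := by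
      have : Continuous fun t : ℝ => ξ + t • (e0 : Fin (d + 2) → ℝ) := by fun_prop
      simpa using (this.tendsto 0).mono_left nhdsWithin_le_nhds
    refine mem_closure_of_tendsto hc (Filter.eventually_of_mem self_mem_nhdsWithin fun t ht => ?_)
    rw [mem_Ioi] at ht
    refine ⟨?_, ?_⟩
    · rw [lor_add_smul_e0]; positivity
    · simp [e0]; positivity

lemma cexp_neg_prC_cpt (x y ξ : Fin (d + 2) → ℝ) :
    cexp (-(I * prC (cpt x y) ξ)) = Real.exp (prR y ξ) * cexp (-(I * prR x ξ)) := by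
  rw [Complex.exp_neg, cexp_prC_cpt, mul_inv, ← Complex.exp_neg, ofReal_exp, ofReal_exp, ← Complex.exp_neg]
  simp

lemma exists_eqOn_lapT {H : (Fin (d + 2) → ℂ) → ℂ} (hH : DifferentiableOn ℂ H (tube (d + 2))) {M C : ℝ}
    (hM : ((d + 2 : ℕ) : ℝ) < M) (hb : ∀ x, ∀ y ∈ cone (d + 2), ‖H (cpt x y)‖ ≤ C * (1 + ‖x‖) ^ (-M)) :
    ∃ g : (Fin (d + 2) → ℝ) → ℂ, Measurable g ∧ (∃ B, ∀ ξ, ‖g ξ‖ ≤ B) ∧ EqOn H (lapT g) (tube (d + 2)) := by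
  set A := ∫ x : Fin (d + 2) → ℝ, C * (1 + ‖x‖) ^ (-M) with hA
  have hAi : Integrable fun x : Fin (d + 2) → ℝ => C * (1 + ‖x‖) ^ (-M) := by
    refine (integrable_one_add_norm (E := Fin (d + 2) → ℝ) (r := M) ?_).const_mul _
    rwa [Module.finrank_fin_fun]
  have hcont : ∀ y ∈ cone (d + 2), Continuous fun x => H (cpt x y) := by
    intro y hy
    refine hH.continuousOn.comp_continuous ?_ fun x => cpt_mem_tube.2 hy
    exact continuous_cpt.comp (f := fun x : Fin (d + 2) → ℝ => (x, y)) (by fun_prop)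
  have hint : ∀ y ∈ cone (d + 2), Integrable fun x => H (cpt x y) := fun y hy =>
    hAi.mono' (hcont y hy).aestronglyMeasurable (.of_forall fun x => hb x y hy)
  set g₀ : (Fin (d + 2) → ℝ) → ℂ := fun ξ => ∫ x, H (cpt x e0) * cexp (-(I * prC (cpt x e0) ξ)) with hg₀
  have hshift : ∀ y ∈ cone (d + 2), ∀ ξ, g₀ ξ = ∫ x, H (cpt x y) * cexp (-(I * prC (cpt x y) ξ)) := by
    intro y hy ξ
    refine integral_contour_shift (Φ := fun z => H z * cexp (-(I * prC z ξ))) ?_ hM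
      (E := fun y => C * Real.exp (prR y ξ)) ?_ ?_ hy e0_mem
    · refine hH.mul (Differentiable.differentiableOn ?_)
      unfold prC
      fun_prop
    · have := continuous_prR (d := d)
      fun_prop
    · intro x y hy
      rw [norm_mul, cexp_neg_prC_cpt, norm_mul, norm_cexp_neg_I_mul, mul_one, norm_real, Real.norm_of_nonneg
        (Real.exp_pos _).le, mul_right_comm]
      exact mul_le_mul_of_nonneg_right (hb x y hy) (Real.exp_pos _).le
  have hg₀y : ∀ y ∈ cone (d + 2), ∀ ξ, g₀ ξ = Real.exp (prR y ξ) * ∫ x, H (cpt x y) * cexp (-(I * prR x ξ)) := by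
    intro y hy ξ
    rw [hshift y hy, ← integral_const_mul]
    refine integral_congr_ae (.of_forall fun x => ?_)
    simp only [cexp_neg_prC_cpt]; ring
  have hle : ∀ y ∈ cone (d + 2), ∀ ξ, ‖g₀ ξ‖ ≤ Real.exp (prR y ξ) * A := by
    intro y hy ξ
    rw [hg₀y y hy, norm_mul, norm_real, Real.norm_of_nonneg (Real.exp_pos _).le]
    refine mul_le_mul_of_nonneg_left (norm_integral_le_of_norm_le hAi (.of_forall fun x => ?_)) (Real.exp_pos _).le
    rw [norm_mul, norm_cexp_neg_I_mul, mul_one]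
    exact hb x y hy
  have hgm : Measurable g₀ := by
    refine StronglyMeasurable.measurable (StronglyMeasurable.integral_prod_right
      (f := fun ξ x => H (cpt x e0) * cexp (-(I * prC (cpt x e0) ξ))) (Continuous.stronglyMeasurable ?_))
    have h1 := (hcont e0 e0_mem).comp (continuous_snd (X := Fin (d + 2) → ℝ))
    have h2 : Continuous fun q : (Fin (d + 2) → ℝ) × (Fin (d + 2) → ℝ) => prC (cpt q.2 e0) q.1 := by
      refine continuous_prC.comp (f := fun q : (Fin (d + 2) → ℝ) × (Fin (d + 2) → ℝ) => (cpt q.2 e0, q.1)) ?_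
      refine Continuous.prodMk (continuous_cpt.comp
        (f := fun q : (Fin (d + 2) → ℝ) × (Fin (d + 2) → ℝ) => (q.2, e0)) (by fun_prop)) (by fun_prop)
    exact h1.mul (by fun_prop : Continuous fun q : (Fin (d + 2) → ℝ) × (Fin (d + 2) → ℝ) =>
      cexp (-(I * prC (cpt q.2 e0) q.1)))
  have htend : ∀ ξ : Fin (d + 2) → ℝ, Filter.Tendsto (fun t : ℝ => Real.exp (prR (t • e0) ξ) * A) (nhdsWithin 0 (Ioi 0))
      (nhds A) := by
    intro ξ
    simp only [prR_smul_left]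
    have : Continuous fun t : ℝ => Real.exp (t * prR e0 ξ) * A := by fun_prop
    simpa using (this.tendsto 0).mono_left nhdsWithin_le_nhds
  have hbound : ∀ ξ, ‖g₀ ξ‖ ≤ A := fun ξ => ge_of_tendsto (htend ξ)
    (Filter.eventually_of_mem self_mem_nhdsWithin fun t ht => hle _ (smul_mem_cone e0_mem ht) ξ)
  have hzero : ∀ ξ, (∃ y ∈ cone (d + 2), prR y ξ < 0) → g₀ ξ = 0 := by
    rintro ξ ⟨y, hy, hneg⟩
    have h1 : Filter.Tendsto (fun t : ℝ => Real.exp (prR (t • y) ξ) * A) Filter.atTop (nhds 0) := by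
      simp only [prR_smul_left]
      have := (Real.tendsto_exp_atBot.comp (Filter.tendsto_id.atTop_mul_const_of_neg hneg)).mul_const A
      simpa using this
    have h2 : ‖g₀ ξ‖ ≤ 0 := ge_of_tendsto h1 ((Filter.eventually_gt_atTop 0).mono fun t ht =>
      hle _ (smul_mem_cone hy ht) ξ)
    simpa using h2
  have hae : ∀ᵐ ξ, g₀ ξ = (cone (d + 2)).indicator g₀ ξ := by
    have hnull : volume (frontier (cone (d + 2))) = 0 := convex_cone.addHaar_frontier _
    filter_upwards [measure_eq_zero_iff_ae_notMem.1 hnull] with ξ hξ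
    by_cases h : ξ ∈ cone (d + 2)
    · rw [indicator_of_mem h]
    · rw [indicator_of_notMem h]; exact hzero ξ (exists_prR_neg h hξ)
  have hLI := LI_of_bounded hgm hbound
  refine ⟨fun ξ => ((2 * Real.pi : ℝ) ^ (d + 2) : ℂ)⁻¹ * g₀ ξ, hgm.const_mul _,
    ⟨‖((2 * Real.pi : ℝ) ^ (d + 2) : ℂ)⁻¹‖ * A, fun ξ => ?_⟩, fun z hz => ?_⟩
  · rw [norm_mul]; exact mul_le_mul_of_nonneg_left (hbound ξ) (norm_nonneg _)
  · set y := imP z with hy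
    set x : Fin (d + 2) → ℝ := fun i => (z i).re with hx
    have hz' : z = cpt x y := (cpt_re_imP z).symm
    have hyc : y ∈ cone (d + 2) := hz
    have hhat : ∀ ξ, (∫ x, H (cpt x y) * cexp (-(I * prR x ξ))) = Real.exp (-prR y ξ) * g₀ ξ := by
      intro ξ
      rw [hg₀y y hyc, ← mul_assoc, ← ofReal_mul, ← Real.exp_add]; simp
    have hhat' : ∀ ξ, (∫ x, H (cpt x y) * cexp (-(I * prR ξ x))) = Real.exp (-prR y ξ) * g₀ ξ := by
      intro ξ; rw [← hhat]; simp only [prR_comm ξ]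
    have hKi : Integrable fun ξ => ∫ x, H (cpt x y) * cexp (-(I * prR ξ x)) := by
      simp only [hhat']
      have h1 : Integrable ((cone (d + 2)).indicator fun ξ => g₀ ξ * Real.exp (-prR y ξ)) := by
        rw [integrable_indicator_iff isOpen_cone.measurableSet]
        refine (hLI.2 y hyc).mono' (Measurable.aestronglyMeasurable ?_) (.of_forall fun ξ => ?_)
        · have := measurable_prR y; fun_prop
        · rw [norm_mul, norm_real, Real.norm_of_nonneg (Real.exp_pos _).le]
      refine h1.congr (hae.mono fun ξ hξ => ?_)
      simp only
      rw [hξ]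
      by_cases h : ξ ∈ cone (d + 2)
      · simp only [indicator_of_mem h]; ring
      · simp only [indicator_of_notMem h]; ring
    have inv := fourier_inversion (hcont y hyc) (hint y hyc) hKi x
    simp only [hhat'] at inv
    have e : ∫ ξ, Real.exp (-prR y ξ) * g₀ ξ * cexp (I * prR ξ x) = lapT g₀ z := by
      rw [lapT, ← integral_indicator isOpen_cone.measurableSet]
      refine integral_congr_ae (hae.mono fun ξ hξ => ?_)
      simp only
      rw [hξ]
      by_cases h : ξ ∈ cone (d + 2)
      · simp only [indicator_of_mem h, hz', cexp_prC_cpt, prR_comm ξ]; ring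
      · simp only [indicator_of_notMem h]; ring
    rw [e] at inv
    have hpi : ((2 * Real.pi : ℝ) ^ (d + 2) : ℂ) ≠ 0 := by
      exact_mod_cast (pow_pos Real.two_pi_pos _).ne'
    have e2 : lapT (fun ξ => ((2 * Real.pi : ℝ) ^ (d + 2) : ℂ)⁻¹ * g₀ ξ) z =
        ((2 * Real.pi : ℝ) ^ (d + 2) : ℂ)⁻¹ * lapT g₀ z := by
      simp only [lapT, mul_assoc]
      rw [integral_const_mul]
    rw [e2, inv, ← hz', inv_mul_cancel_left₀ hpi]

end paleyWiener

section damping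

variable {d : ℕ}

lemma mixInt_le_of_decay {p μ : ℝ} (hp : 2 ≤ p) (hμ : (d : ℝ) / 2 < μ) (hμp : (d : ℝ) / 2 * (p - 2) < μ)
    (m : ℕ) : ∃ C : ℝ≥0∞, C ≠ ⊤ ∧ ∀ {H : (Fin (d + 2) → ℂ) → ℂ}, DifferentiableOn ℂ H (tube (d + 2)) →
      ∀ {M A : ℝ}, ((d + 2 : ℕ) : ℝ) < M → (∀ x, ∀ y ∈ cone (d + 2), ‖H (cpt x y)‖ ≤ A * (1 + ‖x‖) ^ (-M)) →
      mixInt d p (μ - d / 2 - 1) H ≤ C * mixInt d p (μ - d / 2 - 1 + m * p) (BoxOp^[m] H) := by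
  obtain ⟨C, hC, h⟩ := mixInt_lapT_le (d := d) hp hμ hμp m
  refine ⟨C, hC, fun {H} hH {M A} hM hb => ?_⟩
  obtain ⟨g, hg, ⟨B, hB⟩, hE⟩ := exists_eqOn_lapT hH hM hb
  have e : μ - d / 2 - 1 + m * p = μ + m * p - d / 2 - 1 := by ring
  rw [mixInt_congr hE, e, mixInt_congr
    ((BoxOp_iterate_congr isOpen_tube hE m).trans ((LI_of_bounded hg hB).BoxOp_iterate m))]
  exact h g hg ⟨B, hB⟩

/-- The factors of the damping function. -/
def dampFactor (δ : ℝ) (z : Fin (d + 2) → ℂ) (j : Fin (d + 2)) : ℂ := 1 - I * δ * (z 0 + z j / 2)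

/-- A holomorphic function on the tube, bounded by `1`, decaying at infinity and close to `1` for small `δ`. -/
def damp (δ : ℝ) (z : Fin (d + 2) → ℂ) : ℂ := (∏ j, dampFactor δ z j)⁻¹ ^ (d + 3)

lemma one_le_norm_dampFactor {δ : ℝ} (hδ : 0 < δ) {z : Fin (d + 2) → ℂ} (hz : z ∈ tube (d + 2))
    (j : Fin (d + 2)) : 1 ≤ ‖dampFactor δ z j‖ := by
  have h1 := abs_le.1 (abs_le_zero_coord hz j)
  have h2 : 0 < imP z 0 := hz.2
  have h3 : (dampFactor δ z j).re = 1 + δ * (imP z 0 + imP z j / 2) := by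
    simp [dampFactor, imP]
  have h4 : 0 ≤ δ * (imP z 0 + imP z j / 2) := mul_nonneg hδ.le (by linarith)
  exact le_trans (by rw [h3]; linarith) (Complex.re_le_norm _)

lemma abs_re_le_norm_dampFactor {δ : ℝ} (hδ : 0 < δ) (z : Fin (d + 2) → ℂ) (j : Fin (d + 2)) :
    |(z 0).re + (z j).re / 2| ≤ δ⁻¹ * ‖dampFactor δ z j‖ := by
  have h3 : (dampFactor δ z j).im = -(δ * ((z 0).re + (z j).re / 2)) := by
    simp [dampFactor]
  have := Complex.abs_im_le_norm (dampFactor δ z j)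
  rw [h3, abs_neg, abs_mul, abs_of_pos hδ] at this
  rw [inv_mul_eq_div, le_div_iff₀ hδ]
  linarith

lemma norm_dampFactor_le_prod {δ : ℝ} (hδ : 0 < δ) {z : Fin (d + 2) → ℂ} (hz : z ∈ tube (d + 2))
    (j : Fin (d + 2)) : ‖dampFactor δ z j‖ ≤ ‖∏ j, dampFactor δ z j‖ := by
  rw [norm_prod, ← Finset.mul_prod_erase _ _ (Finset.mem_univ j)]
  exact le_mul_of_one_le_right (norm_nonneg _)
    (Finset.one_le_prod fun i _ => one_le_norm_dampFactor hδ hz i)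

lemma one_le_norm_prod_dampFactor {δ : ℝ} (hδ : 0 < δ) {z : Fin (d + 2) → ℂ} (hz : z ∈ tube (d + 2)) :
    1 ≤ ‖∏ j, dampFactor δ z j‖ :=
  (one_le_norm_dampFactor hδ hz 0).trans (norm_dampFactor_le_prod hδ hz 0)

lemma one_add_norm_le_prod_dampFactor {δ : ℝ} (hδ : 0 < δ) {x y : Fin (d + 2) → ℝ} (hy : y ∈ cone (d + 2)) :
    1 + ‖x‖ ≤ (1 + 4 * δ⁻¹) * ‖∏ j, dampFactor δ (cpt x y) j‖ := by
  have hz : cpt x y ∈ tube (d + 2) := cpt_mem_tube.2 hy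
  have hP := one_le_norm_prod_dampFactor hδ hz
  have hj : ∀ j, |x 0 + x j / 2| ≤ δ⁻¹ * ‖∏ j, dampFactor δ (cpt x y) j‖ := fun j => by
    have h1 := abs_re_le_norm_dampFactor hδ (cpt x y) j
    simp only [cpt, add_re, ofReal_re, mul_re, I_re, ofReal_im, I_im, mul_zero, zero_mul, sub_zero, add_zero] at h1
    exact h1.trans (mul_le_mul_of_nonneg_left (norm_dampFactor_le_prod hδ hz j) (by positivity))
  have hx : ‖x‖ ≤ 4 * (δ⁻¹ * ‖∏ j, dampFactor δ (cpt x y) j‖) := by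
    refine (pi_norm_le_iff_of_nonneg (by positivity)).2 fun j => ?_
    have h0 := abs_le.1 (hj 0)
    have h1 := abs_le.1 (hj j)
    rw [Real.norm_eq_abs, abs_le]
    constructor <;> linarith
  linarith

lemma norm_damp_le_one {δ : ℝ} (hδ : 0 < δ) {z : Fin (d + 2) → ℂ} (hz : z ∈ tube (d + 2)) : ‖damp δ z‖ ≤ 1 := by
  rw [damp, norm_pow, norm_inv]
  exact pow_le_one₀ (by positivity) (inv_le_one_of_one_le₀ (one_le_norm_prod_dampFactor hδ hz))

lemma norm_damp_le {δ : ℝ} (hδ : 0 < δ) {x y : Fin (d + 2) → ℝ} (hy : y ∈ cone (d + 2)) :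
    ‖damp δ (cpt x y)‖ ≤ (1 + 4 * δ⁻¹) ^ (d + 3) * (1 + ‖x‖) ^ (-((d + 3 : ℕ) : ℝ)) := by
  have hP := one_le_norm_prod_dampFactor hδ (cpt_mem_tube (x := x).2 hy)
  rw [damp, norm_pow, norm_inv, Real.rpow_neg (by positivity), Real.rpow_natCast, ← inv_pow, ← mul_pow]
  refine pow_le_pow_left₀ (by positivity) ?_ _
  rw [← div_eq_mul_inv, le_div_iff₀ (by positivity), inv_mul_le_iff₀ (by positivity), mul_comm ‖_‖]
  exact one_add_norm_le_prod_dampFactor hδ hy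

lemma differentiableOn_damp {δ : ℝ} (hδ : 0 < δ) : DifferentiableOn ℂ (damp (d := d) δ) (tube (d + 2)) := by
  unfold damp
  refine (DifferentiableOn.inv ?_ fun z hz h => ?_).pow _
  · refine fun z _ => DifferentiableAt.differentiableWithinAt ?_
    refine (HasFDerivAt.finsetProd fun j _ => DifferentiableAt.hasFDerivAt ?_).differentiableAt
    unfold dampFactor
    fun_prop
  · have := one_le_norm_prod_dampFactor hδ hz
    rw [h, norm_zero] at this
    linarith

lemma tendsto_damp (z : Fin (d + 2) → ℂ) :
    Filter.Tendsto (fun k : ℕ => damp (1 / ((k : ℝ) + 1)) z) Filter.atTop (nhds 1) := by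
  have h : ContinuousAt (fun δ : ℝ => damp δ z) 0 := by
    unfold damp dampFactor
    refine (ContinuousAt.inv₀ ?_ (by simp)).pow _
    fun_prop
  have h0 : damp 0 z = 1 := by simp [damp, dampFactor]
  have := h.tendsto.comp tendsto_one_div_add_atTop_nhds_zero_nat
  rwa [h0] at this

end damping

section linearity

variable {d : ℕ}

lemma pd_add {n : ℕ} [NeZero n] {F G : (Fin n → ℂ) → ℂ} {U : Set (Fin n → ℂ)} (hU : IsOpen U)
    (hF : DifferentiableOn ℂ F U) (hG : DifferentiableOn ℂ G U) (j : Fin n) :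
    EqOn (pd j (F + G)) (pd j F + pd j G) U := fun z hz => by
  simp only [pd, Pi.add_apply]
  rw [fderiv_add (hF.differentiableAt (hU.mem_nhds hz)) (hG.differentiableAt (hU.mem_nhds hz))]
  rfl

lemma BoxOp_add {n : ℕ} [NeZero n] {F G : (Fin n → ℂ) → ℂ} {U : Set (Fin n → ℂ)} (hU : IsOpen U)
    (hF : DifferentiableOn ℂ F U) (hG : DifferentiableOn ℂ G U) :
    EqOn (BoxOp (F + G)) (BoxOp F + BoxOp G) U := fun z hz => by
  have h : ∀ j, pd j (pd j (F + G)) z = pd j (pd j F) z + pd j (pd j G) z := fun j =>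
    ((pd_congr hU (pd_add hU hF hG j) j).trans
      (pd_add hU (differentiableOn_pd hU hF j) (differentiableOn_pd hU hG j) j)) hz
  simp only [BoxOp, Pi.add_apply, h, Finset.sum_add_distrib]
  ring

lemma BoxOp_iterate_add {n : ℕ} [NeZero n] {F G : (Fin n → ℂ) → ℂ} {U : Set (Fin n → ℂ)} (hU : IsOpen U)
    (hF : DifferentiableOn ℂ F U) (hG : DifferentiableOn ℂ G U) (m : ℕ) :
    EqOn (BoxOp^[m] (F + G)) (BoxOp^[m] F + BoxOp^[m] G) U := by
  induction m with
  | zero => exact fun _ _ => rfl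
  | succ m ih =>
    simp only [Function.iterate_succ_apply']
    exact (BoxOp_congr hU ih).trans
      (BoxOp_add hU (differentiableOn_BoxOp_iterate hU hF m) (differentiableOn_BoxOp_iterate hU hG m))

lemma aemeasurable_norm_rpow_mul_lor_rpow {p s : ℝ} {F : (Fin (d + 2) → ℂ) → ℂ}
    (hF : ContinuousOn F (tube (d + 2))) :
    AEMeasurable (fun q => ENNReal.ofReal (‖F (cpt q.2 q.1)‖ ^ p * lor q.1 ^ s)) (cvol d) := by
  have hL := (continuous_lor (n := d + 2)).measurable
  have h1 : Measurable fun q : (Fin (d + 2) → ℝ) × (Fin (d + 2) → ℝ) =>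
      (tube (d + 2)).indicator F (cpt q.2 q.1) :=
    (measurable_indicator_tube hF).comp (measurable_cpt_pair measurable_snd measurable_fst)
  refine ⟨_, ((h1.norm.pow_const p).mul ((hL.comp measurable_fst).pow_const s)).ennreal_ofReal,
    ae_mem_cvol.mono fun q hq => ?_⟩
  simp only [Pi.mul_apply, indicator_of_mem (cpt_mem_tube.2 hq), Function.comp_apply]

lemma mixInt_le_of_norm_le_add {p s : ℝ} (hp : 1 ≤ p) {F A B : (Fin (d + 2) → ℂ) → ℂ}
    (hA : ContinuousOn A (tube (d + 2))) (h : ∀ z ∈ tube (d + 2), ‖F z‖ ≤ ‖A z‖ + ‖B z‖) :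
    mixInt d p s F ≤ 2 ^ (p - 1) * (mixInt d p s A + mixInt d p s B) := by
  have hp0 : 0 ≤ p := by linarith
  have h2 : (2 : ℝ≥0∞) ^ (p - 1) ≠ ⊤ := by finiteness
  rw [mixInt, mixInt, mixInt, ← lintegral_add_left' (aemeasurable_norm_rpow_mul_lor_rpow hA),
    ← lintegral_const_mul' _ _ h2]
  refine lintegral_mono_ae (ae_mem_cvol.mono fun q hq => ?_)
  have hs : 0 ≤ lor q.1 ^ s := Real.rpow_nonneg hq.1.le _
  simp only [ENNReal.ofReal_mul (Real.rpow_nonneg (norm_nonneg _) p), ← add_mul, ← mul_assoc,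
    ← ENNReal.ofReal_rpow_of_nonneg (norm_nonneg _) hp0]
  refine mul_le_mul_left (le_trans ?_ (ENNReal.rpow_add_le_mul_rpow_add_rpow _ _ hp)) _
  refine ENNReal.rpow_le_rpow ?_ hp0
  rw [← ENNReal.ofReal_add (norm_nonneg _) (norm_nonneg _)]
  exact ENNReal.ofReal_le_ofReal (h _ (cpt_mem_tube.2 hq))

lemma mixInt_BoxOp_iterate_le {p s : ℝ} (hp : 1 ≤ p) (m : ℕ) : ∃ C : ℝ≥0∞, C ≠ ⊤ ∧
    ∀ {G : (Fin (d + 2) → ℂ) → ℂ}, DifferentiableOn ℂ G (tube (d + 2)) →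
      mixInt d p (s + m * p) (BoxOp^[m] G) ≤ C * mixInt d p s G := by
  induction m with
  | zero => exact ⟨1, by finiteness, fun {G} _ => by simp⟩
  | succ m ih =>
    obtain ⟨C, hC, h⟩ := ih
    obtain ⟨C', hC', h'⟩ := mixInt_BoxOp_le (d := d) (s := s + m * p) hp
    refine ⟨C' * C, by finiteness, fun {G} hG => ?_⟩
    have e : s + (m + 1 : ℕ) * p = s + m * p + p := by push_cast; ring
    rw [Function.iterate_succ_apply', e, mul_assoc]
    exact (h' (differentiableOn_BoxOp_iterate isOpen_tube hG m)).trans (mul_le_mul_right (h hG) _)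

lemma tendsto_mixInt_damp {p s : ℝ} (hp : 1 ≤ p) {G : (Fin (d + 2) → ℂ) → ℂ}
    (hG : ContinuousOn G (tube (d + 2))) (hfin : mixInt d p s G ≠ ⊤) :
    Filter.Tendsto (fun k : ℕ => mixInt d p s fun z => (damp (1 / ((k : ℝ) + 1)) z - 1) * G z) Filter.atTop
      (nhds 0) := by
  have hp0 : 0 < p := by linarith
  have hδ : ∀ k : ℕ, 0 < 1 / ((k : ℝ) + 1) := fun k => by positivity
  simp only [mixInt]
  rw [← lintegral_zero (μ := cvol d)]
  refine tendsto_lintegral_of_dominated_convergence'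
    (fun q => ENNReal.ofReal (2 ^ p) * ENNReal.ofReal (‖G (cpt q.2 q.1)‖ ^ p * lor q.1 ^ s)) (fun k => ?_)
    (fun k => ?_) ?_ ?_
  · have h1 : ContinuousOn (fun z => (damp (1 / ((k : ℝ) + 1)) z - 1) * G z) (tube (d + 2)) :=
      ((differentiableOn_damp (hδ k)).sub_const 1).continuousOn.mul hG
    have h2 := aemeasurable_norm_rpow_mul_lor_rpow (p := p) (s := s) h1
    exact h2
  · refine ae_mem_cvol.mono fun q hq => ?_
    have hs : 0 ≤ lor q.1 ^ s := Real.rpow_nonneg hq.1.le _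
    beta_reduce
    rw [← ENNReal.ofReal_mul (by positivity), ← mul_assoc, ← Real.mul_rpow (by norm_num) (norm_nonneg _)]
    refine ENNReal.ofReal_le_ofReal (mul_le_mul_of_nonneg_right ?_ hs)
    refine Real.rpow_le_rpow (norm_nonneg _) ?_ hp0.le
    rw [norm_mul]
    refine mul_le_mul_of_nonneg_right ((norm_sub_le _ _).trans ?_) (norm_nonneg _)
    have := norm_damp_le_one (hδ k) (cpt_mem_tube (x := q.2).2 hq)
    rw [norm_one]
    linarith
  · rw [lintegral_const_mul' _ _ ENNReal.ofReal_ne_top]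
    exact ENNReal.mul_ne_top ENNReal.ofReal_ne_top hfin
  · refine .of_forall fun q => ?_
    have h1 := ((tendsto_damp (cpt q.2 q.1)).sub_const 1).mul_const (G (cpt q.2 q.1))
    have h2 := ((h1.norm.rpow_const (p := p) (Or.inr hp0.le)).mul_const (lor q.1 ^ s))
    have h3 := ENNReal.tendsto_ofReal h2
    simpa [Real.zero_rpow hp0.ne'] using h3

lemma mixInt_le_of_bounded {p μ : ℝ} (hp : 2 ≤ p) (hμ : (d : ℝ) / 2 < μ) (hμp : (d : ℝ) / 2 * (p - 2) < μ)
    (m : ℕ) : ∃ C : ℝ≥0∞, C ≠ ⊤ ∧ ∀ {G : (Fin (d + 2) → ℂ) → ℂ}, DifferentiableOn ℂ G (tube (d + 2)) →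
      (∃ B, ∀ z ∈ tube (d + 2), ‖G z‖ ≤ B) → mixInt d p (μ - d / 2 - 1) G ≠ ⊤ →
      mixInt d p (μ - d / 2 - 1) G ≤ C * mixInt d p (μ - d / 2 - 1 + m * p) (BoxOp^[m] G) := by
  have hp1 : 1 ≤ p := by linarith
  set s := μ - d / 2 - 1 with hs
  obtain ⟨C₀, hC₀, h₀⟩ := mixInt_le_of_decay (d := d) hp hμ hμp m
  obtain ⟨C₁, hC₁, h₁⟩ := mixInt_BoxOp_iterate_le (d := d) (s := s) hp1 m
  rw [← hs] at h₀
  set K : ℝ≥0∞ := 2 ^ (p - 1) with hK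
  have hKt : K ≠ ⊤ := by rw [hK]; finiteness
  refine ⟨K * (C₀ * K), by finiteness, fun {G} hG ⟨B, hB⟩ hfin => ?_⟩
  have hδ : ∀ k : ℕ, 0 < 1 / ((k : ℝ) + 1) := fun k => by positivity
  set X := mixInt d p (s + m * p) (BoxOp^[m] G) with hX
  set D : ℕ → (Fin (d + 2) → ℂ) → ℂ := fun k z => (damp (1 / ((k : ℝ) + 1)) z - 1) * G z with hD
  have hDd : ∀ k, DifferentiableOn ℂ (D k) (tube (d + 2)) := fun k =>
    ((differentiableOn_damp (hδ k)).sub_const 1).mul hG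
  have hHd : ∀ k, DifferentiableOn ℂ (G + D k) (tube (d + 2)) := fun k => hG.add (hDd k)
  have hH : ∀ k z, (G + D k) z = damp (1 / ((k : ℝ) + 1)) z * G z := fun k z => by
    simp only [hD, Pi.add_apply]; ring
  have hk : ∀ k, mixInt d p s G ≤ K * (C₀ * K) * X + K * (C₀ * (K * C₁) + 1) * mixInt d p s (D k) := by
    intro k
    have h2 : mixInt d p s G ≤ K * (mixInt d p s (G + D k) + mixInt d p s (D k)) := by
      refine mixInt_le_of_norm_le_add hp1 (hHd k).continuousOn fun z _ => ?_
      have : G z = (G + D k) z - D k z := by simp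
      rw [this]
      exact norm_sub_le _ _
    have h3 : mixInt d p s (G + D k) ≤ C₀ * mixInt d p (s + m * p) (BoxOp^[m] (G + D k)) := by
      refine h₀ (hHd k) (M := ((d + 3 : ℕ) : ℝ)) (A := (1 + 4 * (1 / ((k : ℝ) + 1))⁻¹) ^ (d + 3) * B)
        (by push_cast; linarith) fun x y hy => ?_
      have hB' := hB _ (cpt_mem_tube (x := x).2 hy)
      rw [hH, norm_mul, mul_right_comm]
      exact mul_le_mul (norm_damp_le (hδ k) hy) hB' (norm_nonneg _) (by positivity)
    have h4 : mixInt d p (s + m * p) (BoxOp^[m] (G + D k)) ≤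
        K * (X + mixInt d p (s + m * p) (BoxOp^[m] (D k))) := by
      refine mixInt_le_of_norm_le_add hp1
        (differentiableOn_BoxOp_iterate isOpen_tube hG m).continuousOn fun z hz => ?_
      rw [BoxOp_iterate_add isOpen_tube hG (hDd k) m hz]
      exact norm_add_le _ _
    have h5 := h₁ (hDd k)
    calc mixInt d p s G ≤ K * (C₀ * (K * (X + C₁ * mixInt d p s (D k))) + mixInt d p s (D k)) := by
          grw [h2, h3, h4, h5]
      _ = _ := by ring
  have hlim := (ENNReal.Tendsto.const_mul (a := K * (C₀ * (K * C₁) + 1))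
    (tendsto_mixInt_damp hp1 hG.continuousOn hfin) (Or.inr (by finiteness))).const_add (K * (C₀ * K) * X)
  rw [mul_zero, add_zero] at hlim
  exact ge_of_tendsto' hlim hk

end linearity

section hardy

variable {d : ℕ}

lemma BoxOp_shiftI (ε : ℝ) (G : (Fin (d + 2) → ℂ) → ℂ) : BoxOp (shiftI ε G) = shiftI ε (BoxOp G) := by
  have h : ∀ F : (Fin (d + 2) → ℂ) → ℂ, ∀ j, pd j (shiftI ε F) = shiftI ε (pd j F) := fun F j => by
    funext z
    simp only [pd]
    exact DFunLike.congr_fun (fderiv_comp_add_right (f := F) (x := z) _) _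
  funext z
  simp only [BoxOp, h]
  simp only [shiftI, BoxOp]

lemma BoxOp_iterate_shiftI (ε : ℝ) (G : (Fin (d + 2) → ℂ) → ℂ) (m : ℕ) :
    BoxOp^[m] (shiftI ε G) = shiftI ε (BoxOp^[m] G) :=
  (Function.Semiconj.iterate_right (f := shiftI ε) (fun F => (BoxOp_shiftI ε F).symm) m G).symm

lemma tendsto_shiftI {G : (Fin (d + 2) → ℂ) → ℂ} (hG : ContinuousOn G (tube (d + 2))) {z : Fin (d + 2) → ℂ}
    (hz : z ∈ tube (d + 2)) :
    Filter.Tendsto (fun k : ℕ => shiftI (1 / ((k : ℝ) + 1)) G z) Filter.atTop (nhds (G z)) := by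
  have h1 : ContinuousAt (fun ε : ℝ => z + cpt 0 (ε • e0)) 0 := by
    unfold cpt
    fun_prop
  have e : z + cpt 0 ((0 : ℝ) • e0) = z := by
    funext i; simp [cpt]
  have h2 : Filter.Tendsto (fun k : ℕ => z + cpt 0 ((1 / ((k : ℝ) + 1)) • e0)) Filter.atTop (nhds z) := by
    have := h1.tendsto.comp tendsto_one_div_add_atTop_nhds_zero_nat
    rwa [e] at this
  exact (hG.continuousAt (isOpen_tube.mem_nhds hz)).tendsto.comp h2

lemma mixInt_le_mixInt_BoxOp_iterate {p μ : ℝ} (hp : 2 ≤ p) (hμ : (d : ℝ) / 2 + 1 ≤ μ)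
    (hμp : (d : ℝ) / 2 * (p - 2) < μ)
    (m : ℕ) : ∃ C : ℝ≥0∞, C ≠ ⊤ ∧ ∀ {G : (Fin (d + 2) → ℂ) → ℂ}, DifferentiableOn ℂ G (tube (d + 2)) →
      mixInt d p (μ - d / 2 - 1) G ≠ ⊤ →
      mixInt d p (μ - d / 2 - 1) G ≤ C * mixInt d p (μ - d / 2 - 1 + m * p) (BoxOp^[m] G) := by
  have hp0 : 0 ≤ p := by linarith
  obtain ⟨C, hC, h⟩ := mixInt_le_of_bounded (d := d) hp (by linarith) hμp m
  have hs : 0 ≤ μ - d / 2 - 1 := by linarith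
  have hs' : 0 ≤ μ - d / 2 - 1 + m * p := by positivity
  refine ⟨C, hC, fun {G} hG hfin => ?_⟩
  have hδ : ∀ k : ℕ, 0 < 1 / ((k : ℝ) + 1) := fun k => by positivity
  refine lintegral_le_of_tendsto_of_le
    (fun k => aemeasurable_norm_rpow_mul_lor_rpow (p := p) (s := μ - d / 2 - 1)
      (differentiableOn_shiftI (hδ k) hG).continuousOn)
    (ae_mem_cvol.mono fun q hq => ?_) fun k => ?_
  · exact ENNReal.tendsto_ofReal ((((tendsto_shiftI hG.continuousOn (cpt_mem_tube.2 hq)).norm).rpow_const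
      (Or.inr hp0)).mul_const _)
  · have h1 := h (differentiableOn_shiftI (hδ k) hG) (norm_shiftI_le (by linarith) hs (hδ k) hG hfin)
      (ne_top_of_le_ne_top hfin (mixInt_shiftI_le hs (hδ k) hG.continuousOn))
    rw [BoxOp_iterate_shiftI] at h1
    exact h1.trans (mul_le_mul_right
      (mixInt_shiftI_le hs' (hδ k) (differentiableOn_BoxOp_iterate isOpen_tube hG m).continuousOn) _)

end hardy

/-- Lemma: `‖□F‖_{L^p_{ν+p}} ≤ C ‖□^{m+1}F‖_{L^p_{ν+(m+1)p}}` on `A^p_ν`. -/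
theorem hardy_higher_order (n : ℕ) [NeZero n] (hn : 3 ≤ n) (ν p : ℝ)
    (hν : (n : ℝ) / 2 - 1 < ν) (hp1 : 2 ≤ p)
    (hp2 : p ≤ (ν + (n : ℝ) - 1) / ((n : ℝ) / 2 - 1)) :
    ∀ m : ℕ, 1 ≤ m → ∃ C : ℝ, ∀ F, memA n p ν F →
      lpInt n p (ν + p) (BoxOp F) ≤
        ENNReal.ofReal C * lpInt n p (ν + (m + 1) * p) (BoxOp^[m + 1] F) := by
  intro m _
  obtain ⟨d, rfl⟩ : ∃ d, n = d + 2 := ⟨n - 2, by omega⟩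
  have hd : (1 : ℝ) ≤ d := by exact_mod_cast (by omega : 1 ≤ d)
  push_cast at hν hp2
  rw [le_div_iff₀ (by linarith)] at hp2
  obtain ⟨C, hC, h⟩ := mixInt_le_mixInt_BoxOp_iterate (d := d) (μ := ν + p) hp1 (by linarith)
    (by linarith) m
  obtain ⟨C', hC', h'⟩ := mixInt_BoxOp_le (d := d) (p := p) (s := ν - d / 2 - 1) (by linarith)
  refine ⟨C.toReal, fun F ⟨hF, hfin⟩ => ?_⟩
  rw [lpInt_eq_mixInt] at hfin
  rw [lpInt_eq_mixInt, lpInt_eq_mixInt, ENNReal.ofReal_toReal hC, Function.iterate_succ_apply]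
  have e1 : ν + p - d / 2 - 1 = ν - d / 2 - 1 + p := by ring
  have e2 : ν + (m + 1) * p - d / 2 - 1 = ν + p - d / 2 - 1 + m * p := by ring
  rw [e2]
  refine h (differentiableOn_BoxOp isOpen_tube hF) (ne_top_of_le_ne_top ?_ (e1 ▸ h' hF))
  exact ENNReal.mul_ne_top hC' hfin.ne
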